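/- Let G be a compact subgroup of O(n) whose action on ℝ^n admits a section Σ, and assume the generalized Weyl group W = W(Σ) is finite of order m. Let M and N be DC-weight sequences with N strongly regular and sup_{k≥1} (M_{km}/N_k)^{1/k} < ∞. Then every W-invariant function f ∈ C^M(Σ) has a G-invariant extension of class C^N: there exists a G-invariant function f̃ ∈ C^N(ℝ^n) with f̃(s) = f(s) for all s ∈ Σ. -/

import Mathlib

open scoped Nat ENNReal
open Matrix

/-- `f` belongs to the Denjoy–Carleman class `C^M` on the open set `U`. -/
def CMClassOn {E F : Type*} [NormedAddCommGroup E] [NormedSpace ℝ E]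
    [NormedAddCommGroup F] [NormedSpace ℝ F]
    (M : ℕ → ℝ) (U : Set E) (f : E → F) : Prop :=
  ContDiffOn ℝ (⊤ : ℕ∞) f U ∧
    ∀ K : Set E, K ⊆ U → IsCompact K →
      ∃ C > (0 : ℝ), ∃ ρ > (0 : ℝ), ∀ k : ℕ, ∀ x ∈ K,
        ‖iteratedFDerivWithin ℝ k f U x‖ ≤ C * ρ ^ k * (k ! : ℝ) * M k

/-- DC-weight sequence: `M 0 = 1`, positive, increasing, logarithmically convex,
and `sup_k (M (k+1) / M k) ^ (1/k) < ∞`. -/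
def DCWeightSeq (M : ℕ → ℝ) : Prop :=
  M 0 = 1 ∧ (∀ k, 0 < M k) ∧ (∀ k, M k ≤ M (k + 1)) ∧
    (∀ k : ℕ, 1 ≤ k → M k ^ 2 ≤ M (k - 1) * M (k + 1)) ∧
    ∃ C : ℝ, ∀ k : ℕ, 1 ≤ k → (M (k + 1) / M k) ^ ((1 : ℝ) / k) ≤ C

/-- Strong regularity: strong non-quasianalyticity together with moderate growth. -/
def StronglyRegular (N : ℕ → ℝ) : Prop :=
  (∃ C > (0 : ℝ), ∀ j : ℕ,
      ∑' k : ℕ, N (j + k) / (((j + k + 1 : ℕ) : ℝ) * N (j + k + 1)) ≤ C * (N j / N (j + 1))) ∧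
    ∃ C : ℝ, ∀ j k : ℕ, 1 ≤ j → 1 ≤ k →
      (N (j + k) / (N j * N k)) ^ ((1 : ℝ) / ((j : ℝ) + (k : ℝ))) ≤ C

section LieAlgebra

open NormedSpace Filter Topology

variable {E : Type*} [NormedAddCommGroup E] [InnerProductSpace ℝ E]

/-- A compact group of linear isometries, as a set of continuous linear maps. -/
structure IsIsometryGroup (G : Set (E →L[ℝ] E)) : Prop where
  one_mem : (1 : E →L[ℝ] E) ∈ G
  mul_mem : ∀ g ∈ G, ∀ h ∈ G, g * h ∈ G
  inv_mem : ∀ g ∈ G, ∃ h ∈ G, h * g = 1 ∧ g * h = 1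
  norm_map : ∀ g ∈ G, ∀ x, ‖g x‖ = ‖x‖
  isCompact : IsCompact G

theorem IsIsometryGroup.inner_map {G : Set (E →L[ℝ] E)} (hG : IsIsometryGroup G)
    {g : E →L[ℝ] E} (hg : g ∈ G) (x y : E) : inner ℝ (g x) (g y) = inner ℝ x y := by
  let L : E →ₗᵢ[ℝ] E := ⟨g.toLinearMap, hG.norm_map g hg⟩
  exact L.inner_map_map x y

theorem IsIsometryGroup.injective {G : Set (E →L[ℝ] E)} (hG : IsIsometryGroup G)
    {g : E →L[ℝ] E} (hg : g ∈ G) : Function.Injective g := by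
  let L : E →ₗᵢ[ℝ] E := ⟨g.toLinearMap, hG.norm_map g hg⟩
  exact L.injective

theorem IsIsometryGroup.pow_mem {G : Set (E →L[ℝ] E)} (hG : IsIsometryGroup G)
    {g : E →L[ℝ] E} (hg : g ∈ G) (k : ℕ) : g ^ k ∈ G := by
  induction k with
  | zero => simpa using hG.one_mem
  | succ k ih => rw [pow_succ]; exact hG.mul_mem _ ih _ hg

variable [FiniteDimensional ℝ E]

theorem clm_exp_add {A B : E →L[ℝ] E} (h : Commute A B) : exp (A + B) = exp A * exp B := by
  let _ := NormedAlgebra.restrictScalars ℚ ℝ (E →L[ℝ] E)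
  exact exp_add_of_commute h

theorem clm_exp_continuous : Continuous (exp : (E →L[ℝ] E) → (E →L[ℝ] E)) := by
  let _ := NormedAlgebra.restrictScalars ℚ ℝ (E →L[ℝ] E)
  exact exp_continuous

theorem clm_exp_nsmul (k : ℕ) (A : E →L[ℝ] E) : exp (k • A) = exp A ^ k := by
  let _ := NormedAlgebra.restrictScalars ℚ ℝ (E →L[ℝ] E)
  exact exp_nsmul k A

theorem clm_exp_mul_exp_neg (A : E →L[ℝ] E) : exp A * exp (-A) = 1 := by
  rw [← clm_exp_add (Commute.refl A).neg_right]; simp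

theorem clm_exp_neg_mul_exp (A : E →L[ℝ] E) : exp (-A) * exp A = 1 := by
  rw [← clm_exp_add (Commute.refl A).neg_left]; simp

theorem contDiff_clm_exp : ContDiff ℝ ⊤ (exp : (E →L[ℝ] E) → (E →L[ℝ] E)) := by
  rw [contDiff_iff_contDiffAt]
  intro x
  exact (NormedSpace.exp_analytic (𝕂 := ℝ) x).contDiffAt

theorem clm_exp_conj {g h : E →L[ℝ] E} (h1 : h * g = 1) (h2 : g * h = 1) (A : E →L[ℝ] E) :
    exp (g * A * h) = g * exp A * h := by
  let _ := NormedAlgebra.restrictScalars ℚ ℝ (E →L[ℝ] E)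
  exact exp_units_conj (⟨g, h, h2, h1⟩ : (E →L[ℝ] E)ˣ) A

/-- The generators of one-parameter subgroups contained in `G`. -/
def lieSet (G : Set (E →L[ℝ] E)) : Set (E →L[ℝ] E) := {A | ∀ t : ℝ, exp (t • A) ∈ G}

theorem mem_lieSet_of_tendsto {G : Set (E →L[ℝ] E)} (hG : IsIsometryGroup G)
    {B : ℕ → E →L[ℝ] E} {c : ℕ → ℝ} {A : E →L[ℝ] E} (hB : Tendsto B atTop (𝓝 0))
    (hc : Tendsto (fun k => c k • B k) atTop (𝓝 A)) (hBG : ∀ᶠ k in atTop, exp (B k) ∈ G) :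
    A ∈ lieSet G := by
  intro t
  have hInt : ∀ᶠ k in atTop, exp ((⌊t * c k⌋ : ℝ) • B k) ∈ G := by
    filter_upwards [hBG] with k hk
    obtain ⟨m, hm | hm⟩ := Int.eq_nat_or_neg ⌊t * c k⌋
    · rw [hm, Int.cast_natCast, Nat.cast_smul_eq_nsmul, clm_exp_nsmul]
      exact hG.pow_mem hk m
    · rw [hm, Int.cast_neg, Int.cast_natCast, neg_smul, Nat.cast_smul_eq_nsmul]
      obtain ⟨h, hh, h1, -⟩ := hG.inv_mem _ (hG.pow_mem hk m)
      have : exp (-(m • B k)) = h := by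
        rw [← clm_exp_nsmul] at h1
        calc exp (-(m • B k)) = (h * exp (m • B k)) * exp (-(m • B k)) := by rw [h1, one_mul]
          _ = h := by rw [mul_assoc, clm_exp_mul_exp_neg, mul_one]
      rwa [this]
  have hlim : Tendsto (fun k => (⌊t * c k⌋ : ℝ) • B k) atTop (𝓝 (t • A)) := by
    have h1 : Tendsto (fun k => t • (c k • B k)) atTop (𝓝 (t • A)) := hc.const_smul t
    have h2 : Tendsto (fun k => Int.fract (t * c k) • B k) atTop (𝓝 0) := by
      apply squeeze_zero_norm (a := fun k => ‖B k‖)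
      · intro k
        rw [norm_smul, Real.norm_eq_abs, abs_of_nonneg (Int.fract_nonneg _)]
        exact mul_le_of_le_one_left (norm_nonneg _) (Int.fract_lt_one _).le
      · simpa using hB.norm
    have h3 := h1.sub h2
    rw [sub_zero] at h3
    refine h3.congr fun k => ?_
    rw [smul_smul, ← sub_smul, Int.self_sub_fract]
  exact hG.isCompact.isClosed.mem_of_tendsto ((clm_exp_continuous.tendsto _).comp hlim) hInt

omit [FiniteDimensional ℝ E] in
theorem smul_mem_lieSet {G : Set (E →L[ℝ] E)} {A : E →L[ℝ] E} (hA : A ∈ lieSet G) (r : ℝ) :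
    r • A ∈ lieSet G := by
  intro t
  rw [smul_smul]
  exact hA _

theorem add_mem_lieSet {G : Set (E →L[ℝ] E)} (hG : IsIsometryGroup G) {A B : E →L[ℝ] E}
    (hA : A ∈ lieSet G) (hB : B ∈ lieSet G) : A + B ∈ lieSet G := by
  have hs : HasStrictFDerivAt (exp : (E →L[ℝ] E) → (E →L[ℝ] E))
      ((ContinuousLinearEquiv.refl ℝ (E →L[ℝ] E) : (E →L[ℝ] E) ≃L[ℝ] (E →L[ℝ] E)) :
        (E →L[ℝ] E) →L[ℝ] (E →L[ℝ] E)) 0 := by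
    have := hasStrictFDerivAt_exp_zero (𝕂 := ℝ) (𝔸 := E →L[ℝ] E)
    exact this
  set lg := hs.localInverse with hlg
  have hl : HasFDerivAt lg (ContinuousLinearMap.id ℝ (E →L[ℝ] E)) 1 := by
    have := hs.to_localInverse.hasFDerivAt
    rw [exp_zero] at this
    exact this
  have hl0 : lg 1 = 0 := by
    have := hs.localInverse_apply_image
    rwa [exp_zero] at this
  have hr : ∀ᶠ y in 𝓝 (1 : E →L[ℝ] E), exp (lg y) = y := by
    have := hs.eventually_right_inverse
    rwa [exp_zero] at this
  have hA' : HasDerivAt (fun t : ℝ => exp (t • A)) A 0 := by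
    simpa using hasDerivAt_exp_smul_const (𝕂 := ℝ) A (0 : ℝ)
  have hB' : HasDerivAt (fun t : ℝ => exp (t • B)) B 0 := by
    simpa using hasDerivAt_exp_smul_const (𝕂 := ℝ) B (0 : ℝ)
  have hp : HasDerivAt (fun t : ℝ => exp (t • A) * exp (t • B)) (A + B) 0 := by
    have := hA'.mul hB'
    simp only [zero_smul, exp_zero, mul_one, one_mul] at this
    exact this
  have hc : HasDerivAt (fun t : ℝ => lg (exp (t • A) * exp (t • B))) (A + B) 0 := by
    have hl' : HasFDerivAt lg (ContinuousLinearMap.id ℝ (E →L[ℝ] E))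
        (exp ((0 : ℝ) • A) * exp ((0 : ℝ) • B)) := by simpa using hl
    exact hl'.comp_hasDerivAt (0 : ℝ) hp
  have hz : (fun t : ℝ => lg (exp (t • A) * exp (t • B))) 0 = 0 := by simp [hl0]
  have hu : Tendsto (fun k : ℕ => (1 / ((k : ℝ) + 1))) atTop (𝓝 0) :=
    tendsto_one_div_add_atTop_nhds_zero_nat
  have hu' : Tendsto (fun k : ℕ => (1 / ((k : ℝ) + 1))) atTop (𝓝[≠] 0) :=
    tendsto_nhdsWithin_iff.2 ⟨hu, Eventually.of_forall fun k => by
      have : (0 : ℝ) < 1 / ((k : ℝ) + 1) := by positivity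
      exact this.ne'⟩
  refine mem_lieSet_of_tendsto hG
    (B := fun k : ℕ => lg (exp ((1 / ((k : ℝ) + 1)) • A) * exp ((1 / ((k : ℝ) + 1)) • B)))
    (c := fun k : ℕ => (1 / ((k : ℝ) + 1))⁻¹) ?_ ?_ ?_
  · have := hc.continuousAt.tendsto.comp hu
    simp only [zero_smul, exp_zero, mul_one, hl0] at this
    exact this
  · have h := (hasDerivAt_iff_tendsto_slope.1 hc).comp hu'
    refine h.congr fun k => ?_
    simp only [Function.comp, slope_def_module, hz]
    simp
  · have : Tendsto (fun t : ℝ => exp (t • A) * exp (t • B)) (𝓝 0) (𝓝 1) := by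
      simpa using hp.continuousAt.tendsto
    filter_upwards [(this.comp hu).eventually hr] with k hk
    simp only [Function.comp] at hk
    rw [hk]
    exact hG.mul_mem _ (hA _) _ (hB _)

/-- The Lie algebra of a compact group of isometries, as a linear subspace. -/
def lieSubmodule {G : Set (E →L[ℝ] E)} (hG : IsIsometryGroup G) : Submodule ℝ (E →L[ℝ] E) where
  carrier := lieSet G
  add_mem' := fun hA hB => add_mem_lieSet hG hA hB
  zero_mem' := fun t => by simpa using hG.one_mem
  smul_mem' := fun r _ hA => smul_mem_lieSet hA r

theorem mem_lieSubmodule {G : Set (E →L[ℝ] E)} (hG : IsIsometryGroup G) {A : E →L[ℝ] E} :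
    A ∈ lieSubmodule hG ↔ ∀ t : ℝ, exp (t • A) ∈ G := Iff.rfl

theorem conj_mem_lieSubmodule {G : Set (E →L[ℝ] E)} (hG : IsIsometryGroup G) {A g h : E →L[ℝ] E}
    (hA : A ∈ lieSubmodule hG) (hg : g ∈ G) (hh : h ∈ G) (h1 : h * g = 1) (h2 : g * h = 1) :
    g * A * h ∈ lieSubmodule hG := by
  intro t
  have : t • (g * A * h) = g * (t • A) * h := by
    rw [mul_smul_comm, smul_mul_assoc]
  rw [this, clm_exp_conj h1 h2]
  exact hG.mul_mem _ (hG.mul_mem _ hg _ (hA t)) _ hh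

theorem hasDerivAt_clm_exp_apply (A : E →L[ℝ] E) (x : E) (t : ℝ) :
    HasDerivAt (fun u : ℝ => exp (u • A) x) (exp (t • A) (A x)) t := by
  have := (hasDerivAt_exp_smul_const (𝕂 := ℝ) A t)
  have h2 := (ContinuousLinearMap.apply ℝ E x).hasFDerivAt.comp_hasDerivAt t this
  exact h2

theorem hasDerivAt_clm_exp_apply_zero (A : E →L[ℝ] E) (x : E) :
    HasDerivAt (fun u : ℝ => exp (u • A) x) (A x) 0 := by
  simpa using hasDerivAt_clm_exp_apply A x 0

theorem inner_lie_skew {G : Set (E →L[ℝ] E)} (hG : IsIsometryGroup G) {A : E →L[ℝ] E}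
    (hA : A ∈ lieSubmodule hG) (x y : E) : inner ℝ (A x) y = - inner ℝ x (A y) := by
  have h1 := (hasDerivAt_clm_exp_apply_zero A x).inner ℝ (hasDerivAt_clm_exp_apply_zero A y)
  have h2 : (fun u : ℝ => inner ℝ (exp (u • A) x) (exp (u • A) y)) = fun _ => inner ℝ x y := by
    funext u
    exact hG.inner_map (hA u) x y
  rw [h2] at h1
  have := h1.unique (hasDerivAt_const (0 : ℝ) (inner ℝ x y : ℝ))
  simp at this
  linarith

end LieAlgebra

section Section

open NormedSpace Filter Topology

variable {E : Type*} [NormedAddCommGroup E] [InnerProductSpace ℝ E] [FiniteDimensional ℝ E]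

theorem clm_exp_smul_apply_of_apply_eq_zero {A : E →L[ℝ] E} {x : E} (h : A x = 0) (t : ℝ) :
    exp (t • A) x = x := by
  have h1 : ∀ t : ℝ, HasDerivAt (fun u : ℝ => exp (u • A) x) 0 t := fun t => by
    simpa [h] using hasDerivAt_clm_exp_apply A x t
  have h2 := is_const_of_deriv_eq_zero (fun t => (h1 t).differentiableAt)
    (fun t => (h1 t).deriv) t 0
  simpa using h2

/-- A linear section of an isometric action: it meets all orbits, orthogonally. -/
structure IsLinearSection {G : Set (E →L[ℝ] E)} (hG : IsIsometryGroup G) (S : Submodule ℝ E) :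
    Prop where
  meets : ∀ v, ∃ g ∈ G, g v ∈ S
  orth : ∀ A ∈ lieSubmodule hG, ∀ s ∈ S, ∀ u ∈ S, inner ℝ (A s) u = 0

/-- The tangent space to the orbit of `a`. -/
noncomputable def orbitTangent {G : Set (E →L[ℝ] E)} (hG : IsIsometryGroup G) (a : E) :
    Submodule ℝ E :=
  (lieSubmodule hG).map (ContinuousLinearMap.apply ℝ E a).toLinearMap

variable {G : Set (E →L[ℝ] E)} {hG : IsIsometryGroup G} {S : Submodule ℝ E}

theorem mem_orbitTangent {a x : E} :
    x ∈ orbitTangent hG a ↔ ∃ A ∈ lieSubmodule hG, A a = x := by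
  simp [orbitTangent]

theorem finrank_orbitTangent_le {g : E →L[ℝ] E} (hg : g ∈ G) (a : E) :
    Module.finrank ℝ (orbitTangent hG a) ≤ Module.finrank ℝ (orbitTangent hG (g a)) := by
  obtain ⟨h, hh, h1, h2⟩ := hG.inv_mem g hg
  have hle : (orbitTangent hG a).map g.toLinearMap ≤ orbitTangent hG (g a) := by
    rintro _ ⟨x, hx, rfl⟩
    obtain ⟨A, hA, rfl⟩ := mem_orbitTangent.1 hx
    refine mem_orbitTangent.2 ⟨g * A * h, conj_mem_lieSubmodule hG hA hg hh h1 h2, ?_⟩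
    have : h (g a) = a := congrArg (fun f : E →L[ℝ] E => f a) h1
    simp [this]
  calc Module.finrank ℝ (orbitTangent hG a)
      = Module.finrank ℝ ((orbitTangent hG a).map g.toLinearMap) :=
        (Submodule.equivMapOfInjective g.toLinearMap (hG.injective hg) _).finrank_eq
    _ ≤ _ := Submodule.finrank_mono hle

theorem IsLinearSection.bracket (hS : IsLinearSection hG S) {X Y : E →L[ℝ] E}
    (hX : X ∈ lieSubmodule hG) (hY : Y ∈ lieSubmodule hG) {s u : E} (hs : s ∈ S) (hu : u ∈ S) :
    inner ℝ (X (Y s)) u = inner ℝ (Y (X s)) u := by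
  have h0 : ∀ t : ℝ, inner ℝ (Y (exp (t • -X) s)) (exp (t • -X) u) = 0 := by
    intro t
    have e1 : exp (t • -X) * exp (t • X) = 1 := by
      rw [smul_neg]; exact clm_exp_neg_mul_exp _
    have e2 : exp (t • X) * exp (t • -X) = 1 := by
      rw [smul_neg]; exact clm_exp_mul_exp_neg _
    have h1 := hS.orth _ (conj_mem_lieSubmodule hG hY (hX t)
      ((lieSubmodule hG).neg_mem hX t) e1 e2) s hs u hu
    have h2 : exp (t • X) (exp (t • -X) u) = u := congrArg (fun f : E →L[ℝ] E => f u) e2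
    rw [← hG.inner_map (hX t), h2]
    exact h1
  have d1 := (Y.hasFDerivAt.comp_hasDerivAt (0 : ℝ) (hasDerivAt_clm_exp_apply_zero (-X) s)).inner ℝ
    (hasDerivAt_clm_exp_apply_zero (-X) u)
  have d2 := d1.unique ((hasDerivAt_const (0 : ℝ) (0 : ℝ)).congr_of_eventuallyEq
    (Eventually.of_forall fun t => h0 t))
  simp at d2
  rw [inner_lie_skew hG hX]
  linarith

theorem exists_max_finrank_orbitTangent (hS : IsLinearSection hG S) :
    ∃ a ∈ S, ∀ x, Module.finrank ℝ (orbitTangent hG x) ≤ Module.finrank ℝ (orbitTangent hG a) := by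
  have hfin : (Set.range fun x => Module.finrank ℝ (orbitTangent hG x)).Finite :=
    (Set.finite_Iic (Module.finrank ℝ E)).subset (by
      rintro _ ⟨x, rfl⟩; exact Submodule.finrank_le _)
  obtain ⟨_, ⟨b, rfl⟩, hb⟩ := Set.exists_max_image _ id hfin ⟨_, 0, rfl⟩
  obtain ⟨g, hg, hgb⟩ := hS.meets b
  refine ⟨g b, hgb, fun x => ?_⟩
  exact (hb _ ⟨x, rfl⟩).trans (finrank_orbitTangent_le hg b)

theorem IsLinearSection.annihilates (hS : IsLinearSection hG S) {a : E} (ha : a ∈ S)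
    (hmax : ∀ x, Module.finrank ℝ (orbitTangent hG x) ≤ Module.finrank ℝ (orbitTangent hG a))
    {A : E →L[ℝ] E} (hA : A ∈ lieSubmodule hG) (hAa : A a = 0) {y : E} (hy : y ∈ S) :
    A y = 0 := by
  by_contra hne
  set d := Module.finrank ℝ (orbitTangent hG a) with hd
  let b := Module.finBasis ℝ (orbitTangent hG a)
  have hb : ∀ i, ∃ X ∈ lieSubmodule hG, X a = b i := fun i => mem_orbitTangent.1 (b i).2
  choose X hX hXa using hb
  let w : ℝ → Fin d ⊕ Unit → E := fun ε => Sum.elim (fun i => X i (a + ε • y)) (fun _ => A y)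
  have hw0 : LinearIndependent ℝ (w 0) := by
    have h1 : LinearIndependent ℝ (fun i => X i (a + (0 : ℝ) • y)) := by
      simp only [zero_smul, add_zero, hXa]
      exact b.linearIndependent.map' (Submodule.subtype _) (Submodule.ker_subtype _)
    have h2 : LinearIndependent ℝ (fun _ : Unit => A y) := by
      rw [linearIndependent_unique_iff]; exact hne
    refine h1.sum_type h2 ?_
    rw [Submodule.disjoint_def]
    intro x hx hx2
    have hxT : x ∈ orbitTangent hG a := by
      refine Submodule.span_le.2 ?_ hx
      rintro _ ⟨i, rfl⟩
      simp only [zero_smul, add_zero, hXa]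
      exact (b i).2
    obtain ⟨Z, hZ, rfl⟩ := mem_orbitTangent.1 hxT
    obtain ⟨c, hc⟩ := Submodule.mem_span_singleton.1 (by simpa using hx2)
    have hz : inner ℝ (Z a) (A y) = 0 := by
      rw [real_inner_comm, inner_lie_skew hG hA, real_inner_comm, hS.bracket hA hZ ha hy, hAa]
      simp
    rw [← inner_self_eq_zero (𝕜 := ℝ)]
    nth_rewrite 2 [← hc]
    rw [inner_smul_right, hz, mul_zero]
  have hwc : Continuous w := by
    refine continuous_pi fun i => ?_
    rcases i with i | i
    · simp only [w, Sum.elim_inl]; fun_prop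
    · simp only [w, Sum.elim_inr]; fun_prop
  have hev : ∀ᶠ ε in 𝓝 (0 : ℝ), LinearIndependent ℝ (w ε) :=
    (isOpen_setOfPred_linearIndependent.preimage hwc).mem_nhds hw0
  have hev' : ∀ᶠ ε in 𝓝[≠] (0 : ℝ), LinearIndependent ℝ (w ε) ∧ ε ≠ 0 :=
    (hev.filter_mono nhdsWithin_le_nhds).and eventually_mem_nhdsWithin
  obtain ⟨ε, hli, hε⟩ := hev'.exists
  have hmem : ∀ i, w ε i ∈ orbitTangent hG (a + ε • y) := by
    rintro (i | i)
    · exact mem_orbitTangent.2 ⟨X i, hX i, rfl⟩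
    · refine mem_orbitTangent.2 ⟨ε⁻¹ • A, (lieSubmodule hG).smul_mem _ hA, ?_⟩
      simp [hAa, w, hε]
  have hli' : LinearIndependent ℝ
      (fun i => (⟨w ε i, hmem i⟩ : orbitTangent hG (a + ε • y))) :=
    LinearIndependent.of_comp (Submodule.subtype _) hli
  have h3 := hli'.fintype_card_le_finrank
  simp only [Fintype.card_sum, Fintype.card_fin, Fintype.card_unit] at h3
  have := hmax (a + ε • y)
  omega

theorem eventually_eq_zero_of_exp_mem (hG : IsIsometryGroup G)
    (π : (E →L[ℝ] E) →ₗ[ℝ] (E →L[ℝ] E)) (hπ : ∀ A ∈ lieSubmodule hG, π A = 0) :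
    ∀ᶠ Z in 𝓝 (0 : E →L[ℝ] E), π Z = Z → exp Z ∈ G → Z = 0 := by
  by_contra hcon
  obtain ⟨Z, hZ0, hZ⟩ := exists_seq_forall_of_frequently (Filter.not_eventually.1 hcon)
  have hZπ : ∀ k, π (Z k) = Z k := fun k => by have := hZ k; tauto
  have hZG : ∀ k, exp (Z k) ∈ G := fun k => by have := hZ k; tauto
  have hZne : ∀ k, Z k ≠ 0 := fun k => by have := hZ k; tauto
  have hsph : ∀ k, ‖Z k‖⁻¹ • Z k ∈ Metric.sphere (0 : E →L[ℝ] E) 1 := by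
    intro k
    rw [mem_sphere_zero_iff_norm, norm_smul, norm_inv, norm_norm,
      inv_mul_cancel₀ (norm_ne_zero_iff.2 (hZne k))]
  obtain ⟨A, hA, j, hj, hlim⟩ := (isCompact_sphere (0 : E →L[ℝ] E) 1).tendsto_subseq hsph
  have hAG : A ∈ lieSubmodule hG :=
    mem_lieSet_of_tendsto hG (B := fun k => Z (j k)) (c := fun k => ‖Z (j k)‖⁻¹)
      (hZ0.comp hj.tendsto_atTop) hlim (Eventually.of_forall fun k => hZG _)
  have hπA : π A = A := by
    have h1 : Tendsto (fun k => π (‖Z (j k)‖⁻¹ • Z (j k))) atTop (𝓝 (π A)) :=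
      ((LinearMap.continuous_of_finiteDimensional π).tendsto A).comp hlim
    refine tendsto_nhds_unique h1 (hlim.congr fun k => ?_)
    simp [hZπ]
  rw [hπ A hAG] at hπA
  rw [mem_sphere_zero_iff_norm, ← hπA, norm_zero] at hA
  exact zero_ne_one hA

theorem contDiff_submodule_coe {F : Type*} [NormedAddCommGroup F] [NormedSpace ℝ F]
    (R : Submodule ℝ F) {n : WithTop ℕ∞} : ContDiff ℝ n (fun z : R => (z : F)) :=
  R.subtypeL.contDiff

theorem hasStrictFDerivAt_exp_mul_exp_mul_exp {A : Type*} [NormedRing A] [NormedAlgebra ℝ A]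
    [CompleteSpace A] (P Q R : A →L[ℝ] A) :
    HasStrictFDerivAt (fun X => exp (P X) * exp (Q X) * exp (R X)) (P + Q + R) 0 := by
  have hcomp : ∀ L : A →L[ℝ] A, HasStrictFDerivAt (fun X => exp (L X)) L 0 := by
    intro L
    have he : HasStrictFDerivAt (exp : A → A) (ContinuousLinearMap.id ℝ A) (L 0) := by
      rw [map_zero]
      exact hasStrictFDerivAt_exp_zero (𝕂 := ℝ) (𝔸 := A)
    exact he.comp 0 L.hasStrictFDerivAt
  refine (((hcomp P).mul' (hcomp Q)).mul' (hcomp R)).congr_fderiv ?_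
  ext1 X
  simp
  abel

theorem exists_exp_of_mem_nhds_one (hG : IsIsometryGroup G) (p : Submodule ℝ (E →L[ℝ] E))
    (hp : p ≤ lieSubmodule hG) :
    ∃ π : (E →L[ℝ] E) →ₗ[ℝ] (E →L[ℝ] E), (∀ X, π X ∈ lieSubmodule hG) ∧
      (∀ X, π X ∈ p → π X = 0) ∧
      ∀ᶠ g in 𝓝 (1 : E →L[ℝ] E), g ∈ G → ∃ X, ∃ Y ∈ p, g = exp (π X) * exp Y := by
  obtain ⟨q, hq⟩ := Submodule.exists_isCompl (lieSubmodule hG)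
  obtain ⟨r, hr⟩ := Submodule.exists_isCompl p
  set π0 := Submodule.projection _ _ hq with hπ0
  set π2 := Submodule.projection _ _ hr ∘ₗ π0 with hπ2
  set π1 := π0 - π2 with hπ1
  set π3 := LinearMap.id - π0 with hπ3
  have h0 : ∀ X, π0 X ∈ lieSubmodule hG := fun X => Submodule.projection_apply_mem _ _
  have h2 : ∀ X, π2 X ∈ p := fun X => Submodule.projection_apply_mem _ _
  have h1 : ∀ X, π1 X ∈ lieSubmodule hG := fun X => Submodule.sub_mem _ (h0 X) (hp (h2 X))
  have h3 : ∀ A ∈ lieSubmodule hG, π3 A = 0 := fun A hA => by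
    simp [hπ3, hπ0, Submodule.projection_apply_of_mem_left _ hA]
  have h33 : ∀ X, π3 (π3 X) = π3 X := fun X => by
    have : π3 (π0 X) = 0 := h3 _ (h0 X)
    have e : π3 X = X - π0 X := rfl
    conv_lhs => rw [e, map_sub, this, sub_zero]
  refine ⟨π1, h1, ?_, ?_⟩
  · intro X hX
    have e1 : Submodule.projection _ _ hr (π1 X) = π1 X :=
      Submodule.projection_apply_of_mem_left _ hX
    have e2 : Submodule.projection _ _ hr (π1 X) = 0 := by
      have e : π1 X = π0 X - π2 X := rfl
      have e3 : Submodule.projection _ _ hr (π2 X) = π2 X :=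
        Submodule.projection_apply_of_mem_left _ (h2 X)
      rw [e, map_sub, e3]
      exact sub_self _
    rw [← e1, e2]
  have hΦ : HasStrictFDerivAt (fun X => exp (π1 X) * exp (π2 X) * exp (π3 X))
      ((ContinuousLinearEquiv.refl ℝ (E →L[ℝ] E) : (E →L[ℝ] E) ≃L[ℝ] (E →L[ℝ] E)) :
        (E →L[ℝ] E) →L[ℝ] (E →L[ℝ] E)) 0 := by
    refine (hasStrictFDerivAt_exp_mul_exp_mul_exp (LinearMap.toContinuousLinearMap π1)
      (LinearMap.toContinuousLinearMap π2) (LinearMap.toContinuousLinearMap π3)).congr_fderiv ?_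
    refine ContinuousLinearMap.ext fun X => ?_
    change (π0 X - π2 X) + π2 X + (X - π0 X) = X
    abel
  have hΦ0 : exp (π1 0) * exp (π2 0) * exp (π3 0) = 1 := by simp
  have hlg := hΦ.to_localInverse.hasFDerivAt.continuousAt.tendsto
  have hri := hΦ.eventually_right_inverse
  rw [hΦ.localInverse_apply_image] at hlg
  simp only [hΦ0] at hlg hri
  have hπ3c : Tendsto (fun g => π3 (hΦ.localInverse _ _ _ g)) (𝓝 1) (𝓝 0) := by
    have := (LinearMap.continuous_of_finiteDimensional π3).tendsto 0
    rw [map_zero] at this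
    exact this.comp hlg
  filter_upwards [hri, hπ3c.eventually (eventually_eq_zero_of_exp_mem hG π3 h3)] with g hg1 hg2 hgG
  set X := hΦ.localInverse _ _ _ g with hX
  have hz : exp (π3 X) ∈ G := by
    have : exp (π3 X) = exp (-π2 X) * (exp (-π1 X) * g) := by
      rw [← hg1]
      simp only [← mul_assoc]
      rw [mul_assoc (exp (-π2 X)), clm_exp_neg_mul_exp, mul_one, clm_exp_neg_mul_exp, one_mul]
    rw [this]
    have m : ∀ A ∈ lieSubmodule hG, exp (-A) ∈ G := fun A hA => by
      have := (lieSubmodule hG).neg_mem hA 1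
      rwa [one_smul] at this
    exact hG.mul_mem _ (m _ (hp (h2 X))) _ (hG.mul_mem _ (m _ (h1 X)) _ hgG)
  have := hg2 (h33 X) hz
  refine ⟨X, π2 X, h2 X, ?_⟩
  rw [this, exp_zero, mul_one] at hg1
  exact hg1.symm

theorem IsLinearSection.orbitTangent_eq (hS : IsLinearSection hG S) {a : E} (ha : a ∈ S)
    (hmax : ∀ x, Module.finrank ℝ (orbitTangent hG x) ≤ Module.finrank ℝ (orbitTangent hG a)) :
    orbitTangent hG a = Sᗮ := by
  have hle : orbitTangent hG a ≤ Sᗮ := by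
    intro x hx
    obtain ⟨A, hA, rfl⟩ := mem_orbitTangent.1 hx
    rw [Submodule.mem_orthogonal']
    exact fun u hu => hS.orth A hA a ha u hu
  refine Submodule.eq_of_le_of_finrank_le hle ?_
  let p : Submodule ℝ (E →L[ℝ] E) :=
    lieSubmodule hG ⊓ LinearMap.ker (ContinuousLinearMap.apply ℝ E a).toLinearMap
  have hp : ∀ A, A ∈ p ↔ A ∈ lieSubmodule hG ∧ A a = 0 := fun A => by simp [p]
  obtain ⟨π, hπ, hπp, hev⟩ := exists_exp_of_mem_nhds_one hG p inf_le_left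
  have hrank : Module.finrank ℝ (LinearMap.range π) ≤ Module.finrank ℝ (orbitTangent hG a) := by
    let ev : LinearMap.range π →ₗ[ℝ] orbitTangent hG a :=
      LinearMap.codRestrict _ ((ContinuousLinearMap.apply ℝ E a).toLinearMap ∘ₗ
        (LinearMap.range π).subtype) (by
          rintro ⟨_, ⟨X, rfl⟩⟩
          exact mem_orbitTangent.2 ⟨π X, hπ X, rfl⟩)
    refine LinearMap.finrank_le_finrank_of_injective (f := ev) ?_
    rw [← LinearMap.ker_eq_bot, LinearMap.ker_eq_bot']
    rintro ⟨_, ⟨X, rfl⟩⟩ h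
    have h' : π X a = 0 := congrArg Subtype.val h
    exact Subtype.ext (hπp X ((hp _).2 ⟨hπ X, h'⟩))
  let Ψ : LinearMap.range π × S → E := fun z => exp (z.1 : E →L[ℝ] E) (z.2 : E)
  have hΨ : ContDiff ℝ 1 Ψ := by
    have h0 : ContDiff ℝ 1 (fun z : LinearMap.range π × S => (z.1 : E →L[ℝ] E)) :=
      (contDiff_submodule_coe _).comp contDiff_fst
    have h1 : ContDiff ℝ 1 (fun z : LinearMap.range π × S => exp (z.1 : E →L[ℝ] E)) :=
      (contDiff_clm_exp.of_le le_top).comp h0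
    exact h1.clm_apply ((contDiff_submodule_coe S).comp contDiff_snd)
  have hgΨ : ∀ g : E →L[ℝ] E, dimH (Set.range fun z => g (Ψ z)) ≤
      (Module.finrank ℝ (LinearMap.range π × S) : ℝ≥0∞) :=
    fun g => (g.contDiff.comp hΨ).dimH_range_le
  obtain ⟨U, hU, hU1⟩ : ∃ U ∈ 𝓝 (1 : E →L[ℝ] E), ∀ g ∈ U, g ∈ G → ∀ s ∈ S, g s ∈ Set.range Ψ := by
    refine ⟨_, hev, fun g hg hgG s hs => ?_⟩
    obtain ⟨X, Y, hY, rfl⟩ := hg hgG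
    refine ⟨(⟨π X, X, rfl⟩, ⟨s, hs⟩), ?_⟩
    have hYs : Y s = 0 := hS.annihilates ha hmax ((hp Y).1 hY).1 ((hp Y).1 hY).2 hs
    have hes : exp Y s = s := by simpa using clm_exp_smul_apply_of_apply_eq_zero hYs 1
    simp [Ψ, hes]
  have hcov : ∃ t : Finset (E →L[ℝ] E), ∀ v : E, ∃ g ∈ t, v ∈ Set.range fun z => g (Ψ z) := by
    choose! inv hinv hinv1 hinv2 using hG.inv_mem
    obtain ⟨t, ht, hcov⟩ := hG.isCompact.elim_nhds_subcover (fun g => (fun x => inv g * x) ⁻¹' U)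
      (fun g hg => by
        refine (Continuous.continuousAt (by fun_prop)).preimage_mem_nhds ?_
        rw [hinv1 g hg]; exact hU)
    refine ⟨t, fun v => ?_⟩
    obtain ⟨k, hk, hkv⟩ := hS.meets v
    obtain ⟨g, hg⟩ := Set.mem_iUnion₂.1 (hcov (hinv k hk))
    obtain ⟨hgt, hgU⟩ := hg
    refine ⟨g, hgt, ?_⟩
    have hgG := ht g hgt
    obtain ⟨z, hz⟩ := hU1 _ hgU (hG.mul_mem _ (hinv g hgG) _ (hinv k hk)) _ hkv
    refine ⟨z, ?_⟩
    have e1 : inv k (k v) = v := congrArg (fun f : E →L[ℝ] E => f v) (hinv1 k hk)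
    have e2 : g (inv g v) = v := congrArg (fun f : E →L[ℝ] E => f v) (hinv2 g hgG)
    simp only [hz]
    simp [e2, e1]
  obtain ⟨t, ht⟩ := hcov
  have huniv : (Set.univ : Set E) ⊆ ⋃ g ∈ (t : Set (E →L[ℝ] E)), Set.range fun z => g (Ψ z) := by
    intro v _
    obtain ⟨g, hg, hv⟩ := ht v
    exact Set.mem_iUnion₂.2 ⟨g, hg, hv⟩
  have hdim : (Module.finrank ℝ E : ℝ≥0∞) ≤ (Module.finrank ℝ (LinearMap.range π × S) : ℝ≥0∞) := by
    rw [← Real.dimH_univ_eq_finrank]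
    refine (dimH_mono huniv).trans ?_
    rw [dimH_bUnion t.countable_toSet]
    exact iSup₂_le fun g _ => hgΨ g
  have hdim' : Module.finrank ℝ E ≤ Module.finrank ℝ (LinearMap.range π × S) := by
    exact_mod_cast hdim
  rw [Module.finrank_prod] at hdim'
  have := S.finrank_add_finrank_orthogonal
  omega

end Section

section JointDiagonalization

/-- Commuting symmetric operators have an orthonormal basis of joint eigenvectors. -/
theorem exists_orthonormalBasis_joint_eigenvectors {V ι : Type*} [NormedAddCommGroup V]
    [InnerProductSpace ℝ V] [FiniteDimensional ℝ V] (T : ι → Module.End ℝ V)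
    (hT : ∀ i, (T i).IsSymmetric) (hc : ∀ i j, Commute (T i) (T j)) :
    ∃ b : OrthonormalBasis (Fin (Module.finrank ℝ V)) ℝ V, ∀ k i, ∃ c : ℝ, T i (b k) = c • b k := by
  classical
  have hInt := LinearMap.IsSymmetric.directSum_isInternal_of_pairwise_commute hT
    (fun i j _ => hc i j)
  have hortho := LinearMap.IsSymmetric.orthogonalFamily_iInf_eigenspaces hT
  set W : (ι → ℝ) → Submodule ℝ V := fun χ => ⨅ j, (T j).eigenspace (χ j) with hW
  have hfin : Finite {χ // W χ ≠ ⊥} :=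
    (WellFoundedGT.finite_ne_bot_of_iSupIndep hInt.submodule_iSupIndep).to_subtype
  let _ := Fintype.ofFinite {χ // W χ ≠ ⊥}
  have hInt' := (DirectSum.isInternal_ne_bot_iff (A := W)).2 hInt
  have hortho' : OrthogonalFamily ℝ (fun χ : {χ // W χ ≠ ⊥} => W χ)
      (fun χ => (W χ).subtypeₗᵢ) := hortho.comp Subtype.val_injective
  let b := hInt'.collectedOrthonormalBasis hortho' (fun χ => stdOrthonormalBasis ℝ (W χ))
  have hcard := Module.finrank_eq_card_basis b.toBasis
  refine ⟨b.reindex (Fintype.equivFinOfCardEq hcard.symm), fun k i => ?_⟩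
  rw [OrthonormalBasis.reindex_apply]
  set z := (Fintype.equivFinOfCardEq hcard.symm).symm k with hz
  have hm : b z ∈ W z.1 := hInt'.collectedOrthonormalBasis_mem (hV := hortho')
    (fun χ => stdOrthonormalBasis ℝ (W χ)) z
  refine ⟨z.1.1 i, ?_⟩
  exact Module.End.mem_eigenspace_iff.1 ((Submodule.mem_iInf _).1 hm i)

end JointDiagonalization

section Roots

open NormedSpace Filter Topology

variable {E : Type*} [NormedAddCommGroup E] [InnerProductSpace ℝ E] [FiniteDimensional ℝ E]
variable {G : Set (E →L[ℝ] E)} {hG : IsIsometryGroup G} {S : Submodule ℝ E}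

/-- A root system adapted to a section: a regular point `a`, an orthonormal basis `e` of `Sᗮ` and
generators `A` of the group moving `S` in the directions `e`, with speed given by `l`. -/
structure RootSystemData {G : Set (E →L[ℝ] E)} (hG : IsIsometryGroup G) (S : Submodule ℝ E) where
  a : E
  e : OrthonormalBasis (Fin (Module.finrank ℝ Sᗮ)) ℝ Sᗮ
  A : Fin (Module.finrank ℝ Sᗮ) → E →L[ℝ] E
  l : Fin (Module.finrank ℝ Sᗮ) → E
  a_mem : a ∈ S
  l_mem : ∀ i, l i ∈ S
  A_mem : ∀ i, A i ∈ lieSubmodule hG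
  A_apply : ∀ i, ∀ s ∈ S, A i s = (inner ℝ (l i) s : ℝ) • (e i : E)
  inner_a : ∀ i, inner ℝ (l i) a = 1
  finrank_le : ∀ x, Module.finrank ℝ (orbitTangent hG x) ≤ Module.finrank ℝ (orbitTangent hG a)
  tangent_eq : orbitTangent hG a = Sᗮ

theorem IsLinearSection.exists_rootSystemData (hS : IsLinearSection hG S) :
    Nonempty (RootSystemData hG S) := by
  obtain ⟨a, ha, hmax⟩ := exists_max_finrank_orbitTangent hS
  have htan := hS.orbitTangent_eq ha hmax
  let ev : lieSubmodule hG →ₗ[ℝ] Sᗮ :=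
    LinearMap.codRestrict _ ((ContinuousLinearMap.apply ℝ E a).toLinearMap ∘ₗ
      (lieSubmodule hG).subtype) (fun A => by
        rw [← htan]; exact mem_orbitTangent.2 ⟨A, A.2, rfl⟩)
  have hev : Function.Surjective ev := by
    rintro ⟨x, hx⟩
    rw [← htan] at hx
    obtain ⟨A, hA, rfl⟩ := mem_orbitTangent.1 hx
    exact ⟨⟨A, hA⟩, rfl⟩
  obtain ⟨B, hB⟩ := ev.exists_rightInverse_of_surjective (LinearMap.range_eq_top.2 hev)
  have hBa : ∀ x : Sᗮ, (B x : E →L[ℝ] E) a = x := fun x =>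
    congrArg Subtype.val (LinearMap.congr_fun hB x)
  let T : S → Module.End ℝ Sᗮ := fun s =>
    LinearMap.codRestrict _ ((ContinuousLinearMap.apply ℝ E (s : E)).toLinearMap ∘ₗ
      (lieSubmodule hG).subtype ∘ₗ B) (fun x => by
        rw [Submodule.mem_orthogonal']
        exact fun u hu => hS.orth _ (B x).2 s s.2 u hu)
  have hT : ∀ s x, (T s x : E) = (B x : E →L[ℝ] E) s := fun s x => rfl
  have key : ∀ (s u : S) (x y : Sᗮ), inner ℝ ((B x : E →L[ℝ] E) s) ((B y : E →L[ℝ] E) u) =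
      (inner ℝ ((B x : E →L[ℝ] E) u) ((B y : E →L[ℝ] E) s) : ℝ) := by
    intro s u x y
    have h1 := inner_lie_skew hG (B y).2 ((B x : E →L[ℝ] E) s) u
    have h2 := inner_lie_skew hG (B x).2 ((B y : E →L[ℝ] E) s) u
    have h3 := hS.bracket (B x).2 (B y).2 s.2 u.2
    have h4 := real_inner_comm ((B x : E →L[ℝ] E) u) ((B y : E →L[ℝ] E) s)
    linarith
  have hTs : ∀ s, (T s).IsSymmetric := by
    intro s x y
    simp only [Submodule.coe_inner, hT]
    have := key s ⟨a, ha⟩ x y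
    simpa only [hBa] using this
  have hTc : ∀ s u, Commute (T s) (T u) := by
    intro s u
    refine LinearMap.ext fun x => ext_inner_right ℝ fun y => ?_
    change inner ℝ (T s (T u x)) y = inner ℝ (T u (T s x)) y
    rw [hTs s (T u x) y, hTs u (T s x) y]
    simp only [Submodule.coe_inner, hT]
    exact key u s x y
  obtain ⟨b, hb⟩ := exists_orthonormalBasis_joint_eigenvectors T hTs hTc
  let l : Fin (Module.finrank ℝ Sᗮ) → E := fun i =>
    -(S.orthogonalProjectionOnto ((B (b i) : E →L[ℝ] E) (b i)) : E)
  have happ : ∀ i, ∀ s ∈ S, (B (b i) : E →L[ℝ] E) s = (inner ℝ (l i) s : ℝ) • (b i : E) := by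
    intro i s hs
    obtain ⟨c, hc⟩ := hb i ⟨s, hs⟩
    have hc' : (B (b i) : E →L[ℝ] E) s = c • (b i : E) := congrArg Subtype.val hc
    have h1 : inner ℝ ((B (b i) : E →L[ℝ] E) s) (b i : E) = c := by
      rw [hc', inner_smul_left]
      have : inner ℝ (b i : E) (b i : E) = (1 : ℝ) := by
        rw [← Submodule.coe_inner, real_inner_self_eq_norm_sq, b.norm_eq_one]; norm_num
      rw [this]
      simp
    rw [hc', ← h1, inner_lie_skew hG (B (b i)).2]
    congr 1
    simp only [l, inner_neg_left]
    rw [real_inner_comm]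
    congr 1
    exact (Submodule.inner_orthogonalProjectionOnto_eq_of_mem_right ⟨s, hs⟩ _).symm
  refine ⟨⟨a, b, fun i => B (b i), l, ha, fun i => S.neg_mem (Submodule.coe_mem _),
    fun i => (B (b i)).2, happ, fun i => ?_, hmax, htan⟩⟩
  have h1 := happ i a ha
  rw [hBa] at h1
  have h2 : (b i : E) ≠ 0 := by
    simpa using b.orthonormal.ne_zero i
  have h3 : ((inner ℝ (l i) a : ℝ) - 1) • (b i : E) = 0 := by
    rw [sub_smul, ← h1, one_smul, sub_self]
  rcases smul_eq_zero.1 h3 with h | h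
  · linarith
  · exact absurd h h2

theorem inner_lie_eq_zero_of_isExtr {K : Set (E →L[ℝ] E)} {A k : E →L[ℝ] E} {x y : E}
    (hk : IsExtrOn (fun k : E →L[ℝ] E => (inner ℝ (k x) y : ℝ)) K k)
    (hA : ∀ t : ℝ, exp (t • A) * k ∈ K) : inner ℝ (A (k x)) y = (0 : ℝ) := by
  have h1 := (hasDerivAt_clm_exp_apply_zero A (k x)).inner ℝ (hasDerivAt_const (0 : ℝ) y)
  have h2 : IsExtrOn (fun t : ℝ => (inner ℝ (exp (t • A) (k x)) y : ℝ)) Set.univ 0 := by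
    have e : exp ((0 : ℝ) • A) (k x) = k x := by simp
    rcases hk with hk | hk
    · left
      intro t _
      change inner ℝ (exp ((0 : ℝ) • A) (k x)) y ≤ (inner ℝ (exp (t • A) (k x)) y : ℝ)
      rw [e]
      exact hk (hA t)
    · right
      intro t _
      change (inner ℝ (exp (t • A) (k x)) y : ℝ) ≤ inner ℝ (exp ((0 : ℝ) • A) (k x)) y
      rw [e]
      exact hk (hA t)
  have h4 := (h2.isLocalExtr Filter.univ_mem).hasDerivAt_eq_zero h1
  simpa using h4

/-- Conjugation of `IsLinearSection.orth` by an element of the group. -/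
theorem IsLinearSection.inner_apply_lie (hS : IsLinearSection hG S) {h A : E →L[ℝ] E} (hh : h ∈ G)
    (hA : A ∈ lieSubmodule hG) {u s : E} (hu : u ∈ S) (hs : s ∈ S) :
    inner ℝ (h u) (A (h s)) = (0 : ℝ) := by
  obtain ⟨g, hg, h1, h2⟩ := hG.inv_mem h hh
  have h3 := hS.orth _ (conj_mem_lieSubmodule hG hA hg hh h2 h1) s hs u hu
  have h4 : A (h s) = h (g (A (h s))) :=
    (congrArg (fun f : E →L[ℝ] E => f (A (h s))) h2).symm
  rw [h4, hG.inner_map hh, real_inner_comm]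
  exact h3

namespace RootSystemData

variable (R : RootSystemData hG S)
include R

theorem l_ne_zero (i) : R.l i ≠ 0 := fun h => by
  have := R.inner_a i
  simp [h] at this

theorem A_apply_a (i) : R.A i R.a = R.e i := by
  rw [R.A_apply i _ R.a_mem, R.inner_a, one_smul]

theorem mem_of_inner_e {y : E} (h : ∀ i, inner ℝ y (R.e i : E) = (0 : ℝ)) : y ∈ S := by
  rw [← S.orthogonal_orthogonal, Submodule.mem_orthogonal']
  intro u hu
  have h1 : (u : E) = ∑ i, (inner ℝ (R.e i) (⟨u, hu⟩ : Sᗮ) : ℝ) • (R.e i : E) := by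
    have := congrArg Subtype.val (R.e.sum_repr' ⟨u, hu⟩)
    simpa using this.symm
  rw [h1, inner_sum]
  exact Finset.sum_eq_zero fun i _ => by rw [inner_smul_right, h, mul_zero]

theorem map_mem_of_map_a_mem (hS : IsLinearSection hG S) {h : E →L[ℝ] E} (hh : h ∈ G)
    (ha : h R.a ∈ S) {u : E} (hu : u ∈ S) : h u ∈ S := by
  have hle : orbitTangent hG (h R.a) ≤ Sᗮ := by
    intro x hx
    obtain ⟨A, hA, rfl⟩ := mem_orbitTangent.1 hx
    rw [Submodule.mem_orthogonal']
    exact fun u hu => hS.orth A hA _ ha u hu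
  have htan : orbitTangent hG (h R.a) = Sᗮ :=
    Submodule.eq_of_le_of_finrank_le hle (by
      rw [← R.tangent_eq]; exact finrank_orbitTangent_le hh _)
  rw [← S.orthogonal_orthogonal, Submodule.mem_orthogonal']
  intro x hx
  rw [← htan] at hx
  obtain ⟨A, hA, rfl⟩ := mem_orbitTangent.1 hx
  exact hS.inner_apply_lie hh hA hu R.a_mem

theorem exists_mem_normalizer (hS : IsLinearSection hG S) {s t : E} (hs : s ∈ S) (ht : t ∈ S)
    {g : E →L[ℝ] E} (hg : g ∈ G) (hgs : g s = t) :
    ∃ w ∈ G, (∀ u ∈ S, w u ∈ S) ∧ w s = t := by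
  set K : Set (E →L[ℝ] E) := G ∩ {k | k t = t} with hK
  have hKc : IsCompact K := hG.isCompact.inter_right
    (isClosed_eq (by fun_prop) continuous_const)
  obtain ⟨k, hk, hmax⟩ := hKc.exists_isMaxOn ⟨1, hG.one_mem, rfl⟩
    (f := fun k : E →L[ℝ] E => (inner ℝ (k (g R.a)) R.a : ℝ))
    (Continuous.continuousOn (by fun_prop))
  have hkg := hG.mul_mem k hk.1 g hg
  have hkgs : (k * g) s = t := by
    change k (g s) = t
    rw [hgs]; exact hk.2
  refine ⟨k * g, hkg, fun u hu => R.map_mem_of_map_a_mem hS hkg ?_ hu, hkgs⟩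
  refine R.mem_of_inner_e fun i => ?_
  by_cases hi : inner ℝ (R.l i) t = (0 : ℝ)
  · have hAt : R.A i t = 0 := by rw [R.A_apply i t ht, hi, zero_smul]
    have := inner_lie_eq_zero_of_isExtr (A := R.A i) (Or.inr hmax) fun u =>
      ⟨hG.mul_mem _ (R.A_mem i u) _ hk.1, by
        change exp (u • R.A i) (k t) = t
        rw [show k t = t from hk.2]
        exact clm_exp_smul_apply_of_apply_eq_zero hAt u⟩
    rw [inner_lie_skew hG (R.A_mem i), R.A_apply_a, neg_eq_zero] at this
    exact this
  · have h1 := hS.inner_apply_lie hkg (R.A_mem i) R.a_mem hs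
    rw [hkgs, R.A_apply i t ht, inner_smul_right] at h1
    exact (mul_eq_zero.1 h1).resolve_left hi

/-- Each root gives rise to a reflection of the section, induced by an element of the group. -/
theorem exists_reflection (hS : IsLinearSection hG S) (i) :
    ∃ k ∈ G, ∀ s ∈ S, k s = s - (2 * inner ℝ (R.l i) s / ‖R.l i‖ ^ 2) • R.l i := by
  set l := R.l i with hl
  have hl0 : ‖l‖ ^ 2 ≠ 0 := by
    have := R.l_ne_zero i
    positivity
  set K : Set (E →L[ℝ] E) := G ∩ ⋂ s ∈ {s | s ∈ S ∧ inner ℝ l s = (0 : ℝ)}, {k | k s = s} with hK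
  have hKm : ∀ k, k ∈ K ↔ k ∈ G ∧ ∀ s ∈ S, inner ℝ l s = (0 : ℝ) → k s = s := by
    intro k
    simp [hK]
  have hKc : IsCompact K := hG.isCompact.inter_right
    (isClosed_biInter fun s _ => isClosed_eq (by fun_prop) continuous_const)
  have hexp : ∀ j, (∀ s ∈ S, inner ℝ l s = (0 : ℝ) → inner ℝ (R.l j) s = (0 : ℝ)) →
      ∀ k ∈ K, ∀ t : ℝ, exp (t • R.A j) * k ∈ K := by
    intro j hj k hk t
    rw [hKm] at hk ⊢
    refine ⟨hG.mul_mem _ (R.A_mem j t) _ hk.1, fun s hs hls => ?_⟩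
    change exp (t • R.A j) (k s) = s
    rw [hk.2 s hs hls]
    exact clm_exp_smul_apply_of_apply_eq_zero (by rw [R.A_apply j s hs, hj s hs hls, zero_smul]) t
  have h1K : (1 : E →L[ℝ] E) ∈ K := (hKm 1).2 ⟨hG.one_mem, fun s _ _ => rfl⟩
  obtain ⟨k, hk, hmin⟩ := hKc.exists_isMinOn ⟨1, h1K⟩
    (f := fun k : E →L[ℝ] E => (inner ℝ (k l) l : ℝ)) (Continuous.continuousOn (by fun_prop))
  obtain ⟨hkG, hkfix⟩ := (hKm k).1 hk
  have hlS : l ∈ S := R.l_mem i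
  have hyS : k l ∈ S := by
    refine R.mem_of_inner_e fun j => ?_
    by_cases hj : ∀ s ∈ S, inner ℝ l s = (0 : ℝ) → inner ℝ (R.l j) s = (0 : ℝ)
    · have h1 := inner_lie_eq_zero_of_isExtr (Or.inl hmin) (hexp j hj k hk)
      rw [inner_lie_skew hG (R.A_mem j), R.A_apply j l hlS, neg_eq_zero, inner_smul_right] at h1
      refine (mul_eq_zero.1 h1).resolve_left fun h2 => ?_
      have h3 := hj _ (R.l_mem j) (by rw [real_inner_comm]; exact h2)
      exact R.l_ne_zero j (inner_self_eq_zero.1 h3)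
    · push Not at hj
      obtain ⟨s, hs, hls, hjs⟩ := hj
      have h1 := hS.inner_apply_lie hkG (R.A_mem j) hlS hs
      rw [hkfix s hs hls, R.A_apply j s hs, inner_smul_right] at h1
      exact (mul_eq_zero.1 h1).resolve_left hjs
  have hdec : ∀ s : E, s = (s - (inner ℝ l s / ‖l‖ ^ 2) • l) + (inner ℝ l s / ‖l‖ ^ 2) • l := by
    intro s; abel
  have hfix : ∀ s ∈ S, k s = (s - (inner ℝ l s / ‖l‖ ^ 2) • l) + (inner ℝ l s / ‖l‖ ^ 2) • k l := by
    intro s hs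
    conv_lhs => rw [hdec s, map_add, map_smul]
    rw [hkfix _ (S.sub_mem hs (S.smul_mem _ hlS))]
    rw [inner_sub_right, inner_smul_right, real_inner_self_eq_norm_sq, div_mul_cancel₀ _ hl0,
      sub_self]
  obtain ⟨c, hc⟩ : ∃ c : ℝ, k l = c • l := by
    refine ⟨inner ℝ l (k l) / ‖l‖ ^ 2, ?_⟩
    set z := k l - (inner ℝ l (k l) / ‖l‖ ^ 2) • l with hz
    have hzS : z ∈ S := S.sub_mem hyS (S.smul_mem _ hlS)
    have hlz : inner ℝ l z = (0 : ℝ) := by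
      rw [hz, inner_sub_right, inner_smul_right, real_inner_self_eq_norm_sq,
        div_mul_cancel₀ _ hl0, sub_self]
    have h1 : inner ℝ (k l) z = (0 : ℝ) := by
      have := hG.inner_map hkG l z
      rwa [hkfix z hzS hlz, hlz] at this
    have h2 : inner ℝ z z = (0 : ℝ) := by
      nth_rewrite 1 [hz]
      rw [inner_sub_left, inner_smul_left, h1, hlz]
      simp
    exact sub_eq_zero.1 (inner_self_eq_zero.1 h2)
  have hc1 : c = 1 ∨ c = -1 := by
    have h1 := hG.norm_map k hkG l
    rw [hc, norm_smul, Real.norm_eq_abs] at h1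
    have h2 : |c| = 1 := by
      have : ‖l‖ ≠ 0 := fun h => hl0 (by rw [h]; norm_num)
      exact mul_right_cancel₀ this (by rw [h1, one_mul])
    exact eq_or_eq_neg_of_abs_eq h2
  have hcne : c ≠ 1 := by
    rintro rfl
    rw [one_smul] at hc
    have hconst : ∀ t : ℝ, exp (t • R.A i) l = l := by
      intro t
      have h1 : exp (t • R.A i) ∈ K := by
        simpa using hexp i (fun s _ h => h) 1 h1K t
      have h2 : (inner ℝ (k l) l : ℝ) ≤ inner ℝ (exp (t • R.A i) l) l := hmin h1
      rw [hc, real_inner_self_eq_norm_sq] at h2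
      have h3 := norm_sub_sq_real (exp (t • R.A i) l) l
      rw [hG.norm_map _ (R.A_mem i t)] at h3
      have h4 : ‖exp (t • R.A i) l - l‖ = 0 := by
        have : ‖exp (t • R.A i) l - l‖ ^ 2 ≤ 0 := by linarith
        exact pow_eq_zero_iff (two_ne_zero) |>.1 (le_antisymm this (sq_nonneg _))
      exact sub_eq_zero.1 (norm_eq_zero.1 h4)
    have h1 := (hasDerivAt_clm_exp_apply_zero (R.A i) l).unique
      ((hasDerivAt_const (0 : ℝ) l).congr_of_eventuallyEq (Eventually.of_forall hconst))
    rw [R.A_apply i l hlS, ← hl, real_inner_self_eq_norm_sq] at h1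
    refine (smul_eq_zero.1 h1).elim hl0 fun h2 => ?_
    exact R.e.orthonormal.ne_zero i (Subtype.ext h2)
  refine ⟨k, hkG, fun s hs => ?_⟩
  rw [hfix s hs, hc, hc1.resolve_left hcne]
  module

end RootSystemData

end Roots

section ParametricIntegral

open MeasureTheory Set Topology

variable {V F : Type*} [NormedAddCommGroup V] [NormedSpace ℝ V]
  [NormedAddCommGroup F] [NormedSpace ℝ F]

theorem contDiff_iteratedFDeriv_uncurry {H : ℝ → V → F}
    (hH : ContDiff ℝ (⊤ : ℕ∞) (Function.uncurry H)) (m : ℕ) :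
    ContDiff ℝ (⊤ : ℕ∞) (fun p : ℝ × V => iteratedFDeriv ℝ m (H p.1) p.2) := by
  induction m with
  | zero =>
    simp only [iteratedFDeriv_zero_eq_comp]
    exact (continuousMultilinearCurryFin0 ℝ V F).symm.contDiff.comp hH
  | succ m ih =>
    simp only [iteratedFDeriv_succ_eq_comp_left]
    refine (LinearIsometryEquiv.contDiff (𝕜 := ℝ) (E := V →L[ℝ] V [×m]→L[ℝ] F)
      (F := V [×(m+1)]→L[ℝ] F)
      (continuousMultilinearCurryLeftEquiv ℝ (fun _ : Fin (m+1) => V) F).symm).comp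
        (f := fun p : ℝ × V => fderiv ℝ (iteratedFDeriv ℝ m (H p.1)) p.2) ?_
    refine ContDiff.fderiv (f := fun p : ℝ × V => iteratedFDeriv ℝ m (H p.1)) (m := (⊤ : ℕ∞)) ?_
      contDiff_snd (by simp)
    exact ih.comp (f := fun q : (ℝ × V) × V => (q.1.1, q.2)) (by fun_prop)

theorem hasFTaylorSeriesUpTo_intervalIntegral [FiniteDimensional ℝ V] [CompleteSpace F]
    {H : ℝ → V → F}
    (hH : ContDiff ℝ (⊤ : ℕ∞) (Function.uncurry H)) :
    HasFTaylorSeriesUpTo (⊤ : ℕ∞) (fun x => ∫ t in (0 : ℝ)..1, H t x)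
      (fun x m => ∫ t in (0 : ℝ)..1, iteratedFDeriv ℝ m (H t) x) := by
  have hs : ∀ t, ContDiff ℝ (⊤ : ℕ∞) (H t) := fun t =>
    hH.comp (f := fun x => (t, x)) (by fun_prop)
  have hc : ∀ m, Continuous (fun p : ℝ × V => iteratedFDeriv ℝ m (H p.1) p.2) := fun m =>
    (contDiff_iteratedFDeriv_uncurry hH m).continuous
  have hct : ∀ m x, Continuous (fun t => iteratedFDeriv ℝ m (H t) x) := fun m x =>
    (hc m).comp (f := fun t => (t, x)) (by fun_prop)
  have hd : ∀ m x, HasFDerivAt (fun y => ∫ t in (0 : ℝ)..1, iteratedFDeriv ℝ m (H t) y)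
      (∫ t in (0 : ℝ)..1, iteratedFDeriv ℝ (m+1) (H t) x).curryLeft x := by
    intro m x
    have hdt : ∀ t y, HasFDerivAt (iteratedFDeriv ℝ m (H t))
        (iteratedFDeriv ℝ (m+1) (H t) y).curryLeft y := by
      intro t y
      exact ((hs t).ftaylorSeries (𝕜 := ℝ)).fderiv m (by exact_mod_cast ENat.natCast_lt_top m) y
    obtain ⟨C, hC⟩ := (isCompact_Icc (a := (0:ℝ)) (b := 1)).prod
      (isCompact_closedBall x (1:ℝ)) |>.exists_bound_of_continuousOn (hc (m+1)).continuousOn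
    have hcl : (∫ t in (0 : ℝ)..1, iteratedFDeriv ℝ (m+1) (H t) x).curryLeft =
        ∫ t in (0 : ℝ)..1, (iteratedFDeriv ℝ (m+1) (H t) x).curryLeft := by
      have := ContinuousLinearMap.intervalIntegral_comp_comm (μ := volume) (a := 0) (b := 1)
        (𝕜 := ℝ) (E := V [×(m+1)]→L[ℝ] F) (F := V →L[ℝ] V [×m]→L[ℝ] F)
        ((continuousMultilinearCurryLeftEquiv ℝ (fun _ : Fin (m+1) => V)
          F).toContinuousLinearEquiv.toContinuousLinearMap) ((hct (m+1) x).intervalIntegrable 0 1)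
      exact this.symm
    rw [hcl]
    refine intervalIntegral.hasFDerivAt_integral_of_dominated_of_fderiv_le (μ := volume)
      (F := fun y t => iteratedFDeriv ℝ m (H t) y)
      (F' := fun y t => (iteratedFDeriv ℝ (m+1) (H t) y).curryLeft) (bound := fun _ => C)
      (Metric.closedBall_mem_nhds x one_pos) ?_ ((hct m x).intervalIntegrable 0 1) ?_ ?_ ?_ ?_
    · exact Filter.Eventually.of_forall fun y => (hct m y).aestronglyMeasurable
    · exact Continuous.aestronglyMeasurable ((continuousMultilinearCurryLeftEquiv ℝ
        (fun _ : Fin (m+1) => V) F).continuous.comp (hct (m+1) x))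
    · refine Filter.Eventually.of_forall fun t ht y hy => ?_
      rw [ContinuousMultilinearMap.curryLeft_norm]
      rw [uIoc_of_le zero_le_one] at ht
      exact hC (t, y) ⟨⟨ht.1.le, ht.2⟩, hy⟩
    · simp
    · exact Filter.Eventually.of_forall fun t _ y _ => hdt t y
  refine ⟨fun x => ?_, fun m _ x => hd m x, fun m _ => ?_⟩
  · have := ContinuousLinearMap.intervalIntegral_comp_comm (μ := volume) (a := 0) (b := 1)
        (continuousMultilinearCurryFin0 ℝ V F).toContinuousLinearEquiv.toContinuousLinearMap
          ((hct 0 x).intervalIntegrable 0 1)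
    exact this.symm
  · exact continuous_iff_continuousAt.2 fun x => (hd m x).continuousAt

end ParametricIntegral

section ReflectionOperator

open MeasureTheory Set Topology InnerProductSpace

variable {V : Type*} [NormedAddCommGroup V] [InnerProductSpace ℝ V]

/-- The second directional derivative of `f` at `x` in the direction `v`. -/
noncomputable def secondDeriv (f : V → ℝ) (v x : V) : ℝ := fderiv ℝ (fderiv ℝ f) x v v

theorem contDiff_secondDeriv {f : V → ℝ} (hf : ContDiff ℝ (⊤ : ℕ∞) f) (v : V) :
    ContDiff ℝ (⊤ : ℕ∞) (secondDeriv f v) := by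
  have h1 : ContDiff ℝ (⊤ : ℕ∞) (fderiv ℝ f) := hf.fderiv_right (by simp)
  have h2 : ContDiff ℝ (⊤ : ℕ∞) (fderiv ℝ (fderiv ℝ f)) := h1.fderiv_right (by simp)
  exact (h2.clm_apply contDiff_const).clm_apply contDiff_const

theorem norm_iteratedFDeriv_secondDeriv_le {f : V → ℝ} (hf : ContDiff ℝ (⊤ : ℕ∞) f) (v x : V)
    (j : ℕ) :
    ‖iteratedFDeriv ℝ j (secondDeriv f v) x‖ ≤ ‖v‖ ^ 2 * ‖iteratedFDeriv ℝ (j + 2) f x‖ := by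
  have h1 : ContDiff ℝ (⊤ : ℕ∞) (fderiv ℝ f) := hf.fderiv_right (by simp)
  have h2 : ContDiff ℝ (⊤ : ℕ∞) (fderiv ℝ (fderiv ℝ f)) := h1.fderiv_right (by simp)
  have h3 := norm_iteratedFDeriv_clm_apply_const (n := j) (c := v) (h2.contDiffAt (x := x))
    (by exact_mod_cast le_top)
  have h4 := norm_iteratedFDeriv_clm_apply_const (n := j) (c := v)
    ((h2.clm_apply (contDiff_const (c := v))).contDiffAt (x := x)) (by exact_mod_cast le_top)
  rw [norm_iteratedFDeriv_fderiv, norm_iteratedFDeriv_fderiv] at h3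
  calc _ ≤ ‖v‖ * (‖v‖ * ‖iteratedFDeriv ℝ (j + 2) f x‖) := h4.trans (by gcongr)
    _ = _ := by ring

theorem secondDeriv_nonpos_of_isLocalMax {f : V → ℝ} (hf : ContDiff ℝ (⊤ : ℕ∞) f) {x : V}
    (hx : IsLocalMax f x) (v : V) : secondDeriv f v x ≤ 0 := by
  by_contra! hpos
  have h1 : ContDiff ℝ (⊤ : ℕ∞) (fderiv ℝ f) := hf.fderiv_right (by simp)
  set g : ℝ → ℝ := fun t => f (x + t • v) with hg
  have hline : ∀ t, HasDerivAt (fun t : ℝ => x + t • v) v t := fun t => by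
    simpa using ((hasDerivAt_id t).smul_const v).const_add x
  have hd : ∀ t, HasDerivAt g (fderiv ℝ f (x + t • v) v) t := fun t =>
    ((hf.differentiable (by simp)).differentiableAt.hasFDerivAt).comp_hasDerivAt t (hline t)
  have hdg : deriv g = fun t => fderiv ℝ f (x + t • v) v := funext fun t => (hd t).deriv
  have hdd : HasDerivAt (deriv g) (secondDeriv f v x) 0 := by
    rw [hdg]
    have := ((h1.differentiable (by simp)).differentiableAt.hasFDerivAt
      (x := x + (0:ℝ) • v)).comp_hasDerivAt 0 (hline 0)
    have h3 := this.clm_apply (hasDerivAt_const (0:ℝ) v)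
    simpa [secondDeriv] using h3
  have hmax : IsLocalMax g 0 := by
    have : Filter.Tendsto (fun t : ℝ => x + t • v) (𝓝 0) (𝓝 x) := by
      have := (hline 0).continuousAt.tendsto
      simpa using this
    have h := this.eventually hx
    filter_upwards [h] with t ht
    simpa [hg] using ht
  have hmin : IsLocalMin g 0 := by
    refine isLocalMin_of_deriv_deriv_pos (by rw [hdd.deriv]; exact hpos) ?_ (hd 0).continuousAt
    exact hmax.deriv_eq_zero
  have hconst : g =ᶠ[𝓝 0] fun _ => g 0 := by
    filter_upwards [hmax, hmin] with t h1 h2 using le_antisymm h1 h2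
  have h0 : deriv (deriv g) 0 = 0 := by
    have := hconst.deriv.deriv_eq
    rw [this]; simp
  rw [hdd.deriv] at h0
  exact (ne_of_gt hpos) h0

/-- Multiplication by `t` along `l` and the identity on the orthogonal complement of `l`. -/
noncomputable def squeeze (l : V) (t : ℝ) (x : V) : V :=
  x - ((1 - t) * (inner ℝ l x / ‖l‖ ^ 2)) • l

theorem norm_squeeze_le {l : V} (hl : l ≠ 0) {t : ℝ} (h0 : 0 ≤ t) (h1 : t ≤ 1) (x : V) :
    ‖squeeze l t x‖ ≤ ‖x‖ := by
  have hl' : 0 < ‖l‖ := norm_pos_iff.2 hl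
  refine abs_le_of_sq_le_sq' ?_ (norm_nonneg _) |>.2
  rw [squeeze, norm_sub_sq_real, norm_smul, inner_smul_right, real_inner_comm l x, mul_pow,
    Real.norm_eq_abs, sq_abs]
  have : (1 - t) * (inner ℝ l x / ‖l‖ ^ 2) * inner ℝ l x * 2
      - ((1 - t) * (inner ℝ l x / ‖l‖ ^ 2)) ^ 2 * ‖l‖ ^ 2
      = (1 - t ^ 2) * ((inner ℝ l x) ^ 2 / ‖l‖ ^ 2) := by
    field_simp; ring
  have h2 : 0 ≤ (1 - t ^ 2) * ((inner ℝ l x) ^ 2 / ‖l‖ ^ 2) :=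
    mul_nonneg (by nlinarith) (by positivity)
  linarith

/-- The mean of the second derivatives of `f` in the unit direction of `l` along the segment from
`x` to its projection to the hyperplane orthogonal to `l`. -/
noncomputable def rootOp (l : V) (f : V → ℝ) (x : V) : ℝ :=
  ∫ t in (0 : ℝ)..1, (‖l‖ ^ 2)⁻¹ * secondDeriv f l (squeeze l t x)

theorem contDiff_squeeze (l : V) : ContDiff ℝ (⊤ : ℕ∞) (fun p : ℝ × V => squeeze l p.1 p.2) := by
  unfold squeeze
  have : ContDiff ℝ (⊤ : ℕ∞) (fun p : ℝ × V => inner ℝ l p.2) := contDiff_const.inner ℝ contDiff_snd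
  fun_prop

theorem contDiff_rootOp_integrand {f : V → ℝ} (hf : ContDiff ℝ (⊤ : ℕ∞) f) (l : V) :
    ContDiff ℝ (⊤ : ℕ∞) (Function.uncurry fun t x =>
      (‖l‖ ^ 2)⁻¹ * secondDeriv f l (squeeze l t x)) :=
  contDiff_const.mul ((contDiff_secondDeriv hf l).comp (contDiff_squeeze l))

theorem contDiff_rootOp [FiniteDimensional ℝ V] {f : V → ℝ} (hf : ContDiff ℝ (⊤ : ℕ∞) f) (l : V) :
    ContDiff ℝ (⊤ : ℕ∞) (rootOp l f) :=
  (hasFTaylorSeriesUpTo_intervalIntegral (contDiff_rootOp_integrand hf l)).contDiff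

theorem norm_iteratedFDeriv_rootOp_le [FiniteDimensional ℝ V] {f : V → ℝ}
    (hf : ContDiff ℝ (⊤ : ℕ∞) f) {l : V}
    (hl : l ≠ 0) {j : ℕ} {R B : ℝ}
    (hB : ∀ y, ‖y‖ ≤ R → ‖iteratedFDeriv ℝ (j + 2) f y‖ ≤ B) {x : V} (hx : ‖x‖ ≤ R) :
    ‖iteratedFDeriv ℝ j (rootOp l f) x‖ ≤ B := by
  have hl' : 0 < ‖l‖ := norm_pos_iff.2 hl
  have hT := hasFTaylorSeriesUpTo_intervalIntegral (contDiff_rootOp_integrand hf l)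
  have hB0 : 0 ≤ B := (norm_nonneg _).trans (hB x hx)
  have h := hT.eq_iteratedFDeriv (m := j) (by exact_mod_cast le_top) x
  change ‖iteratedFDeriv ℝ j (fun x => ∫ t in (0 : ℝ)..1,
    (‖l‖ ^ 2)⁻¹ * secondDeriv f l (squeeze l t x)) x‖ ≤ B
  rw [← h]
  refine (intervalIntegral.norm_integral_le_of_norm_le_const (C := B) fun t ht => ?_).trans
    (by simp)
  rw [uIoc_of_le zero_le_one] at ht
  let P : V →L[ℝ] V := ContinuousLinearMap.id ℝ V -
    ((1 - t) * (‖l‖ ^ 2)⁻¹) • (innerSL ℝ l).smulRight l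
  have hP : ∀ y, P y = squeeze l t y := fun y => by
    simp [P, squeeze, smul_smul]; congr 1; ring
  have hPn : ‖P‖ ≤ 1 := P.opNorm_le_bound zero_le_one fun y => by
    rw [hP, one_mul]; exact norm_squeeze_le hl ht.1.le ht.2 y
  have hs := contDiff_secondDeriv hf l
  have heq : (fun x => (‖l‖ ^ 2)⁻¹ * secondDeriv f l (squeeze l t x)) =
      (‖l‖ ^ 2)⁻¹ • (secondDeriv f l ∘ P) := by
    ext y; simp [hP]
  rw [heq, iteratedFDeriv_const_smul_apply
      ((hs.comp P.contDiff).contDiffAt.of_le (by exact_mod_cast le_top)), norm_smul,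
    P.iteratedFDeriv_comp_right hs x (i := j) (by exact_mod_cast le_top)]
  have h1 := ContinuousMultilinearMap.norm_compContinuousLinearMap_le
    (iteratedFDeriv ℝ j (secondDeriv f l) (P x)) (fun _ => P)
  have h2 := norm_iteratedFDeriv_secondDeriv_le hf l (P x) j
  have h3 := hB (P x) ((by rw [hP]; exact (norm_squeeze_le hl ht.1.le ht.2 x).trans hx))
  have h4 : ∏ _i : Fin j, ‖P‖ ≤ 1 := Finset.prod_le_one (fun _ _ => norm_nonneg _) fun _ _ => hPn
  rw [Real.norm_of_nonneg (by positivity)]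
  calc _ ≤ (‖l‖ ^ 2)⁻¹ * ((‖l‖ ^ 2 * B) * 1) := by
        gcongr
        refine h1.trans (mul_le_mul (h2.trans (by gcongr)) h4 ?_ (by positivity))
        exact Finset.prod_nonneg fun _ _ => norm_nonneg _
    _ = B := by field_simp

theorem rootOp_spec {f : V → ℝ} (hf : ContDiff ℝ (⊤ : ℕ∞) f) {l : V} (hl : l ≠ 0)
    (hinv : ∀ x, f (x - (2 * inner ℝ l x / ‖l‖ ^ 2) • l) = f x) (x : V) :
    fderiv ℝ f x l = inner ℝ l x * rootOp l f x := by
  have hl' : 0 < ‖l‖ := norm_pos_iff.2 hl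
  have h1 : ContDiff ℝ (⊤ : ℕ∞) (fderiv ℝ f) := hf.fderiv_right (by simp)
  set c := inner ℝ l x / ‖l‖ ^ 2 with hc
  have hline : ∀ t, HasDerivAt (fun t : ℝ => squeeze l t x) (c • l) t := fun t => by
    have h := ((((hasDerivAt_id t).const_sub 1).mul_const c).smul_const l).const_sub x
    simpa [squeeze] using h
  have hd : ∀ t, HasDerivAt (fun t => fderiv ℝ f (squeeze l t x) l)
      (c * secondDeriv f l (squeeze l t x)) t := by
    intro t
    have := ((h1.differentiable (by simp)).differentiableAt.hasFDerivAt
      (x := squeeze l t x)).comp_hasDerivAt t (hline t)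
    have h3 := this.clm_apply (hasDerivAt_const t l)
    simpa [secondDeriv] using h3
  have hcont : Continuous fun t => c * secondDeriv f l (squeeze l t x) :=
    continuous_const.mul ((contDiff_secondDeriv hf l).continuous.comp
      ((contDiff_squeeze l).continuous.comp (by fun_prop : Continuous fun t : ℝ => (t, x))))
  have hInt := intervalIntegral.integral_eq_sub_of_hasDerivAt (a := 0) (b := 1)
    (fun t _ => hd t) (hcont.intervalIntegrable 0 1)
  have hs1 : squeeze l 1 x = x := by simp [squeeze]
  have hzero : fderiv ℝ f (squeeze l 0 x) l = 0 := by
    set z := squeeze l 0 x with hz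
    have hzl : inner ℝ l z = 0 := by
      simp [hz, squeeze, inner_sub_right, inner_smul_right]
      field_simp; ring
    have hev : ∀ t : ℝ, f (z + (-t) • l) = f (z + t • l) := fun t => by
      rw [← hinv (z + t • l)]
      congr 1
      rw [inner_add_right, hzl, inner_smul_right, real_inner_self_eq_norm_sq]
      have : 2 * (0 + t * ‖l‖ ^ 2) / ‖l‖ ^ 2 = 2 * t := by field_simp; ring
      rw [this]; module
    have hl1 : HasDerivAt (fun t : ℝ => z + t • l) l 0 := by
      simpa using ((hasDerivAt_id (0:ℝ)).smul_const l).const_add z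
    have hl2 : HasDerivAt (fun t : ℝ => z + (-t) • l) (-l) 0 := by
      simpa using ((hasDerivAt_neg (0:ℝ)).smul_const l).const_add z
    have hD : DifferentiableAt ℝ f z := (hf.differentiable (by simp)).differentiableAt
    have e1 : HasDerivAt (fun t : ℝ => f (z + t • l)) (fderiv ℝ f z l) 0 :=
      HasFDerivAt.comp_hasDerivAt 0 (by simpa using hD.hasFDerivAt) hl1
    have e2 : HasDerivAt (fun t : ℝ => f (z + (-t) • l)) (fderiv ℝ f z (-l)) 0 :=
      HasFDerivAt.comp_hasDerivAt 0 (by simpa using hD.hasFDerivAt) hl2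
    simp only [hev] at e2
    have := e1.unique e2
    rw [map_neg] at this
    linarith
  rw [hs1, hzero, sub_zero, intervalIntegral.integral_const_mul] at hInt
  rw [← hInt, rootOp, intervalIntegral.integral_const_mul, hc]
  ring

end ReflectionOperator

section RootLaplacian

open MeasureTheory Set Topology InnerProductSpace Module

variable {V : Type*} [NormedAddCommGroup V] [InnerProductSpace ℝ V] [FiniteDimensional ℝ V]
  {ι : Type*} [Fintype ι]

theorem sum_secondDeriv_eq {κ κ' : Type*} [Fintype κ] [Fintype κ'] (b : OrthonormalBasis κ ℝ V)
    (b' : OrthonormalBasis κ' ℝ V) (f : V → ℝ) (x : V) :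
    ∑ i, secondDeriv f (b i) x = ∑ i, secondDeriv f (b' i) x := by
  have h := congrFun (laplacian_eq_iteratedFDeriv_orthonormalBasis f b) x
  have h₂ := congrFun (laplacian_eq_iteratedFDeriv_orthonormalBasis f b') x
  simp only [iteratedFDeriv_two_apply] at h h₂
  exact h.symm.trans h₂

/-- The radial part of the Laplacian associated with the roots `l`, written with integral means of
second derivatives. -/
noncomputable def rootLap (l : ι → V) (f : V → ℝ) (x : V) : ℝ :=
  ∑ i, secondDeriv f (stdOrthonormalBasis ℝ V i) x + ∑ i, rootOp (l i) f x

/-- The average of `rootLap` over a finite group of isometries. -/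
noncomputable def meanRootLap (l : ι → V) (W : Subgroup (V ≃ₗᵢ[ℝ] V)) [Fintype W] (f : V → ℝ)
    (x : V) : ℝ :=
  (Fintype.card W : ℝ)⁻¹ * ∑ w : W, rootLap l f (w.1 x)

theorem contDiff_rootLap (l : ι → V) {f : V → ℝ} (hf : ContDiff ℝ (⊤ : ℕ∞) f) :
    ContDiff ℝ (⊤ : ℕ∞) (rootLap l f) :=
  (ContDiff.sum fun _ _ => contDiff_secondDeriv hf _).add
    (ContDiff.sum fun i _ => contDiff_rootOp hf (l i))

theorem norm_iteratedFDeriv_rootLap_le {l : ι → V} (hl : ∀ i, l i ≠ 0) {f : V → ℝ}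
    (hf : ContDiff ℝ (⊤ : ℕ∞) f) {j : ℕ} {R B : ℝ}
    (hB : ∀ y, ‖y‖ ≤ R → ‖iteratedFDeriv ℝ (j + 2) f y‖ ≤ B) {x : V} (hx : ‖x‖ ≤ R) :
    ‖iteratedFDeriv ℝ j (rootLap l f) x‖ ≤ (finrank ℝ V + Fintype.card ι) * B := by
  have hle : ((j : ℕ) : WithTop ℕ∞) ≤ (⊤ : ℕ∞) := by exact_mod_cast le_top
  have h1 : ∀ i, ContDiff ℝ j (secondDeriv f (stdOrthonormalBasis ℝ V i)) := fun i =>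
    (contDiff_secondDeriv hf _).of_le hle
  have h2 : ∀ i, ContDiff ℝ j (rootOp (l i) f) := fun i => (contDiff_rootOp hf _).of_le hle
  have e : rootLap l f = (fun x => ∑ i, secondDeriv f (stdOrthonormalBasis ℝ V i) x) +
    fun x => ∑ i, rootOp (l i) f x := rfl
  rw [e, iteratedFDeriv_add_apply (ContDiff.sum fun i _ => h1 i).contDiffAt
      (ContDiff.sum fun i _ => h2 i).contDiffAt,
      iteratedFDeriv_fun_sum_apply fun i _ => (h1 i).contDiffAt,
    iteratedFDeriv_fun_sum_apply fun i _ => (h2 i).contDiffAt, add_mul]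
  refine (norm_add_le _ _).trans (add_le_add ?_ ?_)
  · refine (norm_sum_le_of_le (f := fun i => _) (n := fun _ => B) _ fun i _ => ?_).trans (by simp)
    refine (norm_iteratedFDeriv_secondDeriv_le hf _ x j).trans ?_
    rw [(stdOrthonormalBasis ℝ V).orthonormal.1 i]
    simpa using hB x hx
  · refine (norm_sum_le_of_le (f := fun i => _) (n := fun _ => B) _ fun i _ => ?_).trans (by simp)
    exact norm_iteratedFDeriv_rootOp_le hf (hl i) hB hx

variable {W : Subgroup (V ≃ₗᵢ[ℝ] V)} [Fintype W]

theorem contDiff_meanRootLap (l : ι → V) {f : V → ℝ} (hf : ContDiff ℝ (⊤ : ℕ∞) f) :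
    ContDiff ℝ (⊤ : ℕ∞) (meanRootLap l W f) :=
  contDiff_const.mul (ContDiff.sum fun w _ => (contDiff_rootLap l hf).comp w.1.contDiff)

theorem meanRootLap_apply_mem (l : ι → V) (f : V → ℝ) {w : V ≃ₗᵢ[ℝ] V} (hw : w ∈ W) (x : V) :
    meanRootLap l W f (w x) = meanRootLap l W f x := by
  unfold meanRootLap
  congr 1
  exact Fintype.sum_equiv (Equiv.mulRight (⟨w, hw⟩ : W)) _ _ fun v => rfl

theorem norm_iteratedFDeriv_meanRootLap_le {l : ι → V} (hl : ∀ i, l i ≠ 0) {f : V → ℝ}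
    (hf : ContDiff ℝ (⊤ : ℕ∞) f) {j : ℕ} {R B : ℝ}
    (hB : ∀ y, ‖y‖ ≤ R → ‖iteratedFDeriv ℝ (j + 2) f y‖ ≤ B) {x : V} (hx : ‖x‖ ≤ R) :
    ‖iteratedFDeriv ℝ j (meanRootLap l W f) x‖ ≤ (finrank ℝ V + Fintype.card ι) * B := by
  have hle : ((j : ℕ) : WithTop ℕ∞) ≤ (⊤ : ℕ∞) := by exact_mod_cast le_top
  have hs : ∀ w : W, ContDiff ℝ j (rootLap l f ∘ w.1) := fun w =>
    ((contDiff_rootLap l hf).comp w.1.contDiff).of_le hle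
  have e : meanRootLap l W f = (Fintype.card W : ℝ)⁻¹ • fun x => ∑ w : W, (rootLap l f ∘ w.1) x :=
    rfl
  rw [e, iteratedFDeriv_const_smul_apply (ContDiff.sum fun w _ => hs w).contDiffAt,
    iteratedFDeriv_fun_sum_apply fun w _ => (hs w).contDiffAt, norm_smul,
    Real.norm_of_nonneg (by positivity)]
  have hW : (0 : ℝ) < Fintype.card W := by exact_mod_cast Fintype.card_pos
  rw [inv_mul_le_iff₀ hW]
  refine (norm_sum_le_of_le (f := fun i => _)
    (n := fun _ => (finrank ℝ V + Fintype.card ι) * B) _ fun w _ => ?_).trans (by simp)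
  rw [LinearIsometryEquiv.norm_iteratedFDeriv_comp_right]
  exact norm_iteratedFDeriv_rootLap_le hl hf hB (by simpa using hx)

theorem contDiff_iterate_meanRootLap (l : ι → V) {f : V → ℝ} (hf : ContDiff ℝ (⊤ : ℕ∞) f) (i : ℕ) :
    ContDiff ℝ (⊤ : ℕ∞) ((meanRootLap l W)^[i] f) := by
  induction i with
  | zero => exact hf
  | succ i ih => rw [Function.iterate_succ_apply']; exact contDiff_meanRootLap l ih

theorem norm_iteratedFDeriv_iterate_meanRootLap_le {l : ι → V} (hl : ∀ i, l i ≠ 0) {f : V → ℝ}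
    (hf : ContDiff ℝ (⊤ : ℕ∞) f) (i : ℕ) {j : ℕ} {R B : ℝ}
    (hB : ∀ y, ‖y‖ ≤ R → ‖iteratedFDeriv ℝ (j + 2 * i) f y‖ ≤ B) {x : V} (hx : ‖x‖ ≤ R) :
    ‖iteratedFDeriv ℝ j ((meanRootLap l W)^[i] f) x‖ ≤
      (finrank ℝ V + Fintype.card ι) ^ i * B := by
  induction i generalizing j x with
  | zero => simpa using hB x hx
  | succ i ih =>
    rw [Function.iterate_succ_apply', pow_succ', mul_assoc]
    refine norm_iteratedFDeriv_meanRootLap_le hl (contDiff_iterate_meanRootLap l hf i)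
      (fun y hy => ih (fun z hz => ?_) hy) hx
    have := hB z hz
    rwa [show j + 2 * (i + 1) = j + 2 + 2 * i by ring] at this

omit [FiniteDimensional ℝ V] in
theorem secondDeriv_lin {f g : V → ℝ} (hf : ContDiff ℝ (⊤ : ℕ∞) f) (hg : ContDiff ℝ (⊤ : ℕ∞) g)
    (a b : ℝ) (v x : V) :
    secondDeriv (fun y => a * f y + b * g y) v x =
      a * secondDeriv f v x + b * secondDeriv g v x := by
  have h1 : ContDiff ℝ (⊤ : ℕ∞) (fderiv ℝ f) := hf.fderiv_right (by simp)
  have h2 : ContDiff ℝ (⊤ : ℕ∞) (fderiv ℝ g) := hg.fderiv_right (by simp)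
  have e : fderiv ℝ (fun y => a * f y + b * g y) =
      fun y => a • fderiv ℝ f y + b • fderiv ℝ g y := by
    ext1 y
    exact (((hf.differentiable (by simp)).differentiableAt.hasFDerivAt.const_mul a).add
      ((hg.differentiable (by simp)).differentiableAt.hasFDerivAt.const_mul b)).fderiv
  have e2 : fderiv ℝ (fun y => a • fderiv ℝ f y + b • fderiv ℝ g y) x =
      a • fderiv ℝ (fderiv ℝ f) x + b • fderiv ℝ (fderiv ℝ g) x :=
    (((h1.differentiable (by simp)).differentiableAt.hasFDerivAt.const_smul a).add
      ((h2.differentiable (by simp)).differentiableAt.hasFDerivAt.const_smul b)).fderiv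
  rw [secondDeriv, e, e2]
  rfl

omit [FiniteDimensional ℝ V] in
theorem rootOp_lin {f g : V → ℝ} (hf : ContDiff ℝ (⊤ : ℕ∞) f) (hg : ContDiff ℝ (⊤ : ℕ∞) g)
    (a b : ℝ) (l x : V) :
    rootOp l (fun y => a * f y + b * g y) x = a * rootOp l f x + b * rootOp l g x := by
  have hi : ∀ {f : V → ℝ}, ContDiff ℝ (⊤ : ℕ∞) f → Continuous
      (fun t => (‖l‖ ^ 2)⁻¹ * secondDeriv f l (squeeze l t x)) := fun hf =>
    (contDiff_rootOp_integrand hf l).continuous.comp (by fun_prop : Continuous fun t : ℝ => (t, x))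
  unfold rootOp
  rw [← intervalIntegral.integral_const_mul, ← intervalIntegral.integral_const_mul,
    ← intervalIntegral.integral_add (((hi hf).const_mul a).intervalIntegrable 0 1)
      (((hi hg).const_mul b).intervalIntegrable 0 1)]
  congr 1
  ext t
  rw [secondDeriv_lin hf hg]
  ring

theorem meanRootLap_lin (l : ι → V) {f g : V → ℝ} (hf : ContDiff ℝ (⊤ : ℕ∞) f)
    (hg : ContDiff ℝ (⊤ : ℕ∞) g) (a b : ℝ) (x : V) :
    meanRootLap l W (fun y => a * f y + b * g y) x =
      a * meanRootLap l W f x + b * meanRootLap l W g x := by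
  unfold meanRootLap rootLap
  simp only [secondDeriv_lin hf hg, rootOp_lin hf hg, Finset.sum_add_distrib, ← Finset.mul_sum]
  ring

omit [FiniteDimensional ℝ V] in
theorem secondDeriv_norm_sq (v x : V) : secondDeriv (fun y : V => ‖y‖ ^ 2) v x = 2 * ‖v‖ ^ 2 := by
  have e : fderiv ℝ (fun y : V => ‖y‖ ^ 2) = fun y => 2 • innerSL ℝ y := by
    ext1 y
    exact (hasStrictFDerivAt_norm_sq y).hasFDerivAt.fderiv
  have e2 : HasFDerivAt (fun y : V => 2 • innerSL ℝ y) (2 • innerSL ℝ (E := V)) x :=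
    (2 • innerSL ℝ (E := V)).hasFDerivAt
  rw [secondDeriv, e, e2.fderiv]
  change (2 • innerSL ℝ v) v = _
  simp only [_root_.smul_apply, innerSL_apply_apply, real_inner_self_eq_norm_sq]
  simp

theorem meanRootLap_norm_sq {l : ι → V} (hl : ∀ i, l i ≠ 0) (x : V) :
    meanRootLap l W (fun y : V => ‖y‖ ^ 2) x = 2 * (finrank ℝ V + Fintype.card ι) := by
  have hW : (Fintype.card W : ℝ) ≠ 0 := by exact_mod_cast Fintype.card_ne_zero
  have h1 : ∀ i x, rootOp (l i) (fun y : V => ‖y‖ ^ 2) x = 2 := by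
    intro i x
    have : ‖l i‖ ≠ 0 := norm_ne_zero_iff.2 (hl i)
    simp only [rootOp, secondDeriv_norm_sq, intervalIntegral.integral_const]
    simp
    field_simp
  have h2 : ∀ i, ‖stdOrthonormalBasis ℝ V i‖ = 1 := (stdOrthonormalBasis ℝ V).orthonormal.1
  simp only [meanRootLap, rootLap, secondDeriv_norm_sq, h1, h2]
  simp
  field_simp

theorem rootLap_nonpos_of_isLocalMax {l : ι → V} (hl : ∀ i, l i ≠ 0) {f : V → ℝ}
    (hf : ContDiff ℝ (⊤ : ℕ∞) f)
    (hinv : ∀ i x, f (x - (2 * inner ℝ (l i) x / ‖l i‖ ^ 2) • l i) = f x) {x : V}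
    (hx : IsLocalMax f x) : rootLap l f x ≤ 0 := by
  refine add_nonpos (Finset.sum_nonpos fun i _ => secondDeriv_nonpos_of_isLocalMax hf hx _)
    (Finset.sum_nonpos fun i _ => ?_)
  by_cases h0 : inner ℝ (l i) x = 0
  · have : ∀ t, squeeze (l i) t x = x := fun t => by simp [squeeze, h0]
    simp only [rootOp, this, intervalIntegral.integral_const]
    simpa using mul_nonpos_of_nonneg_of_nonpos (by positivity)
      (secondDeriv_nonpos_of_isLocalMax hf hx (l i))
  · have h := rootOp_spec hf (hl i) (hinv i) x
    rw [hx.fderiv_eq_zero] at h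
    have h' : inner ℝ (l i) x * rootOp (l i) f x = 0 := h.symm
    rw [(mul_eq_zero.1 h').resolve_left h0]

theorem le_of_meanRootLap_pos {l : ι → V} (hl : ∀ i, l i ≠ 0) {f : V → ℝ}
    (hf : ContDiff ℝ (⊤ : ℕ∞) f)
    (hinv : ∀ i x, f (x - (2 * inner ℝ (l i) x / ‖l i‖ ^ 2) • l i) = f x)
    (hW : ∀ w ∈ W, ∀ x, f (w x) = f x) {R K : ℝ} (hpos : ∀ x, ‖x‖ ≤ R → 0 < meanRootLap l W f x)
    (hK : ∀ x, ‖x‖ = R → f x ≤ K) {x : V} (hx : ‖x‖ ≤ R) : f x ≤ K := by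
  obtain ⟨y, hy, hmax⟩ := (isCompact_closedBall (0 : V) R).exists_isMaxOn
    ⟨x, by simpa using hx⟩ hf.continuous.continuousOn
  have hy' : ‖y‖ ≤ R := by simpa using hy
  rcases hy'.eq_or_lt with h | h
  · exact (hmax (by simpa using hx)).trans (hK y h)
  · exfalso
    have hloc : ∀ w : W, IsLocalMax f (w.1 y) := by
      intro w
      have : Metric.ball (0 : V) R ∈ 𝓝 (w.1 y) :=
        Metric.isOpen_ball.mem_nhds (by simpa using h)
      filter_upwards [this] with z hz
      rw [hW _ w.2]
      exact hmax (Metric.ball_subset_closedBall hz)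
    have h2 : meanRootLap l W f y ≤ 0 :=
      mul_nonpos_of_nonneg_of_nonpos (by positivity)
        (Finset.sum_nonpos fun w _ => rootLap_nonpos_of_isLocalMax hl hf hinv (hloc w))
    exact absurd (hpos y hy') (not_lt.2 h2)

theorem abs_le_of_abs_meanRootLap_le [Nontrivial V] {l : ι → V} (hl : ∀ i, l i ≠ 0) {f : V → ℝ}
    (hf : ContDiff ℝ (⊤ : ℕ∞) f)
    (hinv : ∀ i x, f (x - (2 * inner ℝ (l i) x / ‖l i‖ ^ 2) • l i) = f x)
    (hW : ∀ w ∈ W, ∀ x, f (w x) = f x) {R ε : ℝ} (hε : 0 < ε)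
    (hL : ∀ x, ‖x‖ ≤ R → |meanRootLap l W f x| ≤ ε)
    (hK : ∀ x, ‖x‖ = R → |f x| ≤ ε) {x : V} (hx : ‖x‖ ≤ R) : |f x| ≤ ε * (1 + R ^ 2) := by
  have hdim : (1 : ℝ) ≤ finrank ℝ V := by exact_mod_cast Module.finrank_pos (R := ℝ) (M := V)
  have hns : ContDiff ℝ (⊤ : ℕ∞) (fun y : V => ‖y‖ ^ 2) := contDiff_norm_sq ℝ
  have key : ∀ a : ℝ, |a| = 1 → a * f x ≤ ε * (1 + R ^ 2) := by
    intro a ha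
    have h := le_of_meanRootLap_pos (W := W) (R := R) (K := ε * (1 + R ^ 2)) hl
      (f := fun y => a * f y + ε * ‖y‖ ^ 2)
      ((contDiff_const.mul hf).add (contDiff_const.mul hns)) ?_ ?_ ?_ ?_ hx
    · have : 0 ≤ ε * ‖x‖ ^ 2 := by positivity
      linarith
    · intro i y
      have : ‖y - (2 * inner ℝ (l i) y / ‖l i‖ ^ 2) • l i‖ ^ 2 = ‖y‖ ^ 2 := by
        have : ‖l i‖ ≠ 0 := norm_ne_zero_iff.2 (hl i)
        rw [norm_sub_sq_real, inner_smul_right, norm_smul, real_inner_comm (l i) y, mul_pow,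
          Real.norm_eq_abs, sq_abs]
        field_simp
        ring
      simp only [hinv i y, this]
    · intro w hw y
      simp [hW w hw y]
    · intro y hy
      rw [meanRootLap_lin l hf hns, meanRootLap_norm_sq hl]
      have h1 : |a * meanRootLap l W f y| ≤ ε := by rw [abs_mul, ha, one_mul]; exact hL y hy
      have h2 := (abs_le.1 h1).1
      have h3 : (0 : ℝ) ≤ Fintype.card ι := by positivity
      nlinarith [mul_nonneg hε.le h3, mul_le_mul_of_nonneg_left hdim hε.le]
    · intro y hy
      have h1 : |a * f y| ≤ ε := by rw [abs_mul, ha, one_mul]; exact hK y hy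
      have h2 := (abs_le.1 h1).2
      simp only [hy]
      linarith
  have h1 := key 1 (by simp)
  have h2 := key (-1) (by simp)
  exact abs_le.2 ⟨by linarith, by linarith⟩

end RootLaplacian

section RadialPart

open Set Topology InnerProductSpace Module NormedSpace

theorem secondDeriv_comp_clm {V E : Type*} [NormedAddCommGroup V] [InnerProductSpace ℝ V]
    [NormedAddCommGroup E] [InnerProductSpace ℝ E] {q : E → ℝ} (hq : ContDiff ℝ (⊤ : ℕ∞) q)
    (A : V →L[ℝ] E) (v x : V) :
    secondDeriv (fun y => q (A y)) v x = secondDeriv q (A v) (A x) := by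
  have h1 : ContDiff ℝ (⊤ : ℕ∞) (fderiv ℝ q) := hq.fderiv_right (by simp)
  have e : fderiv ℝ (fun y => q (A y)) = fun y => (fderiv ℝ q (A y)).comp A := by
    ext1 y
    exact ((hq.differentiable (by simp)).differentiableAt.hasFDerivAt.comp y
      A.hasFDerivAt).fderiv
  have e2 : HasFDerivAt (fun y => (fderiv ℝ q (A y)).comp A)
      (((ContinuousLinearMap.compL ℝ V E ℝ).flip A).comp ((fderiv ℝ (fderiv ℝ q) (A x)).comp A))
      x :=
    ((ContinuousLinearMap.compL ℝ V E ℝ).flip A).hasFDerivAt.comp x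
      ((h1.differentiable (by simp)).differentiableAt.hasFDerivAt.comp x A.hasFDerivAt)
  rw [secondDeriv, e, e2.fderiv]
  rfl

variable {E : Type*} [NormedAddCommGroup E] [InnerProductSpace ℝ E] [FiniteDimensional ℝ E]

omit [FiniteDimensional ℝ E] in
theorem exists_orthonormalBasis_sum {κ κ' : Type*} [Fintype κ] [Fintype κ'] {S : Submodule ℝ E}
    (b : OrthonormalBasis κ ℝ S) (e : OrthonormalBasis κ' ℝ Sᗮ) :
    ∃ c : OrthonormalBasis (κ ⊕ κ') ℝ E, (∀ i, c (Sum.inl i) = b i) ∧ ∀ i, c (Sum.inr i) = e i := by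
  classical
  have ho : Orthonormal ℝ (Sum.elim (fun i => (b i : E)) fun i => (e i : E)) := by
    rw [orthonormal_iff_ite]
    have hb := orthonormal_iff_ite.1 b.orthonormal
    have he := orthonormal_iff_ite.1 e.orthonormal
    rintro (i | i) (j | j)
    · simpa using hb i j
    · simpa using (e j).2 _ (b i).2
    · simpa [real_inner_comm] using (e i).2 _ (b j).2
    · simpa using he i j
  suffices h : (Submodule.span ℝ (range (Sum.elim (fun i => (b i : E)) fun i => (e i : E))))ᗮ = ⊥ by
    have hc := OrthonormalBasis.coe_of_orthogonal_eq_bot_mk ho h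
    exact ⟨OrthonormalBasis.mkOfOrthogonalEqBot ho h, fun i => congrFun hc (Sum.inl i),
      fun i => congrFun hc (Sum.inr i)⟩
  rw [Submodule.eq_bot_iff]
  intro x hx
  have hxo : ∀ i, inner ℝ ((Sum.elim (fun i => (b i : E)) fun i => (e i : E)) i) x = 0 :=
    fun i => hx _ (Submodule.subset_span ⟨i, rfl⟩)
  have hxS : x ∈ Sᗮ := by
    intro u hu
    have : u = ∑ i, (inner ℝ (b i) ⟨u, hu⟩ : ℝ) • (b i : E) := by
      have := congrArg (Subtype.val) (b.sum_repr' ⟨u, hu⟩)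
      simpa using this.symm
    rw [this, sum_inner]
    refine Finset.sum_eq_zero fun i _ => ?_
    rw [inner_smul_left, show inner ℝ (b i : E) x = 0 from hxo (Sum.inl i), mul_zero]
  have : (⟨x, hxS⟩ : Sᗮ) = 0 := by
    rw [← e.sum_repr' ⟨x, hxS⟩]
    refine Finset.sum_eq_zero fun i _ => ?_
    rw [show inner ℝ (e i) (⟨x, hxS⟩ : Sᗮ) = 0 from hxo (Sum.inr i), zero_smul]
  simpa using congrArg Subtype.val this

variable {G : Set (E →L[ℝ] E)} {hG : IsIsometryGroup G} {S : Submodule ℝ E}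

namespace RootSystemData

variable (R : RootSystemData hG S)

/-- The roots as elements of the section. -/
def root (i : Fin (finrank ℝ Sᗮ)) : S := ⟨R.l i, R.l_mem i⟩

theorem root_ne_zero (i) : R.root i ≠ 0 := fun h => R.l_ne_zero i (congrArg Subtype.val h)

theorem restrict_reflection (hS : IsLinearSection hG S) {q : E → ℝ}
    (hinv : ∀ g ∈ G, ∀ x, q (g x) = q x) (i) (x : S) :
    q ((x - (2 * inner ℝ (R.root i) x / ‖R.root i‖ ^ 2) • R.root i : S) : E) = q x := by
  obtain ⟨k, hk, h⟩ := R.exists_reflection hS i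
  rw [← hinv k hk x, h x x.2]
  rfl

theorem sum_secondDeriv_eq_rootLap_of_ne_zero (hS : IsLinearSection hG S) {q : E → ℝ}
    (hq : ContDiff ℝ (⊤ : ℕ∞) q) (hinv : ∀ g ∈ G, ∀ x, q (g x) = q x) (s : S)
    (hs : ∀ i, inner ℝ (R.l i) (s : E) ≠ 0) :
    ∑ i, secondDeriv q (stdOrthonormalBasis ℝ E i) s = rootLap R.root (fun x : S => q x) s := by
  have h1 : ContDiff ℝ (⊤ : ℕ∞) (fderiv ℝ q) := hq.fderiv_right (by simp)
  have hqS : ContDiff ℝ (⊤ : ℕ∞) (fun x : S => q x) := hq.comp (contDiff_submodule_coe S)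
  obtain ⟨c, hc1, hc2⟩ := exists_orthonormalBasis_sum (stdOrthonormalBasis ℝ S) R.e
  rw [sum_secondDeriv_eq _ c, Fintype.sum_sum_type, rootLap]
  have hcurve : ∀ i (t : ℝ), fderiv ℝ q (exp (t • R.A i) s) (exp (t • R.A i) (R.A i s)) = 0 := by
    intro i t
    have := ((hq.differentiable (by simp)).differentiableAt.hasFDerivAt).comp_hasDerivAt t
      (hasDerivAt_clm_exp_apply (R.A i) s t)
    have e : (q ∘ fun u : ℝ => exp (u • R.A i) s) = fun _ => q s :=
      funext fun u => hinv _ (R.A_mem i u) s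
    rw [e] at this
    exact this.unique (hasDerivAt_const t (q s))
  have hgrad : ∀ v ∈ Sᗮ, fderiv ℝ q s v = 0 := by
    intro v hv
    have he : ∀ i, fderiv ℝ q s (R.e i : E) = 0 := by
      intro i
      have := hcurve i 0
      simp only [zero_smul, exp_zero, one_apply_eq_self] at this
      rw [R.A_apply i s s.2, map_smul, smul_eq_mul] at this
      exact (mul_eq_zero.1 this).resolve_left (hs i)
    have : v = ∑ i, (inner ℝ (R.e i) ⟨v, hv⟩ : ℝ) • (R.e i : E) := by
      have := congrArg (Subtype.val) (R.e.sum_repr' ⟨v, hv⟩)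
      simpa using this.symm
    rw [this, map_sum]
    exact Finset.sum_eq_zero fun i _ => by rw [map_smul, he, smul_zero]
  congr 1
  · refine Finset.sum_congr rfl fun i _ => ?_
    rw [hc1]
    exact (secondDeriv_comp_clm hq S.subtypeL _ s).symm
  · refine Finset.sum_congr rfl fun i _ => ?_
    rw [hc2]
    have hdd : HasDerivAt (fun t : ℝ => fderiv ℝ q (exp (t • R.A i) s)
        (exp (t • R.A i) (R.A i s)))
        (fderiv ℝ (fderiv ℝ q) s (R.A i s) (R.A i s) + fderiv ℝ q s (R.A i (R.A i s))) 0 := by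
      have h2 : HasDerivAt (fun t : ℝ => fderiv ℝ q (exp (t • R.A i) s))
          (fderiv ℝ (fderiv ℝ q) s (R.A i s)) 0 :=
        HasFDerivAt.comp_hasDerivAt 0
          (by simpa using (h1.differentiable (by simp)).differentiableAt.hasFDerivAt (x := (s : E)))
          (hasDerivAt_clm_exp_apply_zero (R.A i) s)
      simpa using h2.clm_apply (hasDerivAt_clm_exp_apply_zero (R.A i) (R.A i s))
    have hz : (fun t : ℝ => fderiv ℝ q (exp (t • R.A i) s) (exp (t • R.A i) (R.A i s))) =
      fun _ => 0 := funext fun t => hcurve i t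
    rw [hz] at hdd
    have h0 := hdd.unique (hasDerivAt_const (0 : ℝ) (0 : ℝ))
    have hAe : fderiv ℝ q s (R.A i (R.e i)) = - fderiv ℝ q s (R.l i) := by
      have hm : R.A i (R.e i) + R.l i ∈ Sᗮ := by
        intro u hu
        have h3 := inner_lie_skew hG (R.A_mem i) u (R.e i)
        rw [R.A_apply i u hu, inner_smul_left] at h3
        have h4 : inner ℝ (R.e i : E) (R.e i : E) = (1 : ℝ) := by
          have := R.e.orthonormal.1 i
          rw [real_inner_self_eq_norm_sq, show ‖(R.e i : E)‖ = 1 from this]; norm_num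
        rw [inner_add_right, real_inner_comm (R.l i) u]
        rw [h4] at h3
        simp only [conj_trivial, mul_one] at h3
        rw [h3]; ring
      have := hgrad _ hm
      rw [map_add] at this
      linarith
    have hl : fderiv ℝ q s (R.l i) = inner ℝ (R.l i) (s : E) *
        rootOp (R.root i) (fun x : S => q x) s := by
      have h3 := rootOp_spec hqS (R.root_ne_zero i) (R.restrict_reflection hS hinv i) s
      have h4 : fderiv ℝ (fun x : S => q x) s (R.root i) = fderiv ℝ q s (R.l i) := by
        have := ((hq.differentiable (by simp)).differentiableAt.hasFDerivAt
          (x := (s : E))).comp s S.subtypeL.hasFDerivAt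
        have h5 := this.fderiv
        change fderiv ℝ (fun x : S => q x) s = _ at h5
        rw [h5]; rfl
      rw [← h4, h3]
      rfl
    rw [R.A_apply i s s.2] at h0
    simp only [map_smul, _root_.smul_apply, smul_eq_mul, hAe, hl] at h0
    have h6 : inner ℝ (R.l i) (s : E) ^ 2 * (secondDeriv q (R.e i : E) s -
        rootOp (R.root i) (fun x : S => q x) s) = 0 := by
      unfold secondDeriv
      linear_combination h0
    have := (mul_eq_zero.1 h6).resolve_left (pow_ne_zero 2 (hs i))
    linarith

theorem sum_secondDeriv_eq_rootLap (hS : IsLinearSection hG S) {q : E → ℝ}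
    (hq : ContDiff ℝ (⊤ : ℕ∞) q) (hinv : ∀ g ∈ G, ∀ x, q (g x) = q x) (s : S) :
    ∑ i, secondDeriv q (stdOrthonormalBasis ℝ E i) s = rootLap R.root (fun x : S => q x) s := by
  have hqS : ContDiff ℝ (⊤ : ℕ∞) (fun x : S => q x) := hq.comp (contDiff_submodule_coe S)
  set a : S := ⟨R.a, R.a_mem⟩
  have hline : Filter.Tendsto (fun t : ℝ => s + t • a) (𝓝[≠] 0) (𝓝 s) := by
    have : Continuous fun t : ℝ => s + t • a := by fun_prop
    have := this.tendsto 0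
    simp only [zero_smul, add_zero] at this
    exact this.mono_left nhdsWithin_le_nhds
  have hl : Continuous fun s : S => ∑ i, secondDeriv q (stdOrthonormalBasis ℝ E i) s :=
    continuous_finsetSum _ fun i _ =>
      (contDiff_secondDeriv hq _).continuous.comp continuous_subtype_val
  have hr := (contDiff_rootLap R.root hqS).continuous
  refine tendsto_nhds_unique_of_eventuallyEq ((hl.tendsto s).comp hline)
    ((hr.tendsto s).comp hline) ?_
  have hreg : ∀ᶠ t : ℝ in 𝓝[≠] 0, ∀ i, inner ℝ (R.l i) (s : E) + t ≠ 0 := by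
    rw [Filter.eventually_all]
    intro i
    by_cases h0 : inner ℝ (R.l i) (s : E) = 0
    · filter_upwards [self_mem_nhdsWithin] with t ht
      simpa [h0] using ht
    · refine nhdsWithin_le_nhds ?_
      have : Continuous fun t : ℝ => inner ℝ (R.l i) (s : E) + t := by fun_prop
      exact this.continuousAt.eventually_ne (by simpa using h0)
  filter_upwards [hreg] with t ht
  refine R.sum_secondDeriv_eq_rootLap_of_ne_zero hS hq hinv (s + t • a) fun i => ?_
  have := ht i
  change inner ℝ (R.l i) ((s : E) + t • R.a) ≠ 0
  rwa [inner_add_right, inner_smul_right, R.inner_a, mul_one]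

theorem sum_secondDeriv_eq_meanRootLap (hS : IsLinearSection hG S) {q : E → ℝ}
    (hq : ContDiff ℝ (⊤ : ℕ∞) q) (hinv : ∀ g ∈ G, ∀ x, q (g x) = q x)
    (hinv' : ∀ g ∈ G, ∀ x, ∑ i, secondDeriv q (stdOrthonormalBasis ℝ E i) (g x) =
      ∑ i, secondDeriv q (stdOrthonormalBasis ℝ E i) x)
    {W : Subgroup (S ≃ₗᵢ[ℝ] S)} [Fintype W]
    (hW : ∀ w ∈ W, ∃ g ∈ G, ∀ s : S, g s = w s) (s : S) :
    ∑ i, secondDeriv q (stdOrthonormalBasis ℝ E i) s =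
      meanRootLap R.root W (fun x : S => q x) s := by
  have : ∀ w : W, rootLap R.root (fun x : S => q x) (w.1 s) =
      ∑ i, secondDeriv q (stdOrthonormalBasis ℝ E i) s := by
    intro w
    obtain ⟨g, hg, h⟩ := hW _ w.2
    rw [← R.sum_secondDeriv_eq_rootLap hS hq hinv, ← h, hinv' g hg]
  have hW0 : (Fintype.card W : ℝ) ≠ 0 := by exact_mod_cast Fintype.card_ne_zero
  rw [meanRootLap]
  simp only [this, Finset.sum_const, Finset.card_univ, nsmul_eq_mul]
  field_simp

end RootSystemData

end RadialPart

section PolynomialFunctions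

open Set Topology Module

variable {E : Type*} [NormedAddCommGroup E] [InnerProductSpace ℝ E]

/-- Smooth functions whose derivatives of order `d + 1` vanish, i.e. polynomials of degree at most
`d`. -/
def polyFun (E : Type*) [NormedAddCommGroup E] [InnerProductSpace ℝ E] (d : ℕ) :
    Submodule ℝ (E → ℝ) where
  carrier := {u | ContDiff ℝ (⊤ : ℕ∞) u ∧ ∀ x, iteratedFDeriv ℝ (d + 1) u x = 0}
  add_mem' := by
    rintro u v ⟨hu, hu'⟩ ⟨hv, hv'⟩
    refine ⟨hu.add hv, fun x => ?_⟩
    rw [iteratedFDeriv_add_apply (hu.contDiffAt.of_le (by exact_mod_cast le_top))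
      (hv.contDiffAt.of_le (by exact_mod_cast le_top)), hu', hv', add_zero]
  zero_mem' := ⟨contDiff_const, fun x => by
    rw [show (0 : E → ℝ) = fun _ => 0 from rfl, iteratedFDeriv_fun_zero]; rfl⟩
  smul_mem' := by
    rintro c u ⟨hu, hu'⟩
    refine ⟨contDiff_const.smul hu, fun x => ?_⟩
    rw [iteratedFDeriv_const_smul_apply (hu.contDiffAt.of_le (by exact_mod_cast le_top)), hu',
      smul_zero]

theorem iteratedFDeriv_eq_zero_of_mem_polyFun {d : ℕ} {u : E → ℝ} (hu : u ∈ polyFun E d) {j : ℕ}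
    (hj : d < j) (x : E) : iteratedFDeriv ℝ j u x = 0 := by
  induction j, hj using Nat.le_induction generalizing x with
  | base => exact hu.2 x
  | succ j _ ih =>
    have : iteratedFDeriv ℝ j u = fun _ => 0 := funext ih
    ext v
    rw [iteratedFDeriv_succ_apply_left, this, fderiv_fun_const]
    rfl

theorem polyFun_mono {d d' : ℕ} (h : d ≤ d') : polyFun E d ≤ polyFun E d' := fun _ hu =>
  ⟨hu.1, fun x => iteratedFDeriv_eq_zero_of_mem_polyFun hu (by omega) x⟩

theorem eq_zero_of_mem_polyFun {d : ℕ} {u : E → ℝ} (hu : u ∈ polyFun E d)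
    (h0 : ∀ j ≤ d, iteratedFDeriv ℝ j u 0 = 0) : u = 0 := by
  have key : ∀ i ≤ d + 1, ∀ x, iteratedFDeriv ℝ (d + 1 - i) u x = 0 := by
    intro i hi
    induction i with
    | zero => simpa using hu.2
    | succ i ih =>
      have ih := ih (by omega)
      set j := d + 1 - (i + 1) with hj
      rw [show d + 1 - i = j + 1 by omega] at ih
      have hd : Differentiable ℝ (iteratedFDeriv ℝ j u) :=
        hu.1.differentiable_iteratedFDeriv (by exact_mod_cast ENat.natCast_lt_top j)
      have hz : ∀ x, fderiv ℝ (iteratedFDeriv ℝ j u) x = 0 := fun x => by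
        have := (hu.1.ftaylorSeries (𝕜 := ℝ)).fderiv j (by exact_mod_cast ENat.natCast_lt_top j) x
        have h2 := HasFDerivAt.fderiv this
        rw [show ftaylorSeries ℝ u x (Nat.succ j) = 0 from ih x] at h2
        exact h2
      intro x
      rw [is_const_of_fderiv_eq_zero hd hz x 0, h0 j (by omega)]
  ext x
  have := key (d + 1) le_rfl x
  rw [Nat.sub_self] at this
  rw [Pi.zero_apply, ← norm_eq_zero, ← norm_iteratedFDeriv_zero (𝕜 := ℝ), this, norm_zero]

theorem eq_zero_of_mem_polyFun_of_ball {d : ℕ} {u : E → ℝ} (hu : u ∈ polyFun E d) {R : ℝ}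
    (hR : 0 < R) (h0 : ∀ x, ‖x‖ < R → u x = 0) : u = 0 := by
  refine eq_zero_of_mem_polyFun hu fun j _ => ?_
  have : u =ᶠ[𝓝 0] fun _ => 0 := by
    filter_upwards [Metric.ball_mem_nhds (0 : E) hR] with x hx
    exact h0 x (by simpa using hx)
  rw [(this.iteratedFDeriv ℝ j).eq_of_nhds, iteratedFDeriv_fun_zero]
  rfl

theorem mul_mem_polyFun {d d' : ℕ} {u v : E → ℝ} (hu : u ∈ polyFun E d) (hv : v ∈ polyFun E d') :
    (fun x => u x * v x) ∈ polyFun E (d + d') := by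
  refine ⟨hu.1.mul hv.1, fun x => norm_le_zero_iff.1 ?_⟩
  refine (norm_iteratedFDeriv_mul_le hu.1 hv.1 x
    (n := d + d' + 1) (by exact_mod_cast le_top)).trans (Finset.sum_nonpos fun i _ => ?_)
  rcases lt_or_ge d i with h | h
  · rw [iteratedFDeriv_eq_zero_of_mem_polyFun hu h]; simp
  · rw [iteratedFDeriv_eq_zero_of_mem_polyFun hv (j := d + d' + 1 - i) (by omega)]; simp

theorem const_mem_polyFun (c : ℝ) (d : ℕ) : (fun _ : E => c) ∈ polyFun E d :=
  polyFun_mono (Nat.zero_le d) ⟨contDiff_const, fun x => by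
    rw [iteratedFDeriv_const_of_ne (by simp)]; rfl⟩

theorem clm_mem_polyFun (A : E →L[ℝ] ℝ) : (fun x => A x) ∈ polyFun E 1 := by
  refine ⟨A.contDiff, fun x => ?_⟩
  rw [← norm_eq_zero, ← norm_iteratedFDeriv_fderiv]
  have : fderiv ℝ (fun x => A x) = fun _ => A := by ext1 y; exact A.fderiv
  rw [this, iteratedFDeriv_const_of_ne (by simp)]
  simp

theorem comp_mem_polyFun {F : Type*} [NormedAddCommGroup F] [InnerProductSpace ℝ F] {d : ℕ}
    {u : E → ℝ} (hu : u ∈ polyFun E d) (A : F →L[ℝ] E) : (fun x => u (A x)) ∈ polyFun F d := by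
  refine ⟨hu.1.comp A.contDiff, fun x => ?_⟩
  have := A.iteratedFDeriv_comp_right hu.1 x (i := d + 1) (by exact_mod_cast le_top)
  change iteratedFDeriv ℝ (d + 1) (u ∘ A) x = 0
  rw [this, hu.2]
  rfl

theorem norm_sq_mem_polyFun [FiniteDimensional ℝ E] :
    (fun x : E => ‖x‖ ^ 2) ∈ polyFun E 2 := by
  have : (fun x : E => ‖x‖ ^ 2) =
      ∑ i, fun x : E => innerSL ℝ (stdOrthonormalBasis ℝ E i) x *
        innerSL ℝ (stdOrthonormalBasis ℝ E i) x := by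
    ext x
    rw [← (stdOrthonormalBasis ℝ E).sum_sq_norm_inner_right x, Finset.sum_apply]
    simp [sq]
  rw [this]
  exact Submodule.sum_mem _ fun i _ => mul_mem_polyFun (clm_mem_polyFun _) (clm_mem_polyFun _)

theorem secondDeriv_mem_polyFun {d : ℕ} {u : E → ℝ} (hu : u ∈ polyFun E (d + 2)) (v : E) :
    secondDeriv u v ∈ polyFun E d := by
  refine ⟨contDiff_secondDeriv hu.1 v, fun x => norm_le_zero_iff.1 ?_⟩
  refine (norm_iteratedFDeriv_secondDeriv_le hu.1 v x (d + 1)).trans ?_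
  rw [show d + 1 + 2 = d + 2 + 1 by ring, hu.2]
  simp

instance [FiniteDimensional ℝ E] (d : ℕ) : FiniteDimensional ℝ (polyFun E d) := by
  have hfin : ∀ j, FiniteDimensional ℝ (E [×j]→L[ℝ] ℝ) := fun j =>
    FiniteDimensional.of_injective
      (ContinuousMultilinearMap.toMultilinearMapLinear : (E [×j]→L[ℝ] ℝ) →ₗ[ℝ] _)
      ContinuousMultilinearMap.toMultilinearMap_injective
  let T : polyFun E d →ₗ[ℝ] ((j : Fin (d + 1)) → E [×j]→L[ℝ] ℝ) :=
    { toFun := fun u j => iteratedFDeriv ℝ j u.1 0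
      map_add' := fun u v => by
        ext1 j
        exact iteratedFDeriv_add_apply (u.2.1.contDiffAt.of_le (by exact_mod_cast le_top))
          (v.2.1.contDiffAt.of_le (by exact_mod_cast le_top))
      map_smul' := fun c u => by
        ext1 j
        exact iteratedFDeriv_const_smul_apply (u.2.1.contDiffAt.of_le (by exact_mod_cast le_top)) }
  refine FiniteDimensional.of_injective T ?_
  rw [← LinearMap.ker_eq_bot, LinearMap.ker_eq_bot']
  intro u hu
  refine Subtype.ext (eq_zero_of_mem_polyFun u.2 fun j hj => ?_)
  exact congrFun hu (⟨j, by omega⟩ : Fin (d + 1))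

theorem exists_polyFun_approx [FiniteDimensional ℝ E] {F : E → ℝ} (hF : Continuous F) (R : ℝ)
    {ε : ℝ} (hε : 0 < ε) :
    ∃ d, ∃ p ∈ polyFun E d, ∀ x, ‖x‖ ≤ R → |p x - F x| ≤ ε := by
  let B := Metric.closedBall (0 : E) R
  let A : Subalgebra ℝ C(B, ℝ) :=
    { carrier := {u | ∃ d, ∃ p ∈ polyFun E d, ∀ x : B, u x = p x}
      mul_mem' := by
        rintro u v ⟨d, p, hp, hup⟩ ⟨d', p', hp', hvp⟩
        exact ⟨_, _, mul_mem_polyFun hp hp', fun x => by simp [hup, hvp]⟩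
      add_mem' := by
        rintro u v ⟨d, p, hp, hup⟩ ⟨d', p', hp', hvp⟩
        exact ⟨max d d', _, Submodule.add_mem _ (polyFun_mono (le_max_left _ _) hp)
          (polyFun_mono (le_max_right _ _) hp'), fun x => by simp [hup, hvp]⟩
      algebraMap_mem' := fun c => ⟨0, _, const_mem_polyFun c 0, fun x => rfl⟩ }
  have hsep : A.SeparatesPoints := by
    intro x y hxy
    let A0 := innerSL ℝ ((x : E) - y)
    refine ⟨_, ⟨⟨fun z : B => A0 z, by fun_prop⟩, ⟨1, _, clm_mem_polyFun A0, fun x => rfl⟩, rfl⟩,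
      fun h => hxy (Subtype.ext ?_)⟩
    have h' : A0 x = A0 y := h
    rw [← sub_eq_zero, ← map_sub] at h'
    exact sub_eq_zero.1 (inner_self_eq_zero.1 h')
  have : CompactSpace B := isCompact_iff_compactSpace.1 (isCompact_closedBall _ _)
  obtain ⟨⟨u, d, p, hp, hup⟩, hu⟩ :=
    ContinuousMap.exists_mem_subalgebra_near_continuousMap_of_separatesPoints A hsep
      ⟨fun x : B => F x, by fun_prop⟩ ε hε
  refine ⟨d, p, hp, fun x hx => ?_⟩
  have h := (ContinuousMap.norm_lt_iff _ hε).1 hu ⟨x, by simpa [B] using hx⟩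
  have := hup ⟨x, by simpa [B] using hx⟩
  simp only [ContinuousMap.coe_sub, Pi.sub_apply, this, Real.norm_eq_abs] at h
  exact h.le

end PolynomialFunctions

section Averaging

open Set Topology Module MeasureTheory

variable {E : Type*} [NormedAddCommGroup E] [InnerProductSpace ℝ E] [FiniteDimensional ℝ E]
  {G : Set (E →L[ℝ] E)}

/-- The group structure on a group of isometries. -/
@[reducible] noncomputable def IsIsometryGroup.group (hG : IsIsometryGroup G) : Group G :=
  letI : Mul G := ⟨fun a b => ⟨a.1 * b.1, hG.mul_mem _ a.2 _ b.2⟩⟩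
  letI : One G := ⟨⟨1, hG.one_mem⟩⟩
  letI : Inv G := ⟨fun a => ⟨(hG.inv_mem a.1 a.2).choose, (hG.inv_mem a.1 a.2).choose_spec.1⟩⟩
  Group.ofLeftAxioms (fun _ _ _ => Subtype.ext (mul_assoc _ _ _))
    (fun _ => Subtype.ext (one_mul _))
    (fun a => Subtype.ext (hG.inv_mem a.1 a.2).choose_spec.2.1)

theorem IsIsometryGroup.isTopologicalGroup (hG : IsIsometryGroup G) :
    letI := hG.group
    IsTopologicalGroup G := by
  let _ := hG.group
  have hinv : ∀ a : G, (a⁻¹).1 = ContinuousLinearMap.adjoint a.1 := by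
    intro a
    have h1 : ContinuousLinearMap.adjoint a.1 * a.1 = 1 :=
      (ContinuousLinearMap.norm_map_iff_adjoint_comp_self a.1).1 (hG.norm_map a.1 a.2)
    have h2 : a.1 * (a⁻¹).1 = 1 := congrArg Subtype.val (mul_inv_cancel a)
    calc (a⁻¹).1 = (ContinuousLinearMap.adjoint a.1 * a.1) * (a⁻¹).1 := by rw [h1, one_mul]
      _ = _ := by rw [mul_assoc, h2, mul_one]
  refine { continuous_mul := ?_, continuous_inv := ?_ }
  · exact Continuous.subtype_mk ((continuous_subtype_val.comp continuous_fst).mul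
      (continuous_subtype_val.comp continuous_snd)) _
  · refine continuous_induced_rng.2 ?_
    have : (Subtype.val ∘ fun a : G => a⁻¹) = fun a : G => ContinuousLinearMap.adjoint a.1 :=
      funext hinv
    rw [this]
    exact ContinuousLinearMap.adjoint.continuous.comp continuous_subtype_val

theorem exists_invariant_polyFun_near (hG : IsIsometryGroup G) {F : E → ℝ} (hF : Continuous F)
    (hFG : ∀ g ∈ G, ∀ x, F (g x) = F x) {R : ℝ} (hR : 0 < R) {ε : ℝ} {d : ℕ} {p : E → ℝ}
    (hp : p ∈ polyFun E d) (hpF : ∀ x, ‖x‖ ≤ R → |p x - F x| ≤ ε) :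
    ∃ u ∈ polyFun E d, (∀ g ∈ G, ∀ x, u (g x) = u x) ∧ ∀ x, ‖x‖ ≤ R → |u x - F x| ≤ ε := by
  let _ := hG.group
  have := hG.isTopologicalGroup
  have : CompactSpace G := isCompact_iff_compactSpace.1 hG.isCompact
  let _ : MeasurableSpace G := borel G
  have : BorelSpace G := ⟨rfl⟩
  let μ : Measure G := Measure.haarMeasure ⊤
  have : IsProbabilityMeasure μ := ⟨Measure.haarMeasure_self (K₀ := ⊤)⟩
  let B := Metric.closedBall (0 : E) R
  have : CompactSpace B := isCompact_iff_compactSpace.1 (isCompact_closedBall _ _)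
  let FB : C(B, ℝ) := ⟨fun x => F x, by fun_prop⟩
  have hpc : Continuous p := hp.1.continuous
  have hcp : Continuous fun q : G × B => p ((q.1⁻¹).1 q.2) := by
    have h1 : Continuous fun q : G × B => ((q.1⁻¹).1 : E →L[ℝ] E) :=
      continuous_subtype_val.comp (continuous_inv.comp continuous_fst)
    exact hpc.comp (h1.clm_apply (continuous_subtype_val.comp continuous_snd))
  let Φ : C(G, C(B, ℝ)) := ContinuousMap.curry ⟨_, hcp⟩
  have hΦ : ∀ h x, Φ h x = p ((h⁻¹).1 x) := fun h x => rfl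
  let r : polyFun E d →ₗ[ℝ] C(B, ℝ) :=
    { toFun := fun u => ⟨fun x => u.1 x, u.2.1.continuous.comp continuous_subtype_val⟩
      map_add' := fun u v => rfl
      map_smul' := fun c u => rfl }
  let K : Set C(B, ℝ) := (LinearMap.range r : Set C(B, ℝ)) ∩ Metric.closedBall FB ε
  have hKc : IsClosed K :=
    (Submodule.closed_of_finiteDimensional _).inter Metric.isClosed_closedBall
  have hKv : Convex ℝ K := (Submodule.convex _).inter (convex_closedBall _ _)
  have hε : 0 ≤ ε := (abs_nonneg _).trans (hpF 0 (by simpa using hR.le))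
  have hmem : ∀ h, Φ h ∈ K := by
    intro h
    refine ⟨⟨⟨_, comp_mem_polyFun hp (h⁻¹).1⟩, rfl⟩, ?_⟩
    rw [Metric.mem_closedBall, dist_eq_norm, ContinuousMap.norm_le _ hε]
    intro x
    have hx : ‖(x : E)‖ ≤ R := mem_closedBall_zero_iff.1 x.2
    have := hpF ((h⁻¹).1 x) (by rw [hG.norm_map _ (h⁻¹).2]; exact hx)
    rwa [hFG _ (h⁻¹).2] at this
  have hInt : Integrable Φ μ := Φ.continuous.integrable_of_hasCompactSupport
    (HasCompactSupport.of_compactSpace _)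
  have hu : ∫ h, Φ h ∂μ ∈ K := hKv.integral_mem hKc (Filter.Eventually.of_forall hmem) hInt
  obtain ⟨⟨⟨u, hup⟩, hur⟩, huF⟩ := hu
  have hux : ∀ x : B, u x = ∫ h, p ((h⁻¹).1 x) ∂μ := by
    intro x
    have h1 := congrArg (fun v : C(B, ℝ) => v x) hur
    have h2 := (ContinuousMap.evalCLM ℝ x).integral_comp_comm hInt
    exact h1.trans h2.symm
  refine ⟨u, hup, fun g hg x => ?_, fun x hx => ?_⟩
  · have hd : (fun x => u (g x)) - u = 0 := by
      refine eq_zero_of_mem_polyFun_of_ball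
        (Submodule.sub_mem _ (comp_mem_polyFun hup g) hup) hR fun y hy => ?_
      have hyB : y ∈ B := by simpa [B] using hy.le
      have hgB : g y ∈ B := by simpa [B, hG.norm_map g hg] using hy.le
      have h1 := hux ⟨y, hyB⟩
      have h2 := hux ⟨g y, hgB⟩
      rw [Pi.sub_apply, sub_eq_zero]
      refine h2.trans (Eq.trans ?_ h1.symm)
      have h3 := integral_mul_left_eq_self (μ := μ) (fun h : G => p ((h⁻¹).1 (g y))) ⟨g, hg⟩
      rw [← h3]
      refine integral_congr_ae (Filter.Eventually.of_forall fun h => ?_)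
      have h4 : (((⟨g, hg⟩ : G) * h)⁻¹ * ⟨g, hg⟩).1 = (h⁻¹).1 := by group
      change p (((((⟨g, hg⟩ : G) * h)⁻¹ * ⟨g, hg⟩)).1 y) = p ((h⁻¹).1 y)
      rw [h4]
    exact sub_eq_zero.1 (congrFun hd x)
  · have h1 : dist (∫ h, Φ h ∂μ) FB ≤ ε := huF
    rw [dist_eq_norm, ContinuousMap.norm_le _ hε] at h1
    have h2 := h1 ⟨x, by simpa [B] using hx⟩
    rw [← hur] at h2
    exact h2

end Averaging

section Laplacian

open Set Topology Module

variable {E : Type*} [NormedAddCommGroup E] [InnerProductSpace ℝ E] [FiniteDimensional ℝ E]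

/-- The Laplacian of a function on a Euclidean space. -/
noncomputable def euclLap (u : E → ℝ) (x : E) : ℝ :=
  ∑ i, secondDeriv u (stdOrthonormalBasis ℝ E i) x

theorem contDiff_euclLap {u : E → ℝ} (hu : ContDiff ℝ (⊤ : ℕ∞) u) :
    ContDiff ℝ (⊤ : ℕ∞) (euclLap u) :=
  ContDiff.sum fun i _ => contDiff_secondDeriv hu (stdOrthonormalBasis ℝ E i)

theorem contDiff_iterate_euclLap {u : E → ℝ} (hu : ContDiff ℝ (⊤ : ℕ∞) u) (i : ℕ) :
    ContDiff ℝ (⊤ : ℕ∞) (euclLap^[i] u) := by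
  induction i with
  | zero => exact hu
  | succ i ih =>
    rw [Function.iterate_succ_apply']
    exact contDiff_euclLap ih

theorem euclLap_lin {u v : E → ℝ} (hu : ContDiff ℝ (⊤ : ℕ∞) u) (hv : ContDiff ℝ (⊤ : ℕ∞) v)
    (a b : ℝ) (x : E) :
    euclLap (fun y => a * u y + b * v y) x = a * euclLap u x + b * euclLap v x := by
  simp only [euclLap, secondDeriv_lin hu hv, Finset.sum_add_distrib, Finset.mul_sum]

theorem euclLap_comp_isometry {u : E → ℝ} (hu : ContDiff ℝ (⊤ : ℕ∞) u) {g : E →L[ℝ] E}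
    (hg : ∀ x, ‖g x‖ = ‖x‖) (x : E) : euclLap (fun y => u (g y)) x = euclLap u (g x) := by
  let g' : E →ₗᵢ[ℝ] E := ⟨g, hg⟩
  let e : E ≃ₗᵢ[ℝ] E := g'.toLinearIsometryEquiv rfl
  unfold euclLap
  rw [sum_secondDeriv_eq _ ((stdOrthonormalBasis ℝ E).map e) u (g x)]
  refine Finset.sum_congr rfl fun i _ => ?_
  rw [secondDeriv_comp_clm hu, OrthonormalBasis.map_apply]
  rfl

theorem euclLap_apply_of_invariant {u : E → ℝ} (hu : ContDiff ℝ (⊤ : ℕ∞) u) {g : E →L[ℝ] E}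
    (hg : ∀ x, ‖g x‖ = ‖x‖) (hug : ∀ x, u (g x) = u x) (x : E) :
    euclLap u (g x) = euclLap u x := by
  rw [← euclLap_comp_isometry hu hg]
  simp only [hug]

theorem iterate_euclLap_apply_of_invariant {u : E → ℝ} (hu : ContDiff ℝ (⊤ : ℕ∞) u)
    {g : E →L[ℝ] E} (hg : ∀ x, ‖g x‖ = ‖x‖) (hug : ∀ x, u (g x) = u x) (i : ℕ) (x : E) :
    euclLap^[i] u (g x) = euclLap^[i] u x := by
  induction i generalizing x with
  | zero => exact hug x
  | succ i ih =>
    simp only [Function.iterate_succ_apply']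
    exact euclLap_apply_of_invariant (contDiff_iterate_euclLap hu i) hg ih x

theorem euclLap_mem_polyFun {d : ℕ} {u : E → ℝ} (hu : u ∈ polyFun E (d + 2)) :
    euclLap u ∈ polyFun E d := by
  have : euclLap u = ∑ i, secondDeriv u (stdOrthonormalBasis ℝ E i) := by
    ext x
    simp [euclLap]
  rw [this]
  exact Submodule.sum_mem _ fun i _ => secondDeriv_mem_polyFun hu _

theorem meanRootLap_finZero (f : E → ℝ) :
    meanRootLap (fun _ : Fin 0 => (0 : E)) (⊥ : Subgroup (E ≃ₗᵢ[ℝ] E)) f = euclLap f := by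
  ext x
  have h (w : (⊥ : Subgroup (E ≃ₗᵢ[ℝ] E))) : w.1 x = x := by
    rw [Subgroup.mem_bot.1 w.2]
    rfl
  simp only [meanRootLap, h, rootLap, euclLap]
  simp

theorem eq_zero_of_euclLap_eq_zero [Nontrivial E] {u : E → ℝ} (hu : ContDiff ℝ (⊤ : ℕ∞) u)
    (h : euclLap u = 0) {R : ℝ} (hR : ∀ x, ‖x‖ = R → u x = 0) {x : E} (hx : ‖x‖ ≤ R) :
    u x = 0 := by
  have key : ∀ ε : ℝ, 0 < ε → |u x| ≤ ε * (1 + R ^ 2) := fun ε hε =>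
    abs_le_of_abs_meanRootLap_le (l := fun _ : Fin 0 => (0 : E)) (W := ⊥) (fun i => i.elim0) hu
      (fun i => i.elim0) (fun w hw x => by rw [Subgroup.mem_bot.1 hw]; rfl) hε
      (fun y _ => by rw [meanRootLap_finZero, h]; simpa using hε.le)
      (fun y hy => by rw [hR y hy]; simpa using hε.le) hx
  have h0 : |u x| ≤ 0 := by
    refine le_of_forall_pos_le_add fun ε hε => ?_
    have h1 : (0 : ℝ) < 1 + R ^ 2 := by positivity
    have := key (ε / (1 + R ^ 2)) (by positivity)
    rw [div_mul_cancel₀ _ h1.ne'] at this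
    linarith
  exact abs_eq_zero.1 (le_antisymm h0 (abs_nonneg _))

/-- The polynomial `(R² - ‖x‖²) g(x)`, which vanishes on the sphere of radius `R`. -/
def sphereMul (R : ℝ) (g : E → ℝ) (x : E) : ℝ := (R ^ 2 - ‖x‖ ^ 2) * g x

theorem sphereMul_mem_polyFun (R : ℝ) {d : ℕ} {g : E → ℝ} (hg : g ∈ polyFun E d) :
    sphereMul R g ∈ polyFun E (d + 2) := by
  have h1 : (fun x : E => R ^ 2 - ‖x‖ ^ 2) ∈ polyFun E 2 :=
    Submodule.sub_mem _ (const_mem_polyFun (R ^ 2) 2) norm_sq_mem_polyFun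
  rw [add_comm d]
  exact mul_mem_polyFun h1 hg

theorem exists_unique_dirichlet [Nontrivial E] {R : ℝ} (hR : 0 < R) {d : ℕ} {r : E → ℝ}
    (hr : r ∈ polyFun E d) :
    ∃! g, g ∈ polyFun E d ∧ euclLap (sphereMul R g) = r := by
  let T : polyFun E d →ₗ[ℝ] polyFun E d :=
    { toFun := fun g => ⟨_, euclLap_mem_polyFun (sphereMul_mem_polyFun R g.2)⟩
      map_add' := fun u v => by
        ext x
        have := euclLap_lin (sphereMul_mem_polyFun R u.2).1 (sphereMul_mem_polyFun R v.2).1 1 1 x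
        simp only [one_mul] at this
        refine Eq.trans ?_ this
        change euclLap _ x = _
        congr 1
        ext y
        simp only [sphereMul, Submodule.coe_add, Pi.add_apply]
        ring
      map_smul' := fun c u => by
        ext x
        have := euclLap_lin (sphereMul_mem_polyFun R u.2).1 (sphereMul_mem_polyFun R u.2).1 c 0 x
        simp only [zero_mul, add_zero] at this
        refine Eq.trans ?_ this
        change euclLap _ x = _
        congr 1
        ext y
        simp only [sphereMul, Submodule.coe_smul, Pi.smul_apply, smul_eq_mul]
        ring }
  have hinj : Function.Injective T := by
    refine (injective_iff_map_eq_zero T).2 fun g hg => Subtype.ext ?_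
    have h1 : euclLap (sphereMul R g.1) = 0 := congrArg Subtype.val hg
    refine eq_zero_of_mem_polyFun_of_ball g.2 hR fun x hx => ?_
    have h2 := eq_zero_of_euclLap_eq_zero (sphereMul_mem_polyFun R g.2).1 h1 (R := R)
      (fun y hy => by simp [sphereMul, hy]) hx.le
    have h3 : R ^ 2 - ‖x‖ ^ 2 ≠ 0 := by
      have := norm_nonneg x
      nlinarith
    exact (mul_eq_zero.1 h2).resolve_left h3
  obtain ⟨g, hg⟩ := LinearMap.injective_iff_surjective.1 hinj ⟨r, hr⟩
  refine ⟨g.1, ⟨g.2, congrArg Subtype.val hg⟩, fun g' hg' => ?_⟩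
  have : T ⟨g', hg'.1⟩ = T g := by
    rw [hg]
    exact Subtype.ext hg'.2
  exact congrArg Subtype.val (hinj this)

end Laplacian

section SimultaneousApproximation

open Set Topology Module

variable {E : Type*} [NormedAddCommGroup E] [InnerProductSpace ℝ E] [FiniteDimensional ℝ E]
  {G : Set (E →L[ℝ] E)} {hG : IsIsometryGroup G} {S : Submodule ℝ E}

theorem RootSystemData.exists_continuous_extension (R : RootSystemData hG S)
    (hS : IsLinearSection hG S) {f : S → ℝ} (hf : Continuous f)
    (hfinv : ∀ g ∈ G, (∀ u ∈ S, g u ∈ S) → ∀ s t : S, g s = t → f t = f s) :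
    ∃ F : E → ℝ, Continuous F ∧ (∀ g ∈ G, ∀ x, F (g x) = F x) ∧ ∀ s : S, F s = f s := by
  choose γ hγ hγS using hS.meets
  have key : ∀ x, ∀ g ∈ G, ∀ hg : g x ∈ S, f ⟨γ x x, hγS x⟩ = f ⟨g x, hg⟩ := by
    intro x g hgG hg
    obtain ⟨k, hk, hkg, -⟩ := hG.inv_mem g hgG
    have h1 : (γ x * k) (g x) = γ x x := by
      have : k (g x) = x := by simpa using congrArg (fun A : E →L[ℝ] E => A x) hkg
      rw [mul_apply_eq_comp, this]
    obtain ⟨w, hw, hwS, hws⟩ := R.exists_mem_normalizer hS hg (hγS x)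
      (hG.mul_mem _ (hγ x) _ hk) h1
    exact hfinv w hw hwS ⟨g x, hg⟩ ⟨γ x x, hγS x⟩ hws
  have : CompactSpace G := isCompact_iff_compactSpace.1 hG.isCompact
  refine ⟨fun x => f ⟨γ x x, hγS x⟩, ?_, ?_, ?_⟩
  · refine continuous_iff_isClosed.2 fun C hC => ?_
    have h1 : IsClosed (Subtype.val '' (f ⁻¹' C) : Set E) :=
      (S.closed_of_finiteDimensional.isClosedEmbedding_subtypeVal).isClosedMap _ (hC.preimage hf)
    have hcont : Continuous fun q : G × E => (q.1 : E →L[ℝ] E) q.2 :=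
      (continuous_subtype_val.comp continuous_fst).clm_apply continuous_snd
    have h2 := isClosedMap_snd_of_compactSpace _ (h1.preimage hcont)
    convert h2 using 1
    ext x
    constructor
    · intro hx
      exact ⟨(⟨γ x, hγ x⟩, x), ⟨⟨γ x x, hγS x⟩, hx, rfl⟩, rfl⟩
    · rintro ⟨⟨g, y⟩, ⟨s, hs, hsg⟩, rfl⟩
      have hgy : (g : E →L[ℝ] E) y ∈ S := by
        have h := s.2
        rw [hsg] at h
        exact h
      change f ⟨γ y y, hγS y⟩ ∈ C
      rw [key y g g.2 hgy]
      have : s = ⟨(g : E →L[ℝ] E) y, hgy⟩ := Subtype.ext hsg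
      rw [← this]
      exact hs
  · intro g hg x
    have := key x (γ (g x) * g) (hG.mul_mem _ (hγ _) _ hg) (hγS (g x))
    exact this.symm
  · intro s
    exact key s 1 hG.one_mem s.2

theorem RootSystemData.exists_simultaneous_approx (R : RootSystemData hG S)
    (hS : IsLinearSection hG S) [Nontrivial S] {W : Subgroup (S ≃ₗᵢ[ℝ] S)} [Fintype W]
    (hW : ∀ w ∈ W, ∃ g ∈ G, ∀ s : S, g s = w s)
    (hW' : ∀ g ∈ G, (∀ u ∈ S, g u ∈ S) → ∃ w ∈ W, ∀ s : S, g s = w s) (k : ℕ) :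
    ∀ {f : S → ℝ}, ContDiff ℝ (⊤ : ℕ∞) f → (∀ w ∈ W, ∀ s, f (w s) = f s) →
    ∀ {ρ : ℝ}, 0 < ρ → ∀ {ε : ℝ}, 0 < ε →
    ∃ d, ∃ q ∈ polyFun E d, (∀ g ∈ G, ∀ x, q (g x) = q x) ∧
      ∀ i ≤ k, ∀ s : S, ‖s‖ ≤ ρ → |euclLap^[i] q s - (meanRootLap R.root W)^[i] f s| ≤ ε := by
  have : Nontrivial E := S.nontrivial_iff_ne_bot.1 inferInstance |> fun h => by
    obtain ⟨x, -, hx⟩ := S.exists_mem_ne_zero_of_ne_bot h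
    exact ⟨x, 0, hx⟩
  have hbase : ∀ {f : S → ℝ}, ContDiff ℝ (⊤ : ℕ∞) f → (∀ w ∈ W, ∀ s, f (w s) = f s) →
      ∀ {ρ : ℝ}, 0 < ρ → ∀ {ε : ℝ}, 0 < ε → ∃ d, ∃ q ∈ polyFun E d,
      (∀ g ∈ G, ∀ x, q (g x) = q x) ∧ ∀ s : S, ‖s‖ ≤ ρ → |q s - f s| ≤ ε := by
    intro f hf hfW ρ hρ ε hε
    obtain ⟨F, hF, hFG, hFf⟩ := R.exists_continuous_extension hS hf.continuous
      fun g hg hgS s t hst => by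
        obtain ⟨w, hw, hws⟩ := hW' g hg hgS
        have : t = w s := Subtype.ext (by rw [← hst, hws])
        rw [this, hfW w hw]
    obtain ⟨d, p, hp, hpF⟩ := exists_polyFun_approx hF ρ hε
    obtain ⟨u, hu, huG, huF⟩ := exists_invariant_polyFun_near hG hF hFG hρ hp hpF
    refine ⟨d, u, hu, huG, fun s hs => ?_⟩
    rw [← hFf]
    exact huF s hs
  induction k with
  | zero =>
    intro f hf hfW ρ hρ ε hε
    obtain ⟨d, q, hq, hqG, h⟩ := hbase hf hfW hρ hε
    refine ⟨d, q, hq, hqG, fun i hi s hs => ?_⟩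
    obtain rfl := Nat.le_zero.1 hi
    exact h s hs
  | succ k ih =>
    intro f hf hfW ρ hρ ε hε
    have h1 : (1 : ℝ) ≤ 1 + ρ ^ 2 := le_add_of_nonneg_right (by positivity)
    have hε' : 0 < ε / (1 + ρ ^ 2) := by positivity
    obtain ⟨d₁, q', hq', hqG', hqa⟩ := ih (contDiff_meanRootLap R.root hf)
      (fun w hw s => meanRootLap_apply_mem R.root f hw s) hρ hε'
    obtain ⟨d₂, p, hp, hpG, hpf⟩ := hbase hf hfW hρ hε'
    have hr : (fun x => q' x - euclLap p x) ∈ polyFun E (max d₁ d₂) :=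
      Submodule.sub_mem _ (polyFun_mono (le_max_left _ _) hq')
        (euclLap_mem_polyFun (polyFun_mono ((le_max_right _ _).trans (Nat.le_add_right _ 2)) hp))
    obtain ⟨v, ⟨hv, hvr⟩, hvu⟩ := exists_unique_dirichlet hρ hr
    have hvs := sphereMul_mem_polyFun ρ hv
    have hvG : ∀ g ∈ G, ∀ x, v (g x) = v x := by
      intro g hg x
      refine congrFun (hvu (fun x => v (g x)) ⟨comp_mem_polyFun hv g, ?_⟩) x
      ext x
      have h2 : sphereMul ρ (fun x => v (g x)) = fun x => sphereMul ρ v (g x) := by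
        ext y
        simp only [sphereMul, hG.norm_map g hg]
      rw [h2, euclLap_comp_isometry hvs.1 (hG.norm_map g hg), hvr]
      beta_reduce
      rw [hqG' g hg, euclLap_apply_of_invariant hp.1 (hG.norm_map g hg) (hpG g hg)]
    let q : E → ℝ := fun x => 1 * p x + 1 * sphereMul ρ v x
    have hq : q ∈ polyFun E (max d₁ d₂ + 2) := by
      refine Submodule.add_mem _ (Submodule.smul_mem _ 1 (polyFun_mono ?_ hp))
        (Submodule.smul_mem _ 1 hvs)
      omega
    have hlq : euclLap q = q' := by
      ext x
      rw [euclLap_lin hp.1 hvs.1, hvr]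
      ring
    have hqG : ∀ g ∈ G, ∀ x, q (g x) = q x := by
      intro g hg x
      simp only [q, sphereMul, hG.norm_map g hg, hvG g hg, hpG g hg]
    have hqS : ContDiff ℝ (⊤ : ℕ∞) (fun s : S => q s) := hq.1.comp (contDiff_submodule_coe S)
    have hu : ContDiff ℝ (⊤ : ℕ∞) (fun s : S => 1 * q s + (-1) * f s) :=
      (contDiff_const.mul hqS).add (contDiff_const.mul hf)
    have hradial : ∀ s : S, meanRootLap R.root W (fun s : S => q s) s = q' s := by
      intro s
      have := R.sum_secondDeriv_eq_meanRootLap hS hq.1 hqG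
        (fun g hg x => euclLap_apply_of_invariant hq.1 (hG.norm_map g hg) (hqG g hg) x) hW s
      rw [← this, ← hlq]
      rfl
    have hfrefl : ∀ i (x : S),
        f (x - (2 * inner ℝ (R.root i) x / ‖R.root i‖ ^ 2) • R.root i) = f x := by
      intro i x
      obtain ⟨h, hh, hhs⟩ := R.exists_reflection hS i
      have hmem : ∀ u ∈ S, h u ∈ S := by
        intro u hu
        rw [hhs u hu]
        exact S.sub_mem hu (S.smul_mem _ (R.l_mem i))
      obtain ⟨w, hw, hws⟩ := hW' h hh hmem
      rw [← hfW w hw x]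
      congr 1
      refine Subtype.ext ?_
      rw [← hws, hhs x x.2]
      rfl
    refine ⟨_, q, hq, hqG, fun i hi s hs => ?_⟩
    rcases i with _ | i
    · have h3 := abs_le_of_abs_meanRootLap_le (l := R.root) (W := W) R.root_ne_zero hu
        (fun i x => by
          have h4 := R.restrict_reflection hS hqG i x
          rw [hfrefl i x, h4])
        (fun w hw x => by
          obtain ⟨g, hg, hgw⟩ := hW w hw
          rw [hfW w hw, ← hgw, hqG g hg])
        (R := ρ) hε'
        (fun x hx => by
          rw [meanRootLap_lin R.root hqS hf, hradial]
          have := hqa 0 (Nat.zero_le _) x hx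
          simp only [Function.iterate_zero, id_eq] at this
          convert this using 2
          ring)
        (fun x hx => by
          have h5 := hpf x hx.le
          have h6 : ‖(x : E)‖ = ρ := hx
          convert h5 using 2
          simp only [q, sphereMul, h6]
          ring) hs
      rw [div_mul_cancel₀ _ (by positivity)] at h3
      simp only [Function.iterate_zero, id_eq]
      convert h3 using 2
      ring
    · have h3 := hqa i (by omega) s hs
      rw [Function.iterate_succ_apply, hlq, Function.iterate_succ_apply]
      exact h3.trans (div_le_self hε.le h1)

end SimultaneousApproximation

section GradientEstimate

open Set Topology Module

variable {E : Type*} [NormedAddCommGroup E] [InnerProductSpace ℝ E] [FiniteDimensional ℝ E]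

theorem euclLap_norm_sq (x : E) : euclLap (fun y : E => ‖y‖ ^ 2) x = 2 * finrank ℝ E := by
  simp [euclLap, secondDeriv_norm_sq, mul_comm]

theorem euclLap_inner_sq (e x : E) :
    euclLap (fun y : E => ‖(inner ℝ e y : ℝ)‖ ^ 2) x = 2 * ‖e‖ ^ 2 := by
  have h : ∀ v, secondDeriv (fun y : E => ‖(inner ℝ e y : ℝ)‖ ^ 2) v x =
      2 * ‖(inner ℝ e v : ℝ)‖ ^ 2 := fun v => by
    have := secondDeriv_comp_clm (contDiff_norm_sq ℝ (E := ℝ) (n := (⊤ : ℕ∞))) (innerSL ℝ e) v x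
    rw [secondDeriv_norm_sq] at this
    exact this
  simp only [euclLap, h]
  rw [← Finset.mul_sum, OrthonormalBasis.sum_sq_norm_inner_left]

theorem euclLap_inner (e x : E) : euclLap (fun y : E => (inner ℝ e y : ℝ)) x = 0 := by
  have h : fderiv ℝ (fun y : E => (inner ℝ e y : ℝ)) = fun _ => innerSL ℝ e :=
    funext fun y => (innerSL ℝ e).fderiv
  simp [euclLap, secondDeriv, h]

theorem euclLap_comp_add_left (u : E → ℝ) (a x : E) :
    euclLap (fun y => u (a + y)) x = euclLap u (a + x) := by
  have h : fderiv ℝ (fun y => u (a + y)) = fun y => fderiv ℝ u (a + y) :=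
    funext fun y => fderiv_comp_add_left a
  simp only [euclLap, secondDeriv, h]
  rw [fderiv_comp_add_left (f := fderiv ℝ u) a]

theorem euclLap_nonneg_of_isLocalMin {u : E → ℝ} (hu : ContDiff ℝ (⊤ : ℕ∞) u) {x : E}
    (hx : IsLocalMin u x) : 0 ≤ euclLap u x := by
  have h := euclLap_lin hu hu (-1) 0 x
  simp only [zero_mul, add_zero] at h
  have hx' : IsLocalMax (fun y => -1 * u y) x := by
    filter_upwards [hx] with y hy
    linarith
  have h2 : euclLap (fun y => -1 * u y) x ≤ 0 := Finset.sum_nonpos fun i _ =>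
    secondDeriv_nonpos_of_isLocalMax (contDiff_const.mul hu) hx' _
  linarith

/-- The minimum principle on a half ball. -/
theorem nonneg_on_halfBall {w : E → ℝ} (hw : ContDiff ℝ (⊤ : ℕ∞) w) (e : E) {δ : ℝ}
    (hlap : ∀ x, ‖x‖ ≤ δ → euclLap w x < 0) (h0 : ∀ x, ‖x‖ ≤ δ → inner ℝ e x = (0 : ℝ) → 0 ≤ w x)
    (hδ : ∀ x, ‖x‖ = δ → 0 ≤ (inner ℝ e x : ℝ) → 0 ≤ w x) {x : E} (hx : ‖x‖ ≤ δ)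
    (hex : 0 ≤ (inner ℝ e x : ℝ)) : 0 ≤ w x := by
  have hc : Continuous fun y : E => (inner ℝ e y : ℝ) := by fun_prop
  have hcomp : IsCompact (Metric.closedBall (0 : E) δ ∩ {y | 0 ≤ (inner ℝ e y : ℝ)}) :=
    (isCompact_closedBall _ _).inter_right (isClosed_le continuous_const hc)
  obtain ⟨a, ⟨ha, hea⟩, hmin⟩ := hcomp.exists_isMinOn ⟨x, mem_closedBall_zero_iff.2 hx, hex⟩
    hw.continuous.continuousOn
  refine le_trans ?_ (hmin ⟨mem_closedBall_zero_iff.2 hx, hex⟩)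
  rw [mem_closedBall_zero_iff] at ha
  by_contra! hneg
  have h1 : ‖a‖ < δ := lt_of_le_of_ne ha fun h => (hδ a h hea).not_gt hneg
  have h2 : 0 < (inner ℝ e a : ℝ) := lt_of_le_of_ne hea fun h => (h0 a ha h.symm).not_gt hneg
  have hloc : IsLocalMin w a := by
    filter_upwards [continuous_norm.continuousAt.eventually_lt continuousAt_const h1,
      continuousAt_const.eventually_lt hc.continuousAt h2] with y hy1 hy2
    exact hmin ⟨mem_closedBall_zero_iff.2 hy1.le, hy2.le⟩
  exact (euclLap_nonneg_of_isLocalMin hw hloc).not_gt (hlap a ha)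

theorem fderiv_zero_le_of_unit {u : E → ℝ} (hu : ContDiff ℝ (⊤ : ℕ∞) u) {e : E} (he : ‖e‖ = 1)
    {δ : ℝ} (hδ : 0 < δ) {A F : ℝ} (hA : ∀ y, ‖y‖ ≤ δ → |u y| ≤ A)
    (hF : ∀ y, ‖y‖ ≤ δ → |euclLap u y| < F) :
    fderiv ℝ u 0 e ≤ finrank ℝ E / δ * A + δ / 2 * F := by
  set n := (finrank ℝ E : ℝ)
  have hn : 0 ≤ n := Nat.cast_nonneg _
  have hA0 : 0 ≤ A := (abs_nonneg _).trans (hA 0 (by simpa using hδ.le))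
  have hF0 : 0 < F := (abs_nonneg _).trans_lt (hF 0 (by simpa using hδ.le))
  let σ : E →L[ℝ] E := ((ℝ ∙ e)ᗮ.reflection : E →L[ℝ] E)
  have hσ : ∀ x, σ x = x - (2 * inner ℝ e x : ℝ) • e := fun x => by
    change (ℝ ∙ e)ᗮ.reflection x = _
    rw [Submodule.reflection_orthogonal_apply, Submodule.reflection_singleton_apply]
    simp only [he]
    simp only [RCLike.ofReal_one, one_pow, div_one]
    module
  have hσn : ∀ x, ‖σ x‖ = ‖x‖ := fun x => (ℝ ∙ e)ᗮ.reflection.norm_map x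
  have hee : inner ℝ e e = (1 : ℝ) := by rw [real_inner_self_eq_norm_sq, he, one_pow]
  let w : E → ℝ := fun x => 1 * (A / δ ^ 2 * ‖x‖ ^ 2 + 1 *
    ((-(n * A / δ ^ 2) - F / 2) * ‖(inner ℝ e x : ℝ)‖ ^ 2 + (n * A / δ + δ * F / 2) * inner ℝ e x))
    + (-1 / 2) * (1 * u x + (-1) * u (σ x))
  have c1 : ContDiff ℝ (⊤ : ℕ∞) (fun x : E => ‖x‖ ^ 2) := contDiff_norm_sq ℝ
  have c2 : ContDiff ℝ (⊤ : ℕ∞) (fun x : E => (inner ℝ e x : ℝ)) :=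
    contDiff_const.inner ℝ contDiff_id
  have c3 : ContDiff ℝ (⊤ : ℕ∞) (fun x : E => ‖(inner ℝ e x : ℝ)‖ ^ 2) :=
    (contDiff_norm_sq ℝ).comp c2
  have c4 : ContDiff ℝ (⊤ : ℕ∞) (fun x : E => u (σ x)) := hu.comp σ.contDiff
  have c5 := (contDiff_const (c := -(n * A / δ ^ 2) - F / 2)).mul c3 |>.add
    ((contDiff_const (c := n * A / δ + δ * F / 2)).mul c2)
  have c6 := (contDiff_const (c := A / δ ^ 2)).mul c1 |>.add
    ((contDiff_const (c := (1 : ℝ))).mul c5)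
  have c7 := (contDiff_const (c := (1 : ℝ))).mul hu |>.add ((contDiff_const (c := (-1 : ℝ))).mul c4)
  have hw : ContDiff ℝ (⊤ : ℕ∞) w := (contDiff_const.mul c6).add (contDiff_const.mul c7)
  have hlap : ∀ x, ‖x‖ ≤ δ → euclLap w x < 0 := by
    intro x hx
    rw [euclLap_lin c6 c7, euclLap_lin c1 c5, euclLap_lin c3 c2, euclLap_lin hu c4,
      euclLap_norm_sq, euclLap_inner_sq, euclLap_inner, euclLap_comp_isometry hu hσn, he]
    have h1 := abs_lt.1 (hF x hx)
    have h2 := abs_lt.1 (hF (σ x) ((hσn x).trans_le hx))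
    have h3 : A / δ ^ 2 * (2 * n) = 2 * (n * A / δ ^ 2) := by ring
    linarith [h1.1, h2.2]
  have hfix : ∀ x, inner ℝ e x = (0 : ℝ) → σ x = x := fun x hx => by rw [hσ, hx]; simp
  have hnn : ∀ x, ‖x‖ ≤ δ → 0 ≤ (inner ℝ e x : ℝ) → 0 ≤ w x := by
    intro x hx hex
    refine nonneg_on_halfBall hw e hlap (fun y hy hey => ?_) (fun y hy hey => ?_) hx hex
    · simp only [w, hey, hfix y hey]
      have : 0 ≤ A / δ ^ 2 * ‖y‖ ^ 2 := by positivity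
      simp only [norm_zero]
      linarith
    · have h1 := abs_le.1 (hA y hy.le)
      have h2 := abs_le.1 (hA (σ y) ((hσn y).trans_le hy.le))
      have h3 : (inner ℝ e y : ℝ) ≤ δ := by
        have := real_inner_le_norm e y
        rwa [he, hy, one_mul] at this
      have h4 : A / δ ^ 2 * ‖y‖ ^ 2 = A := by rw [hy]; field_simp
      have h5 : 0 ≤ (n * A / δ ^ 2 + F / 2) * (inner ℝ e y * (δ - inner ℝ e y)) := by
        have : 0 ≤ δ - (inner ℝ e y : ℝ) := by linarith
        positivity
      have h6 : (n * A / δ ^ 2 + F / 2) * (inner ℝ e y * (δ - inner ℝ e y)) =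
          (-(n * A / δ ^ 2) - F / 2) * ‖(inner ℝ e y : ℝ)‖ ^ 2 +
            (n * A / δ + δ * F / 2) * inner ℝ e y := by
        rw [Real.norm_eq_abs, sq_abs]
        field_simp
        ring
      simp only [w]
      rw [h4, ← h6]
      linarith [h1.2, h2.1]
  have hline : HasDerivAt (fun t : ℝ => t • e) e 0 := by
    simpa using (hasDerivAt_id (0 : ℝ)).smul_const e
  have hd : HasDerivAt (fun t : ℝ => w (t • e))
      ((n * A / δ + δ * F / 2) - fderiv ℝ u 0 e) 0 := by
    have e1 : HasDerivAt (fun t : ℝ => u (t • e)) (fderiv ℝ u 0 e) 0 :=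
      HasFDerivAt.comp_hasDerivAt 0 (by
        simpa using (hu.differentiable (by simp)).differentiableAt.hasFDerivAt (x := (0 : E))) hline
    have e2 : HasDerivAt (fun t : ℝ => u (-(t • e))) (fderiv ℝ u 0 (-e)) 0 :=
      HasFDerivAt.comp_hasDerivAt 0 (by
        simpa using (hu.differentiable (by simp)).differentiableAt.hasFDerivAt (x := (0 : E)))
        hline.neg
    have e3 := ((hasDerivAt_id (0 : ℝ)).pow 2)
    have heq : (fun t : ℝ => w (t • e)) = fun t => (A / δ ^ 2 - n * A / δ ^ 2 - F / 2) * (id t) ^ 2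
        + (n * A / δ + δ * F / 2) * t + (-1 / 2) * (u (t • e) - u (-(t • e))) := by
      ext t
      have : σ (t • e) = -(t • e) := by
        rw [hσ, inner_smul_right, hee]
        module
      simp only [w, this, inner_smul_right, hee, norm_smul, he, Real.norm_eq_abs, mul_one, sq_abs,
        id]
      ring
    rw [heq]
    have := ((e3.const_mul (A / δ ^ 2 - n * A / δ ^ 2 - F / 2)).add
      ((hasDerivAt_id (0 : ℝ)).const_mul (n * A / δ + δ * F / 2))).add
      ((e1.sub e2).const_mul (-1 / 2))
    refine this.congr_deriv ?_
    simp
    ring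
  have hpos : 0 ≤ (n * A / δ + δ * F / 2) - fderiv ℝ u 0 e := by
    have h0 : w ((0 : ℝ) • e) = 0 := by
      simp [w]
    refine ge_of_tendsto hd.tendsto_slope_zero_right ?_
    filter_upwards [Ioo_mem_nhdsGT hδ] with t ht
    simp only [zero_add, h0, sub_zero, smul_eq_mul]
    refine mul_nonneg (inv_nonneg.2 ht.1.le) (hnn _ ?_ ?_)
    · rw [norm_smul, he, mul_one, Real.norm_of_nonneg ht.1.le]
      exact ht.2.le
    · rw [inner_smul_right, hee, mul_one]
      exact ht.1.le
  have : n / δ * A + δ / 2 * F = n * A / δ + δ * F / 2 := by ring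
  linarith

/-- The interior gradient estimate for the Laplacian. -/
theorem abs_fderiv_le {u : E → ℝ} (hu : ContDiff ℝ (⊤ : ℕ∞) u) (e x : E)
    {δ : ℝ} (hδ : 0 < δ) {A F : ℝ} (hA : ∀ y, ‖y - x‖ ≤ δ → |u y| ≤ A)
    (hF : ∀ y, ‖y - x‖ ≤ δ → |euclLap u y| ≤ F) :
    |fderiv ℝ u x e| ≤ (finrank ℝ E / δ * A + δ / 2 * F) * ‖e‖ := by
  have hu' : ContDiff ℝ (⊤ : ℕ∞) (fun y => u (x + y)) := hu.comp (contDiff_const.add contDiff_id)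
  have key : ∀ e : E, ‖e‖ = 1 → fderiv ℝ u x e ≤ finrank ℝ E / δ * A + δ / 2 * F := by
    intro e he
    refine le_of_forall_pos_le_add fun ε hε => ?_
    have := fderiv_zero_le_of_unit hu' he hδ (A := A) (F := F + ε / (δ / 2))
      (fun y hy => hA _ (by simpa using hy)) (fun y hy => by
        rw [euclLap_comp_add_left]
        exact lt_add_of_le_of_pos (hF _ (by simpa using hy)) (by positivity))
    rw [fderiv_comp_add_left, add_zero, mul_add, mul_div_cancel₀ _ (by positivity)] at this
    linarith
  rcases eq_or_ne e 0 with rfl | he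
  · simp
  have he' : 0 < ‖e‖ := norm_pos_iff.2 he
  have h1 : e = ‖e‖ • (‖e‖⁻¹ • e) := by rw [smul_smul, mul_inv_cancel₀ he'.ne', one_smul]
  have h2 : ‖‖e‖⁻¹ • e‖ = 1 := by rw [norm_smul, norm_inv, norm_norm, inv_mul_cancel₀ he'.ne']
  have h3 := key _ h2
  have h4 := key (-(‖e‖⁻¹ • e)) (by rwa [norm_neg])
  rw [map_neg] at h4
  rw [h1, map_smul, norm_smul, h2, norm_norm, smul_eq_mul, abs_mul, abs_norm, mul_one, mul_comm]
  exact mul_le_mul_of_nonneg_right (abs_le.2 ⟨by linarith, h3⟩) he'.le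

end GradientEstimate

section IteratedGradientEstimate

open Set Topology Module

variable {E : Type*} [NormedAddCommGroup E] [InnerProductSpace ℝ E]

theorem contDiff_fderiv_const {u : E → ℝ} (hu : ContDiff ℝ (⊤ : ℕ∞) u) (e : E) :
    ContDiff ℝ (⊤ : ℕ∞) (fun x => fderiv ℝ u x e) :=
  (hu.fderiv_right (by simp)).clm_apply contDiff_const

theorem fderiv_fderiv_const {u : E → ℝ} (hu : ContDiff ℝ (⊤ : ℕ∞) u) (e v x : E) :
    fderiv ℝ (fun y => fderiv ℝ u y e) x v = fderiv ℝ (fderiv ℝ u) x v e := by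
  have h1 : ContDiff ℝ (⊤ : ℕ∞) (fderiv ℝ u) := hu.fderiv_right (by simp)
  have h2 := (h1.differentiable (by simp)).differentiableAt.hasFDerivAt (x := x)
  have h3 := (h2.clm_apply (hasFDerivAt_const e x)).fderiv
  rw [h3]
  simp

theorem fderiv_fderiv_comm {u : E → ℝ} (hu : ContDiff ℝ (⊤ : ℕ∞) u) (e v : E) :
    (fun x => fderiv ℝ (fun y => fderiv ℝ u y e) x v) =
      fun x => fderiv ℝ (fun y => fderiv ℝ u y v) x e := by
  ext x
  rw [fderiv_fderiv_const hu, fderiv_fderiv_const hu]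
  exact (hu.contDiffAt.isSymmSndFDerivAt (n := (⊤ : ℕ∞)) (by
    rw [minSmoothness_of_isRCLikeNormedField]
    exact WithTop.coe_le_coe.2 le_top)).eq v e

theorem fderiv_secondDeriv {u : E → ℝ} (hu : ContDiff ℝ (⊤ : ℕ∞) u) (e v x : E) :
    fderiv ℝ (secondDeriv u v) x e = secondDeriv (fun y => fderiv ℝ u y e) v x := by
  have h : ∀ {w : E → ℝ}, ContDiff ℝ (⊤ : ℕ∞) w →
      secondDeriv w v = fun x => fderiv ℝ (fun y => fderiv ℝ w y v) x v := fun hw => by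
    ext x
    rw [fderiv_fderiv_const hw]
    rfl
  rw [h hu, h (contDiff_fderiv_const hu e)]
  rw [congrFun (fderiv_fderiv_comm (contDiff_fderiv_const hu v) v e) x, fderiv_fderiv_comm hu v e]

variable [FiniteDimensional ℝ E]

theorem fderiv_euclLap {u : E → ℝ} (hu : ContDiff ℝ (⊤ : ℕ∞) u) (e x : E) :
    fderiv ℝ (euclLap u) x e = euclLap (fun y => fderiv ℝ u y e) x := by
  have : HasFDerivAt (euclLap u)
      (∑ i, fderiv ℝ (secondDeriv u (stdOrthonormalBasis ℝ E i)) x) x :=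
    HasFDerivAt.fun_sum fun i _ =>
      ((contDiff_secondDeriv hu _).differentiable (by simp)).differentiableAt.hasFDerivAt
  rw [this.fderiv, _root_.sum_apply]
  exact Finset.sum_congr rfl fun i _ => fderiv_secondDeriv hu e _ x

theorem fderiv_iterate_euclLap {u : E → ℝ} (hu : ContDiff ℝ (⊤ : ℕ∞) u) (e : E) (i : ℕ) :
    euclLap^[i] (fun y => fderiv ℝ u y e) = fun x => fderiv ℝ (euclLap^[i] u) x e := by
  induction i with
  | zero => rfl
  | succ i ih =>
    rw [Function.iterate_succ_apply', ih, Function.iterate_succ_apply']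
    ext x
    rw [fderiv_euclLap (contDiff_iterate_euclLap hu i)]

theorem abs_iteratedFDeriv_apply_le {δ τ : ℝ} (hδ : 0 < δ) (hτ : 0 ≤ τ) (k : ℕ) :
    ∀ {u : E → ℝ}, ContDiff ℝ (⊤ : ℕ∞) u → ∀ {A r : ℝ}, 0 ≤ A →
    (∀ i ≤ k, ∀ x, ‖x‖ ≤ r + k * δ → |euclLap^[i] u x| ≤ A * τ ^ i) →
    ∀ v x, ‖x‖ ≤ r → |iteratedFDeriv ℝ k u x v| ≤
      A * (finrank ℝ E / δ + δ / 2 * τ) ^ k * ∏ i, ‖v i‖ := by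
  induction k with
  | zero =>
    intro u hu A r hA h v x hx
    simpa using h 0 le_rfl x (by simpa using hx)
  | succ k ih =>
    intro u hu A r hA h v x hx
    set K := finrank ℝ E / δ + δ / 2 * τ
    have hK : 0 ≤ K := by positivity
    set e := v (Fin.last k)
    have hstep : ∀ i ≤ k, ∀ y, ‖y‖ ≤ r + k * δ →
        |euclLap^[i] (fun z => fderiv ℝ u z e) y| ≤ A * K * ‖e‖ * τ ^ i := by
      intro i hi y hy
      rw [fderiv_iterate_euclLap hu]
      have hz : ∀ z, ‖z - y‖ ≤ δ → ‖z‖ ≤ r + (k + 1 : ℕ) * δ := fun z hz => by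
        have := norm_le_norm_add_norm_sub' z y
        push_cast
        linarith
      refine (abs_fderiv_le (contDiff_iterate_euclLap hu i) e y hδ (A := A * τ ^ i)
        (F := A * τ ^ (i + 1)) (fun z hzy => h i (by omega) z (hz z hzy))
        fun z hzy => ?_).trans_eq ?_
      · rw [← Function.iterate_succ_apply' euclLap]
        exact h (i + 1) (by omega) z (hz z hzy)
      · simp only [K]
        ring
    have h1 := ih (contDiff_fderiv_const hu e) (by positivity) hstep (Fin.init v) x hx
    have h2 : iteratedFDeriv ℝ (k + 1) u x v =
        iteratedFDeriv ℝ k (fun z => fderiv ℝ u z e) x (Fin.init v) := by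
      rw [iteratedFDeriv_succ_apply_right]
      have h3 := (ContinuousLinearMap.apply ℝ ℝ e).iteratedFDeriv_comp_left
        ((hu.fderiv_right (m := (⊤ : ℕ∞)) (by simp)).contDiffAt (x := x)) (i := k)
        (by exact_mod_cast le_top)
      change iteratedFDeriv ℝ k (fun z => fderiv ℝ u z e) x = _ at h3
      rw [h3]
      rfl
    rw [h2]
    refine h1.trans_eq ?_
    rw [Fin.prod_univ_castSucc]
    simp only [Fin.init, e]
    ring

theorem norm_iteratedFDeriv_le_of_euclLap {u : E → ℝ} (hu : ContDiff ℝ (⊤ : ℕ∞) u) {A r τ : ℝ}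
    (hA : 0 ≤ A) (hτ : 0 ≤ τ) {k : ℕ}
    (h : ∀ i ≤ k, ∀ x, ‖x‖ ≤ r + 1 → |euclLap^[i] u x| ≤ A * τ ^ i) {x : E} (hx : ‖x‖ ≤ r) :
    ‖iteratedFDeriv ℝ k u x‖ ≤ A * (finrank ℝ E * (k + 1) + τ / (2 * (k + 1))) ^ k := by
  have hδ : (0 : ℝ) < 1 / (k + 1) := by positivity
  refine ContinuousMultilinearMap.opNorm_le_bound (by positivity) fun v => ?_
  refine (abs_iteratedFDeriv_apply_le hδ hτ k hu hA (fun i hi y hy => h i hi y ?_)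
    v x hx).trans_eq ?_
  · refine hy.trans ?_
    have : (k : ℝ) * (1 / (k + 1)) ≤ 1 := by
      rw [mul_one_div]
      exact div_le_one_of_le₀ (by linarith) (by positivity)
    linarith
  · congr 3
    field_simp

end IteratedGradientEstimate

section Limit

open Set Topology Module Filter

variable {E : Type*} [NormedAddCommGroup E] [InnerProductSpace ℝ E]

theorem hasFTaylorSeriesUpTo_of_uniformCauchySeqOn {q : ℕ → E → ℝ}
    (hq : ∀ j, ContDiff ℝ (⊤ : ℕ∞) (q j))
    (hC : ∀ k : ℕ, ∀ r : ℝ, UniformCauchySeqOn (fun j => iteratedFDeriv ℝ k (q j)) atTop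
      (Metric.ball 0 r)) {F : E → ℝ} (hF : ∀ x, Tendsto (fun j => q j x) atTop (𝓝 (F x))) :
    ∃ p : E → FormalMultilinearSeries ℝ E ℝ, HasFTaylorSeriesUpTo (⊤ : ℕ∞) F p ∧
      ∀ k x, Tendsto (fun j => iteratedFDeriv ℝ k (q j) x) atTop (𝓝 (p x k)) := by
  have hmem : ∀ x : E, x ∈ Metric.ball (0 : E) (‖x‖ + 1) := fun x => by simp
  have hlim : ∀ (x : E) (k : ℕ), ∃ L, Tendsto (fun j => iteratedFDeriv ℝ k (q j) x) atTop (𝓝 L) :=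
    fun x k => cauchySeq_tendsto_of_complete ((hC k (‖x‖ + 1)).cauchySeq (hmem x))
  choose p hp using hlim
  have hu : ∀ (k : ℕ) (r : ℝ), TendstoUniformlyOn (fun j => iteratedFDeriv ℝ k (q j))
      (fun x => p x k) atTop (Metric.ball 0 r) := fun k r =>
    (hC k r).tendstoUniformlyOn_of_tendsto fun x _ => hp x k
  have hderiv : ∀ (m : ℕ) (x : E), HasFDerivAt (fun y => p y m) (p x (m + 1)).curryLeft x := by
    intro m x
    let e := continuousMultilinearCurryLeftEquiv ℝ (fun _ : Fin (m + 1) => E) ℝ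
    have h1 : TendstoUniformlyOn (fun j => e ∘ iteratedFDeriv ℝ (m + 1) (q j))
        (fun y => e (p y (m + 1))) atTop (Metric.ball 0 (‖x‖ + 1)) :=
      e.isometry.uniformContinuous.comp_tendstoUniformlyOn (hu (m + 1) _)
    refine hasFDerivAt_of_tendstoLocallyUniformlyOn Metric.isOpen_ball
      h1.tendstoLocallyUniformlyOn (fun j y _ => ?_) (fun y _ => hp y m) (hmem x)
    exact (hq j).ftaylorSeries.fderiv m (by exact_mod_cast ENat.natCast_lt_top m) y
  refine ⟨p, ⟨fun x => ?_, fun m _ x => hderiv m x, fun m _ => ?_⟩, fun k x => hp x k⟩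
  · have h1 := (continuousMultilinearCurryFin0 ℝ E ℝ).continuous.tendsto (p x 0)
    exact tendsto_nhds_unique (h1.comp (hp x 0)) (hF x)
  · exact continuous_iff_continuousAt.2 fun x => (hderiv m x).continuousAt

variable [FiniteDimensional ℝ E]

theorem contDiff_and_bound_of_tendsto_euclLap {q : ℕ → E → ℝ}
    (hq : ∀ j, ContDiff ℝ (⊤ : ℕ∞) (q j)) {H : ℕ → E → ℝ}
    (hH : ∀ j : ℕ, ∀ i ≤ j, ∀ x, ‖x‖ ≤ j + 1 → |euclLap^[i] (q j) x - H i x| ≤ 1 / (j + 1)) :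
    ContDiff ℝ (⊤ : ℕ∞) (H 0) ∧ ∀ {A r τ : ℝ} {k : ℕ}, 0 ≤ A → 1 ≤ τ →
      (∀ i ≤ k, ∀ x, ‖x‖ ≤ r + 1 → |H i x| ≤ A * τ ^ i) → ∀ {x}, ‖x‖ ≤ r →
      ‖iteratedFDeriv ℝ k (H 0) x‖ ≤ A * (finrank ℝ E * (k + 1) + τ / (2 * (k + 1))) ^ k := by
  have hlin : ∀ j l i, euclLap^[i] (fun x => 1 * q j x + (-1) * q l x) =
      fun x => 1 * euclLap^[i] (q j) x + (-1) * euclLap^[i] (q l) x := by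
    intro j l i
    induction i with
    | zero => rfl
    | succ i ih =>
      simp only [Function.iterate_succ_apply', ih]
      ext x
      rw [euclLap_lin (contDiff_iterate_euclLap (hq j) i) (contDiff_iterate_euclLap (hq l) i)]
  have hdiff : ∀ k : ℕ, ∀ r : ℝ, ∀ J : ℕ, k ≤ J → r ≤ J → ∀ j ≥ J, ∀ l ≥ J, ∀ x, ‖x‖ ≤ r →
      ‖iteratedFDeriv ℝ k (q j) x - iteratedFDeriv ℝ k (q l) x‖ ≤
        2 / (J + 1) * (finrank ℝ E * (k + 1) + 1 / (2 * (k + 1))) ^ k := by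
    intro k r J hkJ hrJ j hj l hl x hx
    have e : iteratedFDeriv ℝ k (q j) x - iteratedFDeriv ℝ k (q l) x =
        iteratedFDeriv ℝ k (fun x => 1 * q j x + (-1) * q l x) x := by
      have : (fun x => 1 * q j x + (-1) * q l x) = q j - q l := by
        ext y
        simp only [Pi.sub_apply]
        ring
      rw [this, iteratedFDeriv_sub_apply ((hq j).contDiffAt.of_le (by exact_mod_cast le_top))
        ((hq l).contDiffAt.of_le (by exact_mod_cast le_top))]
    rw [e]
    refine norm_iteratedFDeriv_le_of_euclLap
      ((contDiff_const.mul (hq j)).add (contDiff_const.mul (hq l))) (by positivity) zero_le_one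
      (fun i hi y hy => ?_) hx
    rw [hlin]
    beta_reduce
    have hjJ : (J : ℝ) ≤ j := by exact_mod_cast hj
    have hlJ : (J : ℝ) ≤ l := by exact_mod_cast hl
    have b1 := hH j i (by omega) y (by linarith)
    have b2 := hH l i (by omega) y (by linarith)
    have c1 : 1 / ((j : ℝ) + 1) ≤ 1 / (J + 1) := by gcongr
    have c2 : 1 / ((l : ℝ) + 1) ≤ 1 / (J + 1) := by gcongr
    have c3 : 2 / ((J : ℝ) + 1) = 1 / (J + 1) + 1 / (J + 1) := by ring
    rw [one_pow, mul_one, c3]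
    rw [abs_le] at b1 b2 ⊢
    constructor <;> linarith [b1.1, b1.2, b2.1, b2.2]
  have hC : ∀ k : ℕ, ∀ r : ℝ, UniformCauchySeqOn (fun j => iteratedFDeriv ℝ k (q j)) atTop
      (Metric.ball 0 r) := by
    intro k r
    rw [Metric.uniformCauchySeqOn_iff]
    intro ε hε
    have ht : Tendsto (fun J : ℕ => 2 / ((J : ℝ) + 1) *
        (finrank ℝ E * (k + 1) + 1 / (2 * (k + 1))) ^ k) atTop (𝓝 0) := by
      have h1 : Tendsto (fun J : ℕ => 2 * (1 / ((J : ℝ) + 1))) atTop (𝓝 (2 * 0)) :=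
        tendsto_one_div_add_atTop_nhds_zero_nat.const_mul 2
      have h2 := h1.mul_const (((finrank ℝ E : ℝ) * (k + 1) + 1 / (2 * (k + 1))) ^ k)
      simpa only [mul_one_div, mul_zero, zero_mul] using h2
    obtain ⟨J, hJε, hJk, hJr⟩ := ((ht.eventually_lt_const hε).and
      ((eventually_ge_atTop k).and (tendsto_natCast_atTop_atTop.eventually_ge_atTop r))).exists
    refine ⟨J, fun j hj l hl x hx => ?_⟩
    rw [dist_eq_norm]
    exact (hdiff k r J hJk hJr j hj l hl x (mem_ball_zero_iff.1 hx).le).trans_lt hJε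
  have hF : ∀ x, Tendsto (fun j => q j x) atTop (𝓝 (H 0 x)) := by
    intro x
    rw [tendsto_iff_norm_sub_tendsto_zero]
    refine squeeze_zero' (Eventually.of_forall fun _ => norm_nonneg _) ?_
      tendsto_one_div_add_atTop_nhds_zero_nat
    filter_upwards [tendsto_natCast_atTop_atTop.eventually_ge_atTop ‖x‖] with j hj
    exact hH j 0 (Nat.zero_le _) x (by linarith)
  obtain ⟨p, hp, hpt⟩ := hasFTaylorSeriesUpTo_of_uniformCauchySeqOn hq hC hF
  refine ⟨hp.contDiff, fun {A r τ k} hA hτ hHA x hx => ?_⟩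
  rw [← hp.eq_iteratedFDeriv (m := k) (by exact_mod_cast le_top) x]
  have ht : Tendsto (fun j : ℕ => (A + 1 / ((j : ℝ) + 1)) *
      (finrank ℝ E * (k + 1) + τ / (2 * (k + 1))) ^ k) atTop
      (𝓝 ((A + 0) * (finrank ℝ E * (k + 1) + τ / (2 * (k + 1))) ^ k)) :=
    (tendsto_one_div_add_atTop_nhds_zero_nat.const_add A).mul_const _
  rw [add_zero] at ht
  refine le_of_tendsto_of_tendsto (hpt k x).norm ht ?_
  filter_upwards [eventually_ge_atTop k,
    tendsto_natCast_atTop_atTop.eventually_ge_atTop r] with j hjk hjr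
  refine norm_iteratedFDeriv_le_of_euclLap (hq j) (by positivity) (by linarith)
    (fun i hi y hy => ?_) hx
  have b1 := hH j i (by omega) y (by linarith)
  have b2 := hHA i hi y hy
  have b3 : 1 / ((j : ℝ) + 1) * 1 ≤ 1 / ((j : ℝ) + 1) * τ ^ i := by
    gcongr
    exact one_le_pow₀ hτ
  rw [add_mul]
  rw [abs_le] at b1 b2 ⊢
  constructor <;> linarith [b1.1, b1.2, b2.1, b2.2]

end Limit

section InvariantExtension

open Set Topology Module Filter

variable {E : Type*} [NormedAddCommGroup E] [InnerProductSpace ℝ E] [FiniteDimensional ℝ E]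
  {G : Set (E →L[ℝ] E)} {hG : IsIsometryGroup G} {S : Submodule ℝ E}

theorem RootSystemData.exists_smooth_invariant_extension (R : RootSystemData hG S)
    (hS : IsLinearSection hG S) [Nontrivial S] {W : Subgroup (S ≃ₗᵢ[ℝ] S)} [Fintype W]
    (hW : ∀ w ∈ W, ∃ g ∈ G, ∀ s : S, g s = w s)
    (hW' : ∀ g ∈ G, (∀ u ∈ S, g u ∈ S) → ∃ w ∈ W, ∀ s : S, g s = w s)
    {f : S → ℝ} (hf : ContDiff ℝ (⊤ : ℕ∞) f) (hfW : ∀ w ∈ W, ∀ s, f (w s) = f s) :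
    ∃ F : E → ℝ, ContDiff ℝ (⊤ : ℕ∞) F ∧ (∀ g ∈ G, ∀ x, F (g x) = F x) ∧ (∀ s : S, F s = f s) ∧
      ∀ {A r τ : ℝ} {k : ℕ}, 0 ≤ A → 1 ≤ τ →
        (∀ i ≤ k, ∀ s, ‖s‖ ≤ r + 1 → |(meanRootLap R.root W)^[i] f s| ≤ A * τ ^ i) →
        ∀ {x}, ‖x‖ ≤ r →
        ‖iteratedFDeriv ℝ k F x‖ ≤ A * (finrank ℝ E * (k + 1) + τ / (2 * (k + 1))) ^ k := by
  have hinv : ∀ i, ∀ w ∈ W, ∀ s, (meanRootLap R.root W)^[i] f (w s) =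
      (meanRootLap R.root W)^[i] f s := by
    intro i w hw s
    rcases i with _ | i
    · exact hfW w hw s
    · rw [Function.iterate_succ_apply']
      exact meanRootLap_apply_mem _ _ hw s
  have hext := fun i => R.exists_continuous_extension hS
    (contDiff_iterate_meanRootLap (W := W) R.root hf i).continuous fun g hg hgS s t hst => by
      obtain ⟨w, hw, hws⟩ := hW' g hg hgS
      have : t = w s := Subtype.ext (by rw [← hst, hws])
      rw [this, hinv i w hw]
  choose H _ hHG hHf using hext
  have happ := fun j : ℕ => R.exists_simultaneous_approx hS hW hW' j hf hfW
    (ρ := j + 1) (by positivity) (ε := 1 / (j + 1)) (by positivity)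
  choose d q hq hqG hqa using happ
  have hmain := contDiff_and_bound_of_tendsto_euclLap (fun j => (hq j).1) (H := H) (by
    intro j i hi x hx
    obtain ⟨g, hg, hgS⟩ := hS.meets x
    rw [← hHG i g hg x, ← iterate_euclLap_apply_of_invariant (hq j).1 (hG.norm_map g hg)
      (hqG j g hg) i x, hHf i ⟨g x, hgS⟩]
    exact hqa j i hi ⟨g x, hgS⟩ ((hG.norm_map g hg x).trans_le hx))
  refine ⟨H 0, hmain.1, hHG 0, hHf 0, fun {A r τ k} hA hτ h {x} hx => ?_⟩
  refine hmain.2 hA hτ (fun i hi y hy => ?_) hx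
  obtain ⟨g, hg, hgS⟩ := hS.meets y
  rw [← hHG i g hg y, hHf i ⟨g y, hgS⟩]
  exact h i hi ⟨g y, hgS⟩ ((hG.norm_map g hg y).trans_le hy)

theorem RootSystemData.exists_denjoyCarleman_invariant_extension (R : RootSystemData hG S)
    (hS : IsLinearSection hG S) [Nontrivial S] {W : Subgroup (S ≃ₗᵢ[ℝ] S)} [Fintype W]
    (hW : ∀ w ∈ W, ∃ g ∈ G, ∀ s : S, g s = w s)
    (hW' : ∀ g ∈ G, (∀ u ∈ S, g u ∈ S) → ∃ w ∈ W, ∀ s : S, g s = w s)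
    {f : S → ℝ} (hf : ContDiff ℝ (⊤ : ℕ∞) f) (hfW : ∀ w ∈ W, ∀ s, f (w s) = f s)
    {M : ℕ → ℝ} (hM0 : ∀ k, 0 < M k) (hM : Monotone M)
    (hfM : ∀ r, ∃ C ρ : ℝ, ∀ k, ∀ s, ‖s‖ ≤ r → ‖iteratedFDeriv ℝ k f s‖ ≤ C * ρ ^ k * k ! * M k) :
    ∃ F : E → ℝ, ContDiff ℝ (⊤ : ℕ∞) F ∧ (∀ g ∈ G, ∀ x, F (g x) = F x) ∧ (∀ s : S, F s = f s) ∧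
      ∀ r, ∃ C > 0, ∃ ρ > 0, ∀ k, ∀ x, ‖x‖ ≤ r →
        ‖iteratedFDeriv ℝ k F x‖ ≤ C * ρ ^ k * k ! * M (2 * k) := by
  obtain ⟨F, hF, hFG, hFf, hFb⟩ := R.exists_smooth_invariant_extension hS hW hW' hf hfW
  refine ⟨F, hF, hFG, hFf, fun r => ?_⟩
  obtain ⟨C₀, ρ₀, h₀⟩ := hfM (r + 1)
  set C := max |C₀| 1
  set ρ := max |ρ₀| 1
  have hC : 1 ≤ C := le_max_right _ _
  have hρ : 1 ≤ ρ := le_max_right _ _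
  have h : ∀ k, ∀ s, ‖s‖ ≤ r + 1 → ‖iteratedFDeriv ℝ k f s‖ ≤ C * ρ ^ k * k ! * M k := by
    intro k s hs
    refine (h₀ k s hs).trans ?_
    have := (hM0 k).le
    refine mul_le_mul_of_nonneg_right (mul_le_mul_of_nonneg_right ?_ (by positivity)) this
    calc C₀ * ρ₀ ^ k ≤ C * |ρ₀ ^ k| := by
          refine (le_abs_self _).trans ?_
          rw [abs_mul]
          gcongr
          exact le_max_left _ _
      _ ≤ C * ρ ^ k := by
          rw [abs_pow]
          gcongr
          exact le_max_left _ _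
  set c : ℝ := finrank ℝ S + Fintype.card (Fin (finrank ℝ Sᗮ))
  have hc : 1 ≤ c := by
    have : (1 : ℝ) ≤ finrank ℝ S := by exact_mod_cast (finrank_pos (R := ℝ) (M := S))
    exact le_add_of_le_of_nonneg this (Nat.cast_nonneg _)
  set K := finrank ℝ E + 2 * c * ρ ^ 2
  have hK : 0 < K := by positivity
  refine ⟨C * Real.exp 1, by positivity, K * Real.exp 1, by positivity, fun k x hx => ?_⟩
  have hM2 := (hM0 (2 * k)).le
  set τ := 4 * c * ρ ^ 2 * (k + 1) ^ 2
  have hτ : 1 ≤ τ := by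
    have h1 : 1 ≤ c * ρ ^ 2 * (k + 1) ^ 2 :=
      one_le_mul_of_one_le_of_one_le (one_le_mul_of_one_le_of_one_le hc (one_le_pow₀ hρ))
        (one_le_pow₀ (by linarith [Nat.cast_nonneg (α := ℝ) k]))
    have h2 : τ = 4 * (c * ρ ^ 2 * (k + 1) ^ 2) := by ring
    linarith
  have hL : ∀ i ≤ k, ∀ s, ‖s‖ ≤ r + 1 →
      |(meanRootLap R.root W)^[i] f s| ≤ C * M (2 * k) * τ ^ i := by
    intro i hi s hs
    have h1 := norm_iteratedFDeriv_iterate_meanRootLap_le (W := W) R.root_ne_zero hf i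
      (j := 0) (R := r + 1) (B := C * ρ ^ (2 * i) * (2 * i)! * M (2 * i))
      (fun y hy => by rw [zero_add]; exact h _ y hy) hs
    rw [norm_iteratedFDeriv_zero, Real.norm_eq_abs] at h1
    refine h1.trans ?_
    have h2 : ((2 * i)! : ℝ) ≤ (4 * (k + 1) ^ 2) ^ i := by
      have : (2 * i)! ≤ (2 * (k + 1)) ^ (2 * i) :=
        (Nat.factorial_le_pow _).trans (Nat.pow_le_pow_left (by omega) _)
      have h3 : ((2 * i)! : ℝ) ≤ (2 * (k + 1)) ^ (2 * i) := by exact_mod_cast this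
      refine h3.trans_eq ?_
      rw [pow_mul]
      ring
    have h4 : M (2 * i) ≤ M (2 * k) := hM (by omega)
    have h5 := (hM0 (2 * i)).le
    calc c ^ i * (C * ρ ^ (2 * i) * (2 * i)! * M (2 * i))
        ≤ c ^ i * (C * ρ ^ (2 * i) * (4 * (k + 1) ^ 2) ^ i * M (2 * k)) := by gcongr
      _ = C * M (2 * k) * τ ^ i := by
        simp only [τ, mul_pow, pow_mul]
        ring
  refine (hFb (by positivity) hτ hL hx).trans ?_
  have e1 : finrank ℝ E * ((k : ℝ) + 1) + τ / (2 * (k + 1)) = K * (k + 1) := by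
    simp only [K, τ]
    field_simp
    ring
  have e2 : ((k : ℝ) + 1) ^ k ≤ Real.exp 1 * Real.exp 1 ^ k * k ! := by
    have := Real.pow_div_factorial_le_exp ((k : ℝ) + 1) (by positivity) k
    rw [div_le_iff₀ (by positivity)] at this
    refine this.trans_eq ?_
    rw [← Real.exp_nat_mul, ← Real.exp_add]
    ring_nf
  rw [e1, mul_pow]
  calc C * M (2 * k) * (K ^ k * ((k : ℝ) + 1) ^ k)
      ≤ C * M (2 * k) * (K ^ k * (Real.exp 1 * Real.exp 1 ^ k * k !)) := by gcongr
    _ = _ := by rw [mul_pow K]; ring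

end InvariantExtension

section DenjoyCarlemanClass

variable {E F : Type*} [NormedAddCommGroup E] [NormedSpace ℝ E]
  [NormedAddCommGroup F] [NormedSpace ℝ F]

theorem cmClassOn_univ_iff {M : ℕ → ℝ} {f : E → ℝ} :
    CMClassOn M Set.univ f ↔ ContDiff ℝ (⊤ : ℕ∞) f ∧ ∀ K : Set E, IsCompact K →
      ∃ C > (0 : ℝ), ∃ ρ > (0 : ℝ), ∀ k : ℕ, ∀ x ∈ K,
        ‖iteratedFDeriv ℝ k f x‖ ≤ C * ρ ^ k * (k ! : ℝ) * M k := by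
  simp only [CMClassOn, contDiffOn_univ, Set.subset_univ, forall_const, iteratedFDerivWithin_univ]

theorem CMClassOn.comp_clm {M : ℕ → ℝ} (hM : ∀ k, 0 < M k) {f : E → ℝ}
    (hf : CMClassOn M Set.univ f) (g : F →L[ℝ] E) : CMClassOn M Set.univ (f ∘ g) := by
  rw [cmClassOn_univ_iff] at hf ⊢
  refine ⟨hf.1.comp g.contDiff, fun K hK => ?_⟩
  obtain ⟨C, hC, ρ, hρ, h⟩ := hf.2 _ (hK.image g.continuous)
  refine ⟨C, hC, ρ * (‖g‖ + 1), by positivity, fun k x hx => ?_⟩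
  have hMk := (hM k).le
  rw [g.iteratedFDeriv_comp_right hf.1 x (by exact_mod_cast le_top)]
  refine (ContinuousMultilinearMap.norm_compContinuousLinearMap_le _ _).trans ?_
  rw [Finset.prod_const, Finset.card_univ, Fintype.card_fin]
  calc _ ≤ C * ρ ^ k * k ! * M k * (‖g‖ + 1) ^ k := by
        gcongr
        · exact h k _ (Set.mem_image_of_mem g hx)
        · linarith
    _ = _ := by rw [mul_pow]; ring

theorem CMClassOn.of_le_pow_mul {M N : ℕ → ℝ} {A : ℝ} (hA : 0 < A)
    (h : ∀ k, M k ≤ A ^ k * N k) {f : E → ℝ} (hf : CMClassOn M Set.univ f) :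
    CMClassOn N Set.univ f := by
  rw [cmClassOn_univ_iff] at hf ⊢
  refine ⟨hf.1, fun K hK => ?_⟩
  obtain ⟨C, hC, ρ, hρ, hb⟩ := hf.2 K hK
  refine ⟨C, hC, ρ * A, by positivity, fun k x hx => (hb k x hx).trans ?_⟩
  calc _ ≤ C * ρ ^ k * k ! * (A ^ k * N k) := by gcongr; exact h k
    _ = _ := by rw [mul_pow]; ring

theorem DCWeightSeq.monotone {M : ℕ → ℝ} (hM : DCWeightSeq M) : Monotone M :=
  monotone_nat_of_le_succ hM.2.2.1

theorem DCWeightSeq.exists_le_pow_mul {M N : ℕ → ℝ} (hM : DCWeightSeq M) (hN : DCWeightSeq N)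
    {m : ℕ} (hMN : ∃ C : ℝ, ∀ k : ℕ, 1 ≤ k → (M (k * m) / N k) ^ ((1 : ℝ) / k) ≤ C) :
    ∃ A > (0 : ℝ), ∀ j k : ℕ, j ≤ k * m → M j ≤ A ^ k * N k := by
  obtain ⟨C, hC⟩ := hMN
  refine ⟨max C 1, by positivity, fun j k hj => (hM.monotone hj).trans ?_⟩
  rcases Nat.eq_zero_or_pos k with rfl | hk
  · simp [hM.1, hN.1]
  have hNk := hN.2.1 k
  rw [← div_le_iff₀ hNk]
  have h0 : 0 ≤ M (k * m) / N k := (div_pos (hM.2.1 _) hNk).le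
  calc M (k * m) / N k = ((M (k * m) / N k) ^ ((1 : ℝ) / k)) ^ k := by
        rw [one_div, Real.rpow_inv_natCast_pow h0 hk.ne']
    _ ≤ max C 1 ^ k := by
        gcongr
        exact (hC k hk).trans (le_max_left _ _)

end DenjoyCarlemanClass

section WeylGroup

variable {E : Type*} [NormedAddCommGroup E] [InnerProductSpace ℝ E]
  {G : Set (E →L[ℝ] E)}

/-- The isometries of `S` induced by elements of `G`. -/
def IsIsometryGroup.weylGroup (hG : IsIsometryGroup G) (S : Submodule ℝ E) :
    Subgroup (S ≃ₗᵢ[ℝ] S) where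
  carrier := {w | ∃ g ∈ G, ∀ s : S, g s = w s}
  mul_mem' := by
    rintro w₁ w₂ ⟨g₁, h₁, hw₁⟩ ⟨g₂, h₂, hw₂⟩
    refine ⟨g₁ * g₂, hG.mul_mem _ h₁ _ h₂, fun s => ?_⟩
    change g₁ (g₂ s) = w₁ (w₂ s)
    rw [hw₂, hw₁]
  one_mem' := ⟨1, hG.one_mem, fun _ => rfl⟩
  inv_mem' := by
    rintro w ⟨g, hg, hw⟩
    obtain ⟨h, hh, hhg, -⟩ := hG.inv_mem g hg
    refine ⟨h, hh, fun s => ?_⟩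
    have h1 : g (w⁻¹ s : S) = s := by
      rw [hw]
      exact congrArg Subtype.val (w.apply_symm_apply s)
    rw [← h1]
    exact DFunLike.congr_fun hhg _

theorem IsIsometryGroup.exists_mem_weylGroup [FiniteDimensional ℝ E] (hG : IsIsometryGroup G)
    {S : Submodule ℝ E} {g : E →L[ℝ] E} (hg : g ∈ G) (hgS : ∀ u ∈ S, g u ∈ S) :
    ∃ w ∈ hG.weylGroup S, ∀ s : S, g s = w s := by
  let L : S →ₗᵢ[ℝ] S := ⟨g.toLinearMap.restrict hgS, fun s => hG.norm_map g hg s⟩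
  exact ⟨L.toLinearIsometryEquiv rfl, ⟨g, hg, fun _ => rfl⟩, fun _ => rfl⟩

theorem RootSystemData.nontrivial_weylGroup [FiniteDimensional ℝ E] {hG : IsIsometryGroup G}
    {S : Submodule ℝ E} (R : RootSystemData hG S) (hS : IsLinearSection hG S)
    (i : Fin (Module.finrank ℝ Sᗮ)) : Nontrivial (hG.weylGroup S) := by
  obtain ⟨k, hk, hks⟩ := R.exists_reflection hS i
  obtain ⟨w, hw, hkw⟩ := hG.exists_mem_weylGroup (S := S) hk fun u hu => by
    rw [hks u hu]
    exact S.sub_mem hu (S.smul_mem _ (R.l_mem i))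
  refine ⟨⟨w, hw⟩, 1, fun h => ?_⟩
  have h1 : w = 1 := congrArg Subtype.val h
  have h2 := hkw (R.root i)
  have h3 : (R.root i : E) = R.l i := rfl
  have h4 : ‖R.l i‖ ^ 2 ≠ 0 := by
    have := R.l_ne_zero i
    positivity
  rw [h1, h3, hks _ (R.l_mem i), real_inner_self_eq_norm_sq, mul_div_assoc, div_self h4] at h2
  have h5 : R.l i - (2 * 1 : ℝ) • R.l i = R.l i := h2
  rw [mul_one, sub_eq_self] at h5
  exact R.l_ne_zero i ((smul_eq_zero_iff_right two_ne_zero).1 h5)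

end WeylGroup

section MatrixGroup

open Module

variable {n : ℕ}

theorem isIsometryGroup_image_toEuclideanCLM {G : Subgroup (GL (Fin n) ℝ)}
    (hGorth : ∀ g ∈ G, g.val * g.valᵀ = 1)
    (hGcpt : IsCompact ((Units.val : GL (Fin n) ℝ → Matrix (Fin n) (Fin n) ℝ) ''
      (G : Set (GL (Fin n) ℝ)))) :
    IsIsometryGroup ((fun g : GL (Fin n) ℝ => toEuclideanCLM (n := Fin n) (𝕜 := ℝ) g.val) ''
      (G : Set (GL (Fin n) ℝ))) where
  one_mem := ⟨1, G.one_mem, map_one _⟩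
  mul_mem := by
    rintro _ ⟨g, hg, rfl⟩ _ ⟨h, hh, rfl⟩
    exact ⟨g * h, G.mul_mem hg hh, map_mul _ _ _⟩
  inv_mem := by
    rintro _ ⟨g, hg, rfl⟩
    refine ⟨_, ⟨g⁻¹, G.inv_mem hg, rfl⟩, ?_, ?_⟩
    · rw [← map_mul, ← Units.val_mul, inv_mul_cancel, Units.val_one, map_one]
    · rw [← map_mul, ← Units.val_mul, mul_inv_cancel, Units.val_one, map_one]
  norm_map := by
    rintro _ ⟨g, hg, rfl⟩ x
    have h : g.valᵀ * g.val = 1 := mul_eq_one_comm.1 (hGorth g hg)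
    rw [← sq_eq_sq₀ (norm_nonneg _) (norm_nonneg _), ← real_inner_self_eq_norm_sq,
      EuclideanSpace.real_norm_sq_eq x, inner_toEuclideanCLM, ofLp_toEuclideanCLM,
      dotProduct_mulVec, ← mulVec_transpose, mulVec_mulVec, h, one_mulVec]
    simp [dotProduct, sq]
  isCompact := by
    have hc : Continuous (toEuclideanCLM (n := Fin n) (𝕜 := ℝ)) :=
      LinearMap.continuous_of_finiteDimensional
        ((toEuclideanCLM (n := Fin n) (𝕜 := ℝ)).toAlgEquiv.toLinearMap)
    rw [← Set.image_image (fun A => toEuclideanCLM (n := Fin n) (𝕜 := ℝ) A) Units.val]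
    exact hGcpt.image hc

end MatrixGroup

/-- Let `G` be a compact subgroup of `O(n)` acting on `ℝⁿ` with a section
`Σ` and generalized Weyl group `W(Σ)` finite of order `m`.  Let `M`, `N` be DC-weight
sequences with `N` strongly regular and `sup_k (M (km) / N k)^(1/k) < ∞`.  Then every
`W`-invariant `f ∈ C^M(Σ)` has a `G`-invariant extension of class `C^N` to `ℝⁿ`. -/
theorem invariant_extension_from_section
    (n m : ℕ) (hm : 0 < m)
    (G : Subgroup (GL (Fin n) ℝ))
    (hGorth : ∀ g ∈ G, g.val * g.valᵀ = 1)
    (hGcpt : IsCompact ((Units.val : GL (Fin n) ℝ → Matrix (Fin n) (Fin n) ℝ) ''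
      (G : Set (GL (Fin n) ℝ))))
    (S : Submodule ℝ (Fin n → ℝ))
    (hSmeets : ∀ v : Fin n → ℝ, ∃ g ∈ G, g.val.mulVec v ∈ S)
    (hSorth : ∀ s ∈ S, ∀ c : ℝ → (Fin n → ℝ), ContDiff ℝ 1 c → c 0 = s →
      (∀ t : ℝ, ∃ g ∈ G, c t = g.val.mulVec s) →
      ∀ u ∈ S, ∑ i, deriv c 0 i * u i = 0)
    (hW : Nat.card {φW : S → (Fin n → ℝ) // ∃ g ∈ G,
      Submodule.map (Matrix.mulVecLin g.val) S = S ∧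
      ∀ s : S, φW s = g.val.mulVec (s : Fin n → ℝ)} = m)
    (M N : ℕ → ℝ) (hM : DCWeightSeq M) (hN : DCWeightSeq N)
    (hNsr : StronglyRegular N)
    (hMN : ∃ C : ℝ, ∀ k : ℕ, 1 ≤ k → (M (k * m) / N k) ^ ((1 : ℝ) / k) ≤ C)
    (f : S → ℝ) (hf : CMClassOn M Set.univ f)
    (hfinv : ∀ g ∈ G, Submodule.map (Matrix.mulVecLin g.val) S = S →
      ∀ s t : S, (t : Fin n → ℝ) = g.val.mulVec (s : Fin n → ℝ) → f t = f s) :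
    ∃ ftilde : (Fin n → ℝ) → ℝ, CMClassOn N Set.univ ftilde ∧
      (∀ g ∈ G, ∀ x : Fin n → ℝ, ftilde (g.val.mulVec x) = ftilde x) ∧
      ∀ s : S, ftilde (s : Fin n → ℝ) = f s := by
  classical
  obtain ⟨A, hA, hMNA⟩ := hM.exists_le_pow_mul hN hMN
  by_cases hST : S = ⊤
  · refine ⟨f ∘ (ContinuousLinearMap.id ℝ (Fin n → ℝ)).codRestrict S fun x => hST ▸ trivial,
      (hf.comp_clm hM.2.1 _).of_le_pow_mul hA fun k => hMNA k k (Nat.le_mul_of_pos_right k hm),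
      fun g hg x => ?_, fun s => rfl⟩
    refine hfinv g hg ?_ _ _ rfl
    refine Submodule.eq_of_le_of_finrank_eq (fun x _ => hST ▸ trivial) ?_
    exact (Submodule.equivMapOfInjective _ (mulVec_injective_of_isUnit g.isUnit) S).finrank_eq.symm
  set e : EuclideanSpace ℝ (Fin n) ≃L[ℝ] (Fin n → ℝ) := EuclideanSpace.equiv (Fin n) ℝ
  have hG := isIsometryGroup_image_toEuclideanCLM hGorth hGcpt
  set S' : Submodule ℝ (EuclideanSpace ℝ (Fin n)) := S.comap e.toLinearMap
  have hmap : ∀ g ∈ G, (∀ u ∈ S', toEuclideanCLM (n := Fin n) (𝕜 := ℝ) g.val u ∈ S') →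
      Submodule.map (Matrix.mulVecLin g.val) S = S := by
    intro g hg h
    refine Submodule.eq_of_le_of_finrank_eq ?_ ?_
    · rintro _ ⟨u, hu, rfl⟩
      exact h (e.symm u) hu
    · exact (Submodule.equivMapOfInjective _
        (mulVec_injective_of_isUnit g.isUnit) S).finrank_eq.symm
  have hS : IsLinearSection hG S' := by
    refine ⟨fun v => ?_, fun B hB s hs u hu => ?_⟩
    · obtain ⟨g, hg, h⟩ := hSmeets (e v)
      exact ⟨_, ⟨g, hg, rfl⟩, h⟩
    · have hd : HasDerivAt (fun t : ℝ => e (NormedSpace.exp (t • B) s)) (e (B s)) 0 :=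
        e.toContinuousLinearMap.hasFDerivAt.comp_hasDerivAt 0 (hasDerivAt_clm_exp_apply_zero B s)
      have := hSorth (e s) hs (fun t => e (NormedSpace.exp (t • B) s)) ?_ (by simp) (fun t => ?_)
        (e u) hu
      · rw [hd.deriv] at this
        rw [PiLp.inner_apply, ← this]
        exact Finset.sum_congr rfl fun i _ => mul_comm _ _
      · have h1 : ContDiff ℝ 1 fun t : ℝ => NormedSpace.exp (t • B) :=
          (contDiff_clm_exp.of_le le_top).comp (contDiff_id.smul contDiff_const)
        exact e.contDiff.comp (h1.clm_apply contDiff_const)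
      · obtain ⟨g, hg, h⟩ := (mem_lieSubmodule hG).1 hB t
        exact ⟨g, hg, by rw [← h]; rfl⟩
  obtain ⟨R⟩ := hS.exists_rootSystemData
  have hpos : 0 < Module.finrank ℝ S'ᗮ := by
    rw [Module.finrank_pos_iff, Submodule.nontrivial_iff_ne_bot, Ne,
      Submodule.orthogonal_eq_bot_iff]
    intro h
    refine hST (Submodule.eq_top_iff'.2 fun x => ?_)
    have : e.symm x ∈ S' := h ▸ trivial
    exact this
  have hSn : Nontrivial S' := ⟨R.root ⟨0, hpos⟩, 0, R.root_ne_zero _⟩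
  have hWn : Nontrivial (hG.weylGroup S') := R.nontrivial_weylGroup hS ⟨0, hpos⟩
  set T := {φW : S → (Fin n → ℝ) // ∃ g ∈ G,
      Submodule.map (Matrix.mulVecLin g.val) S = S ∧
      ∀ s : S, φW s = g.val.mulVec (s : Fin n → ℝ)}
  have hTfin : Finite T := Nat.finite_of_card_ne_zero (hW ▸ hm.ne')
  let ι : hG.weylGroup S' → T := fun w => ⟨fun s => e (w.1 ⟨e.symm s, s.2⟩), by
    obtain ⟨_, ⟨g, hg, rfl⟩, h⟩ := w.2
    refine ⟨g, hg, hmap g hg fun u hu => ?_, fun s => ?_⟩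
    · rw [h ⟨u, hu⟩]
      exact (w.1 ⟨u, hu⟩).2
    · exact congrArg e (h ⟨e.symm s, s.2⟩).symm⟩
  have hι : Function.Injective ι := by
    intro w₁ w₂ h
    refine Subtype.ext (LinearIsometryEquiv.ext fun s => Subtype.ext (e.injective ?_))
    exact congrFun (congrArg Subtype.val h) ⟨e s, s.2⟩
  have hWfin : Finite (hG.weylGroup S') := Finite.of_injective ι hι
  have hm2 : 2 ≤ m := by
    have : Nontrivial T := hι.nontrivial
    rw [← hW]
    exact Finite.one_lt_card
  let j : S' →L[ℝ] S := (e.toContinuousLinearMap.comp S'.subtypeL).codRestrict S fun s => s.2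
  have hfj := hf.comp_clm hM.2.1 j
  have hfj' := cmClassOn_univ_iff.1 hfj
  cases nonempty_fintype (hG.weylGroup S')
  obtain ⟨F, hF, hFG, hFf, hFb⟩ := R.exists_denjoyCarleman_invariant_extension hS
    (W := hG.weylGroup S') (fun w hw => hw)
    (fun g hg hgS => hG.exists_mem_weylGroup hg hgS) hfj'.1
    (by
      rintro w ⟨_, ⟨g, hg, rfl⟩, h⟩ s
      refine hfinv g hg (hmap g hg fun u hu => ?_) _ _ (congrArg e (h s).symm)
      rw [h ⟨u, hu⟩]
      exact (w ⟨u, hu⟩).2)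
    hM.2.1 hM.monotone
    (fun r => by
      obtain ⟨C, -, ρ, -, h⟩ := hfj'.2 _ (isCompact_closedBall 0 r)
      exact ⟨C, ρ, fun k s hs => h k s (mem_closedBall_zero_iff.2 hs)⟩)
  have hFM : CMClassOn (fun k => M (2 * k)) Set.univ F := by
    refine cmClassOn_univ_iff.2 ⟨hF, fun K hK => ?_⟩
    obtain ⟨r, hr⟩ := hK.isBounded.exists_norm_le
    obtain ⟨C, hC, ρ, hρ, h⟩ := hFb r
    exact ⟨C, hC, ρ, hρ, fun k x hx => h k x (hr x hx)⟩
  refine ⟨F ∘ e.symm, (hFM.comp_clm (fun k => hM.2.1 _)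
    e.symm.toContinuousLinearMap).of_le_pow_mul hA fun k => hMNA _ k ?_, fun g hg x => ?_,
    fun s => ?_⟩
  · rw [mul_comm]
    exact Nat.mul_le_mul_left k hm2
  · exact hFG _ ⟨g, hg, rfl⟩ (e.symm x)
  · exact hFf ⟨e.symm s, s.2⟩
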